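/- Let k be an algebraically closed field of characteristic zero, let R be an affine domain over k that is a Dedekind domain (the coordinate ring of a smooth affine curve T), and let B be a regular affine domain over k of Krull dimension 3 that is a smooth R-algebra with B/mB k-isomorphic to the polynomial ring k[x, y] for every maximal ideal m of R. Let δ be a locally nilpotent R-derivation of B such that the induced derivation δ_m on B/mB is nonzero for every maximal ideal m of R, and let A = Ker δ. Then: (1) A is a finitely generated normal k-algebra of Krull dimension 2; (2) A is a flat R-algebra; (3) for every maximal ideal m of R the fiber ring A ⊗_R R/m is k-isomorphic to a polynomial ring k[x] in one variable; and (4) Spec A → Spec R is an 𝔸¹-bundle in the Zariski topology: for every maximal ideal m of R there exists s ∈ R ∖ m such that A_s is R_s-isomorphic to the polynomial ring R_s[x]. -/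

import Mathlib

open scoped TensorProduct

universe u

/-- The kernel of an `R`-derivation of `B`, as an `R`-subalgebra of `B`. -/
def Derivation.kerSubalgebra {R B : Type*} [CommRing R] [CommRing B] [Algebra R B]
    (δ : Derivation R B B) : Subalgebra R B where
  carrier := {b : B | δ b = 0}
  add_mem' := by
    intro a b (ha : δ a = 0) (hb : δ b = 0)
    show δ (a + b) = 0
    rw [map_add, ha, hb, add_zero]
  mul_mem' := by
    intro a b (ha : δ a = 0) (hb : δ b = 0)
    show δ (a * b) = 0
    rw [Derivation.leibniz, ha, hb, smul_zero, smul_zero, add_zero]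
  algebraMap_mem' := fun r => δ.map_algebraMap r

theorem isIntegrallyClosed_of_etale (P S : Type*) [CommRing P] [IsDomain P] [IsIntegrallyClosed P]
    [CommRing S] [IsDomain S] [Algebra P S] [Algebra.Etale P S]
    (X : Type*) [Field X] [Algebra P X] [IsFractionRing P X] : IsIntegrallyClosed S := by
  have hflat : Module.Flat P S := inferInstance
  have : FaithfulSMul P S := inferInstance
  have hloc : IsLocalization (Algebra.algebraMapSubmonoid S (nonZeroDivisors P)) (S ⊗[P] X) :=
    inferInstance
  have hle : Algebra.algebraMapSubmonoid S (nonZeroDivisors P) ≤ nonZeroDivisors S :=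
    algebraMapSubmonoid_le_nonZeroDivisors_of_faithfulSMul S fun ⦃x⦄ a ↦ a
  have hdom : IsDomain (S ⊗[P] X) := IsLocalization.isDomain_of_le_nonZeroDivisors _ hle
  let e : S ⊗[P] X ≃ₐ[P] X ⊗[P] S := Algebra.TensorProduct.comm P S X
  have hdom' : IsDomain (X ⊗[P] S) := e.symm.toMulEquiv.isDomain (S ⊗[P] X)
  have hfin : Module.Finite X (X ⊗[P] S) := Algebra.FormallyUnramified.finite_of_free X (X ⊗[P] S)
  have hfield : IsField (X ⊗[P] S) :=
    isField_of_isIntegral_of_isField' (Field.toIsField X)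
  have hfield' : IsField (S ⊗[P] X) := e.toMulEquiv.isField hfield
  let _ := hfield'.toField
  have h1 : IsIntegrallyClosed (S ⊗[P] X) := Field.instIsIntegrallyClosed (S ⊗[P] X)
  have : FaithfulSMul S (S ⊗[P] X) := by
    rw [faithfulSMul_iff_algebraMap_injective]
    exact IsLocalization.injective _ hle
  have : IsIntegrallyClosedIn S (S ⊗[P] X) := by
    rw [isIntegrallyClosedIn_iff]
    refine ⟨FaithfulSMul.algebraMap_injective _ _, fun {x} hx ↦ ?_⟩
    obtain ⟨y, hy⟩ := (TensorProduct.toIntegralClosure_bijective_of_smooth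
      (R := P) (S := S) (B := X)).2 ⟨x, hx⟩
    have hy' : (Algebra.TensorProduct.map (AlgHom.id S S) (integralClosure P X).val) y = x :=
      congrArg Subtype.val hy
    rw [← hy']
    clear hy hy' hx
    induction y with
    | zero => exact ⟨0, by simp⟩
    | add a b ha hb =>
      obtain ⟨a', ha⟩ := ha
      obtain ⟨b', hb⟩ := hb
      exact ⟨a' + b', by rw [map_add, map_add, ha, hb]⟩
    | tmul s z =>
      obtain ⟨p, hp⟩ := IsIntegrallyClosed.isIntegral_iff.mp z.2
      refine ⟨p • s, ?_⟩
      have h2 : (p • s) ⊗ₜ[P] (1 : X) = s ⊗ₜ[P] (algebraMap P X p : X) := by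
        rw [TensorProduct.smul_tmul, Algebra.algebraMap_eq_smul_one (A := X)]
      rw [Algebra.TensorProduct.algebraMap_apply]
      simp only [Algebra.TensorProduct.map_tmul, Subalgebra.coe_val, ← hp]
      exact h2
  exact IsIntegrallyClosed.of_isIntegrallyClosed_of_isIntegrallyClosedIn S (S ⊗[P] X)

theorem isIntegrallyClosed_of_smooth (k B : Type*) [Field k] [CommRing B] [IsDomain B] [Algebra k B]
    [Algebra.Smooth k B] : IsIntegrallyClosed B := by
  let X := FractionRing B
  rw [isIntegrallyClosed_iff X]
  intro x hx
  let I : Ideal B :=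
    { carrier := {b | ∃ y : B, algebraMap B X y = algebraMap B X b * x}
      zero_mem' := ⟨0, by simp⟩
      add_mem' := by
        rintro a b ⟨y, hy⟩ ⟨z, hz⟩
        exact ⟨y + z, by simp [hy, hz, add_mul]⟩
      smul_mem' := by
        rintro c b ⟨y, hy⟩
        exact ⟨c * y, by simp [hy, mul_assoc]⟩ }
  suffices h : I = ⊤ by
    obtain ⟨y, hy⟩ : (1 : B) ∈ I := h ▸ Submodule.mem_top
    exact ⟨y, by simpa using hy⟩
  by_contra hI
  obtain ⟨p, hp, hIp⟩ := Ideal.exists_le_maximal I hI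
  have := hp.isPrime
  obtain ⟨f, hf, n, _, _, h⟩ :=
    Algebra.IsSmoothAt.exists_isStandardEtale_mvPolynomial (R := k) (S := B) (p := p)
  have hf0 : f ≠ 0 := by rintro rfl; exact hf p.zero_mem
  have hle : Submonoid.powers f ≤ nonZeroDivisors B :=
    powers_le_nonZeroDivisors_of_noZeroDivisors hf0
  have hd : IsDomain (Localization.Away f) := IsLocalization.isDomain_localization hle
  have : IsIntegrallyClosed (Localization.Away f) :=
    isIntegrallyClosed_of_etale (MvPolynomial (Fin n) k) _ (FractionRing (MvPolynomial (Fin n) k))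
  let L := Localization.subalgebra X (Submonoid.powers f) hle
  have : IsIntegrallyClosed L := this.of_equiv
    (IsLocalization.algEquiv (Submonoid.powers f) (Localization.Away f) L).toRingEquiv
  obtain ⟨y, hy⟩ := IsIntegrallyClosed.isIntegral_iff.mp (hx.tower_top (A := L))
  obtain ⟨⟨b, s, N, rfl⟩, hs⟩ := IsLocalization.surj (Submonoid.powers f) y
  apply hf
  apply hp.isPrime.mem_of_pow_mem N
  apply hIp
  refine ⟨b, ?_⟩
  have := congrArg (algebraMap L X) hs
  simp only [map_mul, ← IsScalarTower.algebraMap_apply, hy] at this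
  rw [← this, mul_comm]

section LocallyNilpotent

variable {R B : Type*} [CommRing R] [CommRing B] [Algebra R B]

/-- A derivation, viewed as linear over its kernel. -/
def Derivation.overKer (δ : Derivation R B B) : Derivation δ.kerSubalgebra B B :=
  Derivation.mk'
    { toFun := δ
      map_add' := map_add δ
      map_smul' := fun a b ↦ by
        have h : δ (a : B) = 0 := a.2
        simp [Subalgebra.smul_def, h] }
    (fun a b ↦ δ.leibniz a b)

@[simp]
lemma Derivation.overKer_apply (δ : Derivation R B B) (b : B) : δ.overKer b = δ b := rfl

lemma Derivation.mem_kerSubalgebra (δ : Derivation R B B) {b : B} :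
    b ∈ δ.kerSubalgebra ↔ δ b = 0 := Iff.rfl

lemma Derivation.mem_kerSubalgebra_of_isAlgebraic [IsDomain B] [CharZero B]
    (δ : Derivation R B B) {b : B} (hb : IsAlgebraic δ.kerSubalgebra b) :
    b ∈ δ.kerSubalgebra := by
  by_contra hne
  have key : ∀ n : ℕ, ∀ P : Polynomial δ.kerSubalgebra, P.natDegree = n →
      Polynomial.aeval b P = 0 → P = 0 := by
    intro n
    induction n with
    | zero =>
      intro P hP h
      rw [Polynomial.eq_C_of_natDegree_eq_zero hP] at h ⊢
      simpa using h
    | succ n ih =>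
      intro P hP h
      have h1 : δ.overKer (Polynomial.aeval b P) = 0 := by rw [h, map_zero]
      rw [Derivation.map_aeval, smul_eq_mul, mul_eq_zero] at h1
      have h2 := h1.resolve_right hne
      have hc : CharZero δ.kerSubalgebra := inferInstance
      have h3 : P.derivative.natDegree = n := by
        rw [Polynomial.natDegree_derivative, hP, Nat.add_sub_cancel]
      have h4 := ih _ h3 h2
      have := Polynomial.derivative_eq_zero.mp h4
      omega
  obtain ⟨P, hP, h⟩ := hb
  exact hP (key _ P rfl h)

lemma Derivation.exists_localSlice (δ : Derivation R B B)
    (hLN : ∀ b : B, ∃ n : ℕ, 1 ≤ n ∧ (⇑δ)^[n] b = 0) (h0 : ∃ b, δ b ≠ 0) :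
    ∃ s, δ s ≠ 0 ∧ δ (δ s) = 0 := by
  classical
  obtain ⟨b, hb⟩ := h0
  have hex : ∃ n, (⇑δ)^[n] b = 0 := (hLN b).imp fun _ h ↦ h.2
  obtain ⟨n, hn⟩ : ∃ n, Nat.find hex = n + 2 := by
    have h1 := Nat.find_spec hex
    rcases h : Nat.find hex with _ | _ | n
    · rw [h] at h1
      simp only [Function.iterate_zero, id_eq] at h1
      simp [h1] at hb
    · rw [h] at h1
      exact absurd h1 hb
    · exact ⟨n, rfl⟩
  refine ⟨(⇑δ)^[n] b, ?_, ?_⟩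
  · rw [← Function.iterate_succ_apply' δ]
    exact Nat.find_min hex (by omega)
  · rw [← Function.iterate_succ_apply' δ, ← Function.iterate_succ_apply' δ]
    have := Nat.find_spec hex
    rwa [hn] at this

lemma Polynomial.exists_derivative_eq_nsmul {A : Type*} [CommRing A] (P : Polynomial A) :
    ∃ N : ℕ, N ≠ 0 ∧ ∃ Q : Polynomial A, Polynomial.derivative Q = N • P := by
  induction P using Polynomial.induction_on' with
  | add P₁ P₂ h₁ h₂ =>
    obtain ⟨N₁, h₁, Q₁, hQ₁⟩ := h₁
    obtain ⟨N₂, h₂, Q₂, hQ₂⟩ := h₂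
    refine ⟨N₁ * N₂, mul_ne_zero h₁ h₂, N₂ • Q₁ + N₁ • Q₂, ?_⟩
    simp only [map_add, map_nsmul, hQ₁, hQ₂, smul_add, smul_smul, mul_comm]
  | monomial n a =>
    refine ⟨n + 1, by omega, Polynomial.monomial (n + 1) a, ?_⟩
    rw [Polynomial.derivative_monomial, Nat.add_sub_cancel, nsmul_eq_mul, mul_comm,
      ← Polynomial.C_mul_monomial, mul_comm]
    simp [mul_comm]

lemma Derivation.exists_mul_eq_aeval [IsDomain B] [CharZero B] (δ : Derivation R B B)
    (hLN : ∀ b : B, ∃ n : ℕ, 1 ≤ n ∧ (⇑δ)^[n] b = 0) {s : B} (hs : δ s ≠ 0)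
    (hs' : δ (δ s) = 0) (b : B) :
    ∃ a : δ.kerSubalgebra, a ≠ 0 ∧ ∃ P : Polynomial δ.kerSubalgebra,
      a * b = Polynomial.aeval s P := by
  obtain ⟨n, -, hn⟩ := hLN b
  induction n generalizing b with
  | zero => exact ⟨1, one_ne_zero, 0, by simpa using hn⟩
  | succ n ih =>
    rw [Function.iterate_succ_apply] at hn
    obtain ⟨a, ha, P, hP⟩ := ih _ hn
    obtain ⟨N, hN, Q, hQ⟩ := P.exists_derivative_eq_nsmul
    let α : δ.kerSubalgebra := ⟨δ s, hs'⟩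
    have hα : α ≠ 0 := fun h ↦ hs (congrArg Subtype.val h)
    have h1 : δ.overKer ((N * α * a : δ.kerSubalgebra) • b - Polynomial.aeval s Q) = 0 := by
      rw [map_sub, Derivation.map_smul, Derivation.map_aeval, hQ, map_nsmul]
      simp only [overKer_apply, Subalgebra.smul_def, smul_eq_mul, ← hP]
      simp [α]
      ring
    refine ⟨N * α * a, mul_ne_zero (mul_ne_zero (by exact_mod_cast hN) hα) ha,
      Q + Polynomial.C ⟨_, h1⟩, ?_⟩
    simp [Subalgebra.smul_def, Algebra.algebraMap_eq_smul_one]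

lemma Derivation.transcendental_of_apply_ne_zero [IsDomain B] [CharZero B] (δ : Derivation R B B)
    {s : B} (hs : δ s ≠ 0) : Transcendental δ.kerSubalgebra s :=
  fun h ↦ hs (δ.mem_kerSubalgebra_of_isAlgebraic h)

lemma Derivation.exists_finset_pow_mul_mem_adjoin [IsDomain B] [CharZero B]
    [Algebra.FiniteType R B] (δ : Derivation R B B)
    (hLN : ∀ b : B, ∃ n : ℕ, 1 ≤ n ∧ (⇑δ)^[n] b = 0) (h0 : ∃ b, δ b ≠ 0) :
    ∃ c : δ.kerSubalgebra, c ≠ 0 ∧ ∃ G : Finset δ.kerSubalgebra, ∀ b : δ.kerSubalgebra,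
      ∃ N : ℕ, c ^ N * b ∈ Algebra.adjoin R (G : Set δ.kerSubalgebra) := by
  classical
  obtain ⟨s, hs, hs'⟩ := δ.exists_localSlice hLN h0
  obtain ⟨S, hS⟩ := Algebra.FiniteType.out (R := R) (A := B)
  choose a ha P hP using fun b ↦ δ.exists_mul_eq_aeval hLN hs hs' b
  let c : δ.kerSubalgebra := ∏ x ∈ S, a x
  let G : Finset δ.kerSubalgebra := insert c (S.biUnion fun x ↦
    (S.image a) ∪ (P x).support.image (P x).coeff)
  let A' := Algebra.adjoin R (G : Set δ.kerSubalgebra)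
  have hcA' : c ∈ A' := Algebra.subset_adjoin (by simp [G])
  have hGc : ∀ x ∈ S, ∀ i, (P x).coeff i ∈ A' := fun x hx i ↦ by
    by_cases h : (P x).coeff i = 0
    · rw [h]; exact zero_mem _
    · apply Algebra.subset_adjoin
      simp only [G, Finset.coe_insert, Set.mem_insert_iff, Finset.mem_coe, Finset.mem_biUnion]
      exact Or.inr ⟨x, hx, Finset.mem_union_right _ (Finset.mem_image_of_mem _ (by simpa using h))⟩
  have hGa : ∀ x ∈ S, a x ∈ A' := fun x hx ↦ by
    apply Algebra.subset_adjoin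
    simp only [G, Finset.coe_insert, Set.mem_insert_iff, Finset.mem_coe, Finset.mem_biUnion]
    exact Or.inr ⟨x, hx, Finset.mem_union_left _ (Finset.mem_image_of_mem _ hx)⟩
  let L := Polynomial.lifts (algebraMap A' δ.kerSubalgebra)
  have hLcoef : ∀ p : Polynomial δ.kerSubalgebra, (∀ i, p.coeff i ∈ A') → p ∈ L := fun p hp ↦
    (Polynomial.lifts_iff_coeff_lifts p).mpr fun i ↦ ⟨⟨_, hp i⟩, rfl⟩
  have hLcoef' : ∀ p ∈ L, ∀ i, p.coeff i ∈ A' := by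
    intro p hp i
    obtain ⟨q, hq⟩ := (Polynomial.lifts_iff_coeff_lifts p).mp hp i
    exact hq ▸ q.2
  have hCL : ∀ x ∈ A', Polynomial.C x ∈ L := fun x hx ↦
    Polynomial.C_mem_lifts (algebraMap A' δ.kerSubalgebra) ⟨x, hx⟩
  have main : ∀ b : B, ∃ N : ℕ, ∃ p ∈ L, (c : B) ^ N * b = Polynomial.aeval s p := by
    intro b
    have hb : b ∈ Algebra.adjoin R (S : Set B) := hS ▸ Algebra.mem_top
    induction hb using Algebra.adjoin_induction with
    | mem x hx =>
      refine ⟨1, Polynomial.C (∏ y ∈ S.erase x, a y) * P x, L.mul_mem (hCL _ ?_) (hLcoef _ (hGc x hx)), ?_⟩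
      · exact A'.prod_mem fun y hy ↦ hGa y (Finset.mem_of_mem_erase hy)
      · have : c = (∏ y ∈ S.erase x, a y) * a x := (Finset.prod_erase_mul _ _ hx).symm
        rw [map_mul, Polynomial.aeval_C, ← hP x, pow_one, this]
        simp [mul_assoc, Algebra.algebraMap_eq_smul_one, Subalgebra.smul_def]
    | algebraMap r =>
      refine ⟨0, Polynomial.C (algebraMap R _ r), hCL _ (A'.algebraMap_mem r), ?_⟩
      simp [← IsScalarTower.algebraMap_apply]
    | add x y _ _ hx hy =>
      obtain ⟨N, p, hp, hx⟩ := hx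
      obtain ⟨M, q, hq, hy⟩ := hy
      refine ⟨N + M, Polynomial.C (c ^ M) * p + Polynomial.C (c ^ N) * q,
        L.add_mem (L.mul_mem (hCL _ (A'.pow_mem hcA' _)) hp)
          (L.mul_mem (hCL _ (A'.pow_mem hcA' _)) hq), ?_⟩
      rw [map_add, map_mul, map_mul, ← hx, ← hy]
      simp [Algebra.algebraMap_eq_smul_one, Subalgebra.smul_def]
      ring
    | mul x y _ _ hx hy =>
      obtain ⟨N, p, hp, hx⟩ := hx
      obtain ⟨M, q, hq, hy⟩ := hy
      refine ⟨N + M, p * q, L.mul_mem hp hq, ?_⟩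
      rw [map_mul, ← hx, ← hy]
      ring
  refine ⟨c, Finset.prod_ne_zero_iff.mpr fun x _ ↦ ha x, G, fun b ↦ ?_⟩
  obtain ⟨N, p, hp, h⟩ := main b
  refine ⟨N, ?_⟩
  have : p = Polynomial.C (c ^ N * b) := by
    have htr := δ.transcendental_of_apply_ne_zero hs
    rw [transcendental_iff_injective] at htr
    apply htr
    rw [← h]
    simp [Algebra.algebraMap_eq_smul_one, Subalgebra.smul_def]
  have h2 := hLcoef' p hp 0
  rwa [this, Polynomial.coeff_C_zero] at h2

lemma Derivation.trdeg_kerSubalgebra [IsDomain B] [CharZero B] (δ : Derivation R B B)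
    (hLN : ∀ b : B, ∃ n : ℕ, 1 ≤ n ∧ (⇑δ)^[n] b = 0) (h0 : ∃ b, δ b ≠ 0) :
    Algebra.trdeg δ.kerSubalgebra B = 1 := by
  obtain ⟨s, hs, hs'⟩ := δ.exists_localSlice hLN h0
  have h1 : AlgebraicIndependent δ.kerSubalgebra ![s] := by
    rw [algebraicIndependent_unique_type_iff]
    exact δ.transcendental_of_apply_ne_zero hs
  have h2 : IsTranscendenceBasis δ.kerSubalgebra ![s] := by
    rw [h1.isTranscendenceBasis_iff_isAlgebraic]
    refine ⟨fun b ↦ ?_⟩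
    obtain ⟨a, ha, P, hP⟩ := δ.exists_mul_eq_aeval hLN hs hs' b
    let D := Algebra.adjoin δ.kerSubalgebra (Set.range ![s])
    have hsD : s ∈ D := Algebra.subset_adjoin ⟨0, rfl⟩
    let y : D := Polynomial.aeval ⟨s, hsD⟩ P
    have hy : algebraMap D B y = Polynomial.aeval s P := by
      rw [← Polynomial.aeval_algebraMap_apply]; rfl
    refine ⟨Polynomial.C (algebraMap _ D a) * Polynomial.X - Polynomial.C y, fun h ↦ ha ?_, ?_⟩
    · have := congrArg (fun p ↦ Polynomial.coeff p 1) h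
      simp only [Polynomial.coeff_sub, Polynomial.coeff_C_mul, Polynomial.coeff_X_one, mul_one,
        Polynomial.coeff_C_succ, sub_zero, Polynomial.coeff_zero] at this
      exact Subtype.ext (congrArg (Subtype.val : D → B) this)
    · rw [map_sub, map_mul, Polynomial.aeval_C, Polynomial.aeval_C, Polynomial.aeval_X, hy, ← hP,
        ← IsScalarTower.algebraMap_apply]
      simp [Algebra.algebraMap_eq_smul_one, Subalgebra.smul_def]
  have h3 := h2.lift_cardinalMk_eq_trdeg
  simpa using h3.symm

end LocallyNilpotent

section Points

/-- A finitely generated algebra over an algebraically closed field has a rational point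
on every nonempty closed subset. -/
lemma exists_algHom_of_ne_top {k : Type u} [Field k] [IsAlgClosed k] {C : Type u} [CommRing C]
    [Algebra k C] [Algebra.FiniteType k C] (I : Ideal C) (hI : I ≠ ⊤) :
    ∃ ψ : C →ₐ[k] k, I ≤ RingHom.ker ψ := by
  obtain ⟨M, hM, hIM⟩ := Ideal.exists_le_maximal I hI
  let _ : Field (C ⧸ M) := Ideal.Quotient.field M
  have : Module.Finite k (C ⧸ M) := finite_of_finite_type_of_isJacobsonRing k (C ⧸ M)
  have hb := IsAlgClosed.algebraMap_bijective_of_isIntegral (k := k) (K := C ⧸ M)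
  let e : k ≃ₐ[k] (C ⧸ M) := AlgEquiv.ofBijective (Algebra.ofId k (C ⧸ M)) hb
  refine ⟨(e.symm : (C ⧸ M) →ₐ[k] k).comp (Ideal.Quotient.mkₐ k M), fun x hx ↦ ?_⟩
  have : Ideal.Quotient.mk M x = 0 := Ideal.Quotient.eq_zero_iff_mem.2 (hIM hx)
  simp [RingHom.mem_ker, this]

/-- Points of a finitely generated extension of domains lift outside a proper closed subset. -/
theorem exists_forall_exists_algHom_extension {k S C : Type u} [Field k] [IsAlgClosed k]
    [CommRing S] [IsDomain S] [IsNoetherianRing S] [CommRing C] [IsDomain C] [Algebra k S]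
    [Algebra k C] [Algebra S C]
    [IsScalarTower k S C] [Algebra.FiniteType S C] [Algebra.FiniteType k C]
    (hinj : Function.Injective (algebraMap S C)) (c : C) (hc : c ≠ 0) :
    ∃ σ : S, σ ≠ 0 ∧ ∀ φ : S →ₐ[k] k, φ σ ≠ 0 →
      ∃ ψ : C →ₐ[k] k, (∀ s, ψ (algebraMap S C s) = φ s) ∧ ψ c ≠ 0 := by
  let D := Localization.Away c
  have : IsDomain D := IsLocalization.isDomain_localization (powers_le_nonZeroDivisors_of_noZeroDivisors hc)
  have : Algebra.FiniteType C D := IsLocalization.finiteType_of_monoid_fg (Submonoid.powers c) D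
  have : Algebra.FiniteType S D := Algebra.FiniteType.trans (S := C) inferInstance inferInstance
  have : Algebra.FiniteType k D := Algebra.FiniteType.trans (S := C) inferInstance inferInstance
  have : Algebra.FinitePresentation S D := Algebra.FinitePresentation.of_finiteType.1 inferInstance
  have hD : Function.Injective (algebraMap S D) := by
    rw [IsScalarTower.algebraMap_eq S C D]
    exact (IsLocalization.injective D (M := Submonoid.powers c)
      (powers_le_nonZeroDivisors_of_noZeroDivisors hc)).comp hinj
  have hcon := PrimeSpectrum.isConstructible_range_comap (f := algebraMap S D)
    (RingHom.finitePresentation_algebraMap.2 inferInstance)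
  obtain ⟨T, hT⟩ := PrimeSpectrum.exists_constructibleSetData_iff.2 hcon
  have h0 : (⊥ : PrimeSpectrum S) ∈ T.toSet := by
    rw [hT]
    refine ⟨⊥, ?_⟩
    ext1
    simp [PrimeSpectrum.comap_asIdeal, (RingHom.injective_iff_ker_eq_bot _).1 hD, ← RingHom.ker_eq_comap_bot]
  rw [PrimeSpectrum.ConstructibleSetData.toSet] at h0
  simp only [Set.mem_iUnion, PrimeSpectrum.BasicConstructibleSetData.toSet] at h0
  obtain ⟨t, ht, h1, h2⟩ := h0
  have hg : ∀ i, t.g i = 0 := by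
    intro i
    have := h1 (Set.mem_range_self i)
    simpa using this
  have hf : t.f ≠ 0 := by
    intro h
    apply h2
    simp [h]
  refine ⟨t.f, hf, fun φ hφ ↦ ?_⟩
  have hmax : (RingHom.ker φ).IsMaximal := RingHom.ker_isMaximal_of_surjective φ
    (fun x ↦ ⟨algebraMap k S x, by simp⟩)
  have hmem : (⟨RingHom.ker φ, hmax.isPrime⟩ : PrimeSpectrum S) ∈ T.toSet := by
    rw [PrimeSpectrum.ConstructibleSetData.toSet]
    simp only [Set.mem_iUnion, PrimeSpectrum.BasicConstructibleSetData.toSet]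
    refine ⟨t, ht, ?_, ?_⟩
    · rintro x ⟨i, rfl⟩
      simp [hg]
    · simpa [PrimeSpectrum.mem_zeroLocus] using hφ
  rw [hT] at hmem
  obtain ⟨q, hq⟩ := hmem
  obtain ⟨ψ, hψ⟩ := exists_algHom_of_ne_top (k := k) q.asIdeal q.isPrime.ne_top
  refine ⟨ψ.comp (IsScalarTower.toAlgHom k C D), fun s ↦ ?_, ?_⟩
  · have hs : s - algebraMap k S (φ s) ∈ RingHom.ker φ := by simp [RingHom.mem_ker]
    have hq' : RingHom.ker φ = q.asIdeal.comap (algebraMap S D) := by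
      have := congrArg PrimeSpectrum.asIdeal hq
      simpa using this.symm
    rw [hq'] at hs
    have := hψ hs
    rw [RingHom.mem_ker, map_sub, map_sub, ← IsScalarTower.algebraMap_apply k S D, AlgHom.commutes, sub_eq_zero] at this
    simpa [← IsScalarTower.algebraMap_apply S C D] using this
  · have : IsUnit (algebraMap C D c) := IsLocalization.Away.algebraMap_isUnit c
    simpa using (this.map ψ).ne_zero

lemma exists_algHom_algebraicClosure_of_nontrivial (K C : Type u) [Field K] [CommRing C]
    [Nontrivial C] [Algebra K C] [Algebra.FiniteType K C] :
    Nonempty (C →ₐ[K] AlgebraicClosure K) := by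
  obtain ⟨M, hM⟩ := Ideal.exists_maximal C
  let _ : Field (C ⧸ M) := Ideal.Quotient.field M
  have : Module.Finite K (C ⧸ M) := finite_of_finite_type_of_isJacobsonRing K (C ⧸ M)
  have : Module.IsTorsionFree K (C ⧸ M) := inferInstance
  let f : (C ⧸ M) →ₐ[K] AlgebraicClosure K := IsAlgClosed.lift
  exact ⟨f.comp (Ideal.Quotient.mkₐ K M)⟩

/-- A finitely generated algebra with points above a dense set of points of `R` has a geometric
generic point. -/
theorem exists_algHom_algebraicClosure {R S : Type u} [CommRing R] [IsDomain R] [CommRing S]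
    [Algebra R S] [Algebra.FiniteType R S] (K : Type u) [Field K] [Algebra R K] [IsFractionRing R K]
    (h : ∀ r : R, r ≠ 0 → algebraMap R S r ≠ 0) :
    Nonempty (S →ₐ[R] AlgebraicClosure K) := by
  have hC : Nontrivial (K ⊗[R] S) := by
    let _ : Algebra S (K ⊗[R] S) := Algebra.TensorProduct.rightAlgebra
    have : IsLocalization (Algebra.algebraMapSubmonoid S (nonZeroDivisors R)) (K ⊗[R] S) :=
      IsLocalization.tensorRight ..
    rw [← not_subsingleton_iff_nontrivial]
    intro hs
    obtain ⟨r, hr, hr0⟩ := (IsLocalization.subsingleton_iff (S := K ⊗[R] S)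
      (M := Algebra.algebraMapSubmonoid S (nonZeroDivisors R))).1 hs
    exact h r (nonZeroDivisors.ne_zero hr) hr0
  obtain ⟨f⟩ := exists_algHom_algebraicClosure_of_nontrivial K (K ⊗[R] S)
  exact ⟨(f.restrictScalars R).comp Algebra.TensorProduct.includeRight⟩

end Points

section PlaneFamily

/-- Identifications of the closed fibres of `B` over `R` with affine planes, where the closed
points of `R` are given as `k`-algebra homomorphisms to `k`. -/
structure PlaneFamily (k R B : Type u) [Field k] [CommRing R] [Algebra k R] [CommRing B]
    [Algebra k B] [Algebra R B] where
  /-- the restriction map to the fibre -/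
  fib : (R →ₐ[k] k) → B →ₐ[k] MvPolynomial (Fin 2) k
  surjective_fib : ∀ ε, Function.Surjective (fib ε)
  ker_fib : ∀ ε, RingHom.ker (fib ε) = (RingHom.ker ε).map (algebraMap R B)

variable {k R B : Type u} [Field k] [CommRing R] [Algebra k R] [CommRing B]
    [Algebra k B] [Algebra R B] [IsScalarTower k R B]

lemma PlaneFamily.fib_algebraMap (β : PlaneFamily k R B) (ε : R →ₐ[k] k) (r : R) :
    β.fib ε (algebraMap R B r) = MvPolynomial.C (ε r) := by
  have h : algebraMap R B (r - algebraMap k R (ε r)) ∈ RingHom.ker (β.fib ε) := by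
    rw [β.ker_fib]
    exact Ideal.mem_map_of_mem _ (by simp [RingHom.mem_ker])
  rw [RingHom.mem_ker, map_sub, map_sub, ← IsScalarTower.algebraMap_apply k R B,
    AlgHom.commutes, sub_eq_zero] at h
  simpa using h

lemma exists_algHom_apply_ne_zero [IsAlgClosed k] [IsDomain R] [Algebra.FiniteType k R] (r : R)
    (hr : r ≠ 0) : ∃ ε : R →ₐ[k] k, ε r ≠ 0 := by
  obtain ⟨σ, hσ, h⟩ := exists_forall_exists_algHom_extension (k := k) (S := k) (C := R)
    (algebraMap k R).injective r hr
  obtain ⟨ψ, -, hψ⟩ := h (AlgHom.id k k) hσ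
  exact ⟨ψ, hψ⟩

lemma PlaneFamily.injective_algebraMap [IsAlgClosed k] [IsDomain R] [Algebra.FiniteType k R]
    (β : PlaneFamily k R B) : Function.Injective (algebraMap R B) := by
  rw [injective_iff_map_eq_zero]
  intro r hr
  by_contra h
  obtain ⟨ε, hε⟩ := exists_algHom_apply_ne_zero (k := k) r h
  have := β.fib_algebraMap ε r
  rw [hr, map_zero] at this
  exact hε ((map_eq_zero_iff _ (MvPolynomial.C_injective (Fin 2) k)).1 this.symm)

/-- Algebraically independent elements stay algebraically independent on almost all fibres. -/
lemma PlaneFamily.exists_forall_algebraicIndependent [IsAlgClosed k] [IsDomain R]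
    [Algebra.FiniteType k R] [IsDomain B] [Algebra.FiniteType k B]
    (β : PlaneFamily k R B) {ι : Type} [Finite ι] (v : ι → B) (hv : AlgebraicIndependent R v) :
    ∃ r : R, r ≠ 0 ∧ ∀ ε : R →ₐ[k] k, ε r ≠ 0 →
      AlgebraicIndependent k (fun i ↦ β.fib ε (v i)) := by
  have : IsNoetherianRing R := Algebra.FiniteType.isNoetherianRing k R
  let S := MvPolynomial ι R
  let _ : Algebra S B := (MvPolynomial.aeval v : S →ₐ[R] B).toRingHom.toAlgebra
  have hSB : ∀ s : S, algebraMap S B s = MvPolynomial.aeval v s := fun s ↦ rfl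
  have : IsScalarTower R S B := IsScalarTower.of_algebraMap_eq fun x ↦ by
    rw [hSB, MvPolynomial.algebraMap_eq, MvPolynomial.aeval_C]
  have : IsScalarTower k S B := IsScalarTower.of_algebraMap_eq fun x ↦ by
    rw [IsScalarTower.algebraMap_apply k R B, IsScalarTower.algebraMap_apply k R S,
      IsScalarTower.algebraMap_apply R S B]
  have : Algebra.FiniteType S B := Algebra.FiniteType.of_restrictScalars_finiteType k S B
  obtain ⟨σ, hσ, hext⟩ := exists_forall_exists_algHom_extension (k := k) (S := S) (C := B)
    hv 1 one_ne_zero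
  obtain ⟨d, hd⟩ := MvPolynomial.ne_zero_iff.1 hσ
  refine ⟨σ.coeff d, hd, fun ε hε ↦ ?_⟩
  have hσ' : MvPolynomial.map (ε : R →+* k) σ ≠ 0 := by
    refine MvPolynomial.ne_zero_iff.2 ⟨d, ?_⟩
    simpa [MvPolynomial.coeff_map] using hε
  rw [AlgebraicIndependent, injective_iff_map_eq_zero]
  intro Q hQ
  by_contra hQ0
  obtain ⟨l, hl⟩ : ∃ l : ι → k, MvPolynomial.eval l (MvPolynomial.map (ε : R →+* k) σ * Q) ≠ 0 := by
    by_contra! h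
    exact mul_ne_zero hσ' hQ0 (MvPolynomial.funext fun x ↦ by rw [h x, map_zero])
  rw [map_mul, mul_ne_zero_iff] at hl
  let φ : S →ₐ[k] k :=
    { MvPolynomial.eval₂Hom (ε : R →+* k) l with
      commutes' := fun x ↦ by
        rw [IsScalarTower.algebraMap_apply k R S, MvPolynomial.algebraMap_eq]
        exact (MvPolynomial.eval₂_C _ _ _).trans (ε.commutes x) }
  have hφ : ∀ s, φ s = MvPolynomial.eval₂ (ε : R →+* k) l s := fun s ↦ rfl
  obtain ⟨ψ, hψ, -⟩ := hext φ (by rw [hφ, ← MvPolynomial.eval_map]; exact hl.1)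
  have hψv : ∀ i, ψ (v i) = l i := fun i ↦ by
    have := hψ (MvPolynomial.X i)
    rwa [hSB, MvPolynomial.aeval_X, hφ, MvPolynomial.eval₂_X] at this
  have hψR : ∀ r, ψ (algebraMap R B r) = ε r := fun r ↦ by
    have := hψ (MvPolynomial.C r)
    rwa [hSB, MvPolynomial.aeval_C, hφ, MvPolynomial.eval₂_C] at this
  have hk : RingHom.ker (β.fib ε) ≤ RingHom.ker ψ := by
    rw [β.ker_fib, Ideal.map_le_iff_le_comap]
    intro x hx
    rw [Ideal.mem_comap, RingHom.mem_ker, hψR]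
    exact hx
  have h1 : MvPolynomial.aeval v Q ∈ RingHom.ker (β.fib ε) := by
    rw [RingHom.mem_ker, ← hQ, ← AlgHom.comp_apply, MvPolynomial.comp_aeval]
  have h2 := hk h1
  rw [RingHom.mem_ker, ← AlgHom.comp_apply, MvPolynomial.comp_aeval] at h2
  simp only [hψv] at h2
  exact hl.2 (by simpa [MvPolynomial.aeval_eq_eval] using h2)

lemma exists_uniformizer [IsDedekindDomain R] (m : Ideal R) [m.IsMaximal] (h0 : m ≠ ⊥) :
    ∃ t ∈ m, t ≠ 0 ∧ ∀ x ∈ m, ∃ w ∉ m, t ∣ w * x := by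
  obtain ⟨t, htm, ht⟩ : ∃ t ∈ m, t ∉ m ^ 2 := by
    by_contra! h
    have : m ^ 1 = m ^ 2 := le_antisymm (by rw [pow_one]; exact h) (Ideal.pow_le_pow_right (by norm_num))
    have hm1 : m ≠ ⊤ := Ideal.IsPrime.ne_top'
    exact (Ideal.pow_right_strictAnti m h0 hm1 one_lt_two).ne this.symm
  obtain ⟨J, hJ⟩ := Ideal.dvd_iff_le.2 ((Ideal.span_singleton_le_iff_mem m).2 htm)
  obtain ⟨w, hwJ, hwm⟩ : ∃ w ∈ J, w ∉ m := by
    by_contra! h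
    apply ht
    rw [← Ideal.span_singleton_le_iff_mem, hJ, pow_two]
    exact Ideal.mul_mono_right h
  refine ⟨t, htm, fun h ↦ ht (h ▸ zero_mem _), fun x hx ↦ ⟨w, hwm, ?_⟩⟩
  rw [← Ideal.mem_span_singleton, hJ, mul_comm w]
  exact Ideal.mul_mem_mul hx hwJ

lemma eq_zero_of_forall_pow_dvd {C : Type*} [CommRing C] [IsDomain C] [IsNoetherianRing C]
    (P : Ideal C) [P.IsPrime] {t x : C} (ht : t ∈ P) (h : ∀ j : ℕ, ∃ w ∉ P, t ^ j ∣ w * x) :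
    x = 0 := by
  let L := Localization.AtPrime P
  have hL : algebraMap C L x ∈ (⨅ j : ℕ, IsLocalRing.maximalIdeal L ^ j) := by
    rw [Ideal.mem_iInf]
    intro j
    obtain ⟨w, hw, y, hy⟩ := h j
    have hu : IsUnit (algebraMap C L w) := IsLocalization.map_units L (⟨w, hw⟩ : P.primeCompl)
    rw [← Ideal.unit_mul_mem_iff_mem _ hu, ← map_mul, hy, map_mul, map_pow]
    refine Ideal.mul_mem_right _ _ (Ideal.pow_mem_pow ?_ _)
    exact (IsLocalization.AtPrime.to_map_mem_maximal_iff L P t).2 ht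
  rw [Ideal.iInf_pow_eq_bot_of_isLocalRing _ (IsLocalRing.maximalIdeal.isMaximal L).ne_top,
    Ideal.mem_bot] at hL
  exact (IsLocalization.to_map_eq_zero_iff L P.primeCompl_le_nonZeroDivisors).1 hL

lemma PlaneFamily.isPrime_ker_fib (β : PlaneFamily k R B) (ε : R →ₐ[k] k) :
    (RingHom.ker (β.fib ε)).IsPrime := RingHom.ker_isPrime _

lemma PlaneFamily.algebraMap_mem_ker_fib (β : PlaneFamily k R B) (ε : R →ₐ[k] k) {r : R} :
    algebraMap R B r ∈ RingHom.ker (β.fib ε) ↔ ε r = 0 := by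
  rw [RingHom.mem_ker, β.fib_algebraMap, map_eq_zero_iff _ (MvPolynomial.C_injective _ _)]

/-- An element of `B` vanishing to infinite order along a fibre is zero. -/
lemma PlaneFamily.eq_zero_of_forall_pow_dvd [IsDomain B] [IsNoetherianRing B]
    (β : PlaneFamily k R B) (ε : R →ₐ[k] k) {t : R} (ht : ε t = 0) {x : B}
    (h : ∀ j : ℕ, ∃ w : R, ε w ≠ 0 ∧ algebraMap R B t ^ j ∣ algebraMap R B w * x) : x = 0 := by
  have := β.isPrime_ker_fib ε
  refine _root_.eq_zero_of_forall_pow_dvd (RingHom.ker (β.fib ε))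
    ((β.algebraMap_mem_ker_fib ε).2 ht) fun j ↦ ?_
  obtain ⟨w, hw, h⟩ := h j
  exact ⟨_, fun h ↦ hw ((β.algebraMap_mem_ker_fib ε).1 h), h⟩

/-- `t` generates the maximal ideal of the point `ε` after localizing. -/
def IsLocalParameter (ε : R →ₐ[k] k) (t : R) : Prop :=
  ε t = 0 ∧ t ≠ 0 ∧ ∀ x, ε x = 0 → ∃ w, ε w ≠ 0 ∧ t ∣ w * x

/-- Lifts of the coordinates of a fibre are independent to any order along the fibre. -/
lemma PlaneFamily.exists_pow_dvd_coeff [IsDomain B] (β : PlaneFamily k R B)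
    (hinj : Function.Injective (algebraMap R B)) (ε : R →ₐ[k] k)
    {t : R} (ht : IsLocalParameter ε t) (b : Fin 2 → B)
    (hb : ∀ i, β.fib ε (b i) = MvPolynomial.X i) (j : ℕ) :
    ∀ (G : MvPolynomial (Fin 2) R) (w : R), ε w ≠ 0 →
      algebraMap R B (t ^ j) ∣ algebraMap R B w * MvPolynomial.aeval b G →
      ∃ w' : R, ε w' ≠ 0 ∧ ∀ d, t ^ j ∣ w' * G.coeff d := by
  induction j with
  | zero => exact fun G w hw _ ↦ ⟨w, hw, by simp⟩
  | succ j ih =>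
    intro G w hw hG
    have hG0 : MvPolynomial.map (ε : R →+* k) G = 0 := by
      obtain ⟨y, hy⟩ := hG
      have h1 := congrArg (β.fib ε) hy
      rw [map_mul, map_mul, β.fib_algebraMap, β.fib_algebraMap, map_pow, ht.1, zero_pow (by simp),
        map_zero, zero_mul] at h1
      rcases mul_eq_zero.1 h1 with h | h
      · exact absurd ((map_eq_zero_iff _ (MvPolynomial.C_injective _ _)).1 h) hw
      · rw [← h, MvPolynomial.aeval_def, ← AlgHom.coe_toRingHom, MvPolynomial.hom_eval₂]
        conv_lhs => rw [← MvPolynomial.eval₂_eta (MvPolynomial.map (ε : R →+* k) G), MvPolynomial.eval₂_map]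
        congr 1
        · ext1 r
          simp [β.fib_algebraMap]
        · ext1 i
          simp [hb]
    have hc : ∀ d, ∃ w, ε w ≠ 0 ∧ t ∣ w * G.coeff d := fun d ↦ ht.2.2 _ (by
      have := congrArg (MvPolynomial.coeff d) hG0
      simpa [MvPolynomial.coeff_map] using this)
    choose w₁ hw₁ hd using hc
    obtain ⟨w₂, hw₂, hd₂⟩ : ∃ w, ε w ≠ 0 ∧ ∀ d, t ∣ w * G.coeff d := by
      refine ⟨∏ d ∈ G.support, w₁ d, ?_, fun d ↦ ?_⟩
      · rw [map_prod]
        exact Finset.prod_ne_zero_iff.2 fun d _ ↦ hw₁ d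
      · by_cases h : d ∈ G.support
        · exact (hd d).trans (mul_dvd_mul_right (Finset.dvd_prod_of_mem _ h) _)
        · simp [MvPolynomial.notMem_support_iff.1 h]
    obtain ⟨G', hG'⟩ : MvPolynomial.C t ∣ MvPolynomial.C w₂ * G := by
      rw [MvPolynomial.C_dvd_iff_dvd_coeff]
      simpa using hd₂
    have ht0 : algebraMap R B t ≠ 0 := (map_ne_zero_iff _ hinj).2 ht.2.1
    obtain ⟨w₃, hw₃, h₃⟩ := ih G' w hw (by
      obtain ⟨y, hy⟩ := hG
      have h1 := congrArg (MvPolynomial.aeval b) hG'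
      simp only [map_mul, MvPolynomial.aeval_C] at h1
      refine ⟨algebraMap R B w₂ * y, mul_left_cancel₀ ht0 ?_⟩
      rw [mul_left_comm, ← h1, mul_left_comm, hy, pow_succ, map_mul]
      ring)
    refine ⟨w₃ * w₂, by simp [hw₃, hw₂], fun d ↦ ?_⟩
    obtain ⟨z, hz⟩ := h₃ d
    have h2 := congrArg (MvPolynomial.coeff d) hG'
    simp only [MvPolynomial.coeff_C_mul] at h2
    refine ⟨z, ?_⟩
    rw [mul_assoc, h2, mul_left_comm, hz, pow_succ]
    ring

end PlaneFamily

section TranscendenceDegree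

variable {k R B : Type u} [Field k] [CommRing R] [Algebra k R] [CommRing B]
    [Algebra k B] [Algebra R B] [IsScalarTower k R B]

lemma PlaneFamily.algebraicIndependent_of_fib_eq_X [IsDomain R] [IsDomain B] [IsNoetherianRing B]
    (β : PlaneFamily k R B)
    (hinj : Function.Injective (algebraMap R B)) (ε : R →ₐ[k] k)
    {t : R} (ht : IsLocalParameter ε t) (b : Fin 2 → B)
    (hb : ∀ i, β.fib ε (b i) = MvPolynomial.X i) : AlgebraicIndependent R b := by
  rw [AlgebraicIndependent, injective_iff_map_eq_zero]
  intro G hG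
  ext d
  rw [MvPolynomial.coeff_zero]
  apply hinj
  rw [map_zero]
  refine β.eq_zero_of_forall_pow_dvd ε ht.1 fun j ↦ ?_
  obtain ⟨w, hw, h⟩ := β.exists_pow_dvd_coeff hinj ε ht b hb j G 1 (by simp) (by simp [hG])
  refine ⟨w, hw, ?_⟩
  rw [← map_pow, ← map_mul]
  exact map_dvd _ (h d)

lemma PlaneFamily.exists_fib_eq_X (β : PlaneFamily k R B) (ε : R →ₐ[k] k) :
    ∃ b : Fin 2 → B, ∀ i, β.fib ε (b i) = MvPolynomial.X i :=
  ⟨fun i ↦ (β.surjective_fib ε (MvPolynomial.X i)).choose,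
    fun i ↦ (β.surjective_fib ε (MvPolynomial.X i)).choose_spec⟩

lemma PlaneFamily.trdeg_eq_two [IsAlgClosed k] [IsDomain R]
    [Algebra.FiniteType k R] [IsDomain B] [Algebra.FiniteType k B]
    (β : PlaneFamily k R B) (ε : R →ₐ[k] k) {t : R} (ht : IsLocalParameter ε t) :
    Algebra.trdeg R B = 2 := by
  have : IsNoetherianRing B := Algebra.FiniteType.isNoetherianRing k B
  have hinj := β.injective_algebraMap
  apply le_antisymm
  · rw [Algebra.trdeg]
    refine ciSup_le' fun ⟨s, hs⟩ ↦ ?_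
    by_contra! h
    have h3 : ((3 : ℕ) : Cardinal) ≤ Cardinal.mk s := by
      rw [show (3 : ℕ) = 2 + 1 from rfl, Nat.cast_add_one, ← Cardinal.succ_natCast]
      exact Order.succ_le_of_lt h
    have h4 : Cardinal.lift.{u} (Cardinal.mk (Fin 3)) ≤ Cardinal.lift.{0} (Cardinal.mk s) := by
      simpa using h3
    obtain ⟨g⟩ := Cardinal.lift_mk_le'.1 h4
    obtain ⟨r, hr, hgen⟩ := β.exists_forall_algebraicIndependent _ (hs.comp g g.injective)
    obtain ⟨ε', hε'⟩ := exists_algHom_apply_ne_zero (k := k) r hr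
    have := (hgen ε' hε').lift_cardinalMk_le_trdeg
    rw [MvPolynomial.trdeg_of_isDomain] at this
    simp only [Cardinal.mk_fin, Cardinal.lift_natCast] at this
    exact absurd (Nat.cast_le.1 this) (by norm_num)
  · obtain ⟨b, hb⟩ := β.exists_fib_eq_X ε
    have := (β.algebraicIndependent_of_fib_eq_X hinj ε ht b hb).lift_cardinalMk_le_trdeg
    simpa using this

lemma PlaneFamily.trdeg_subalgebra [IsAlgClosed k] [IsDomain R]
    [Algebra.FiniteType k R] [IsDomain B] [Algebra.FiniteType k B]
    (β : PlaneFamily k R B) (ε : R →ₐ[k] k) {t : R} (ht : IsLocalParameter ε t)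
    (A : Subalgebra R B) (hA : Algebra.trdeg A B = 1) :
    Algebra.trdeg R A = 1 := by
  have hinj := β.injective_algebraMap
  have : FaithfulSMul R A := (faithfulSMul_iff_algebraMap_injective R A).2 fun x y h ↦
    hinj (congrArg (algebraMap A B) h)
  have h := trdeg_add_eq R A (A := B)
  rw [hA, β.trdeg_eq_two ε ht] at h
  exact Cardinal.add_one_inj.1 (h.trans one_add_one_eq_two.symm)

lemma exists_transcendental_of_trdeg_eq_one {R A : Type u} [CommRing R] [CommRing A] [Algebra R A]
    (h : Algebra.trdeg R A = 1) : ∃ a : A, Transcendental R a := by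
  have : Algebra.Transcendental R A := trdeg_ne_zero_iff.1 (by simp [h])
  exact Algebra.transcendental_def.1 this

lemma isAlgebraic_adjoin_of_trdeg_eq_one {R A : Type u} [CommRing R] [IsDomain R] [CommRing A]
    [IsDomain A] [Algebra R A]
    (h : Algebra.trdeg R A = 1) {a : A} (ha : Transcendental R a) :
    Algebra.IsAlgebraic (Algebra.adjoin R {a}) A := by
  have h1 : AlgebraicIndependent R (fun _ : Unit ↦ a) := algebraicIndependent_unique_type_iff.2 ha
  have := (h1.isTranscendenceBasis_of_lift_trdeg_le_of_finite (by simp [h])).isAlgebraic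
  rwa [Set.range_const] at this

end TranscendenceDegree

section Luroth

open Polynomial IntermediateField

variable {K : Type*} [Field K]

lemma Polynomial.algebraMap_sum_pow_mul_pow (u v N : K[X]) (hv : v ≠ 0) (M : ℕ)
    (hM : N.natDegree ≤ M) :
    algebraMap K[X] (RatFunc K) (∑ i ∈ Finset.range (M + 1), C (N.coeff i) * u ^ i * v ^ (M - i)) =
      algebraMap K[X] (RatFunc K) v ^ M *
        aeval (algebraMap K[X] (RatFunc K) u / algebraMap K[X] (RatFunc K) v) N := by
  have hv' : algebraMap K[X] (RatFunc K) v ≠ 0 := by simpa using hv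
  rw [aeval_eq_sum_range' (Nat.lt_succ_of_le hM), map_sum, Finset.mul_sum]
  refine Finset.sum_congr rfl fun i hi ↦ ?_
  have hi' : M = (M - i) + i := by have := Finset.mem_range.1 hi; omega
  rw [Algebra.smul_def, map_mul, map_mul, map_pow, map_pow, IsScalarTower.algebraMap_apply K K[X],
    Polynomial.algebraMap_eq]
  conv_rhs => rw [hi', pow_add, div_pow]
  field_simp

lemma Polynomial.natDegree_sum_pow_mul_pow_le (u v N : K[X]) (huv : v.natDegree ≤ u.natDegree)
    (M : ℕ) :
    (∑ i ∈ Finset.range (M + 1), C (N.coeff i) * u ^ i * v ^ (M - i)).natDegree ≤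
      M * u.natDegree := by
  refine natDegree_sum_le_of_forall_le _ _ fun i hi ↦ ?_
  have hi' : M = i + (M - i) := by have := Finset.mem_range.1 hi; omega
  calc _ ≤ (C (N.coeff i) * u ^ i).natDegree + (v ^ (M - i)).natDegree := natDegree_mul_le
    _ ≤ i * u.natDegree + (M - i) * v.natDegree :=
      add_le_add ((natDegree_C_mul_le _ _).trans natDegree_pow_le) natDegree_pow_le
    _ ≤ i * u.natDegree + (M - i) * u.natDegree := by gcongr
    _ = M * u.natDegree := by rw [← add_mul, ← hi']

lemma Polynomial.natDegree_sum_pow_mul_pow (u v N : K[X]) (huv : v.natDegree < u.natDegree)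
    (hN : N ≠ 0) :
    (∑ i ∈ Finset.range (N.natDegree + 1), C (N.coeff i) * u ^ i * v ^ (N.natDegree - i)).natDegree
      = N.natDegree * u.natDegree := by
  rw [Finset.sum_range_succ, tsub_self, pow_zero, mul_one]
  have h1 : (C (N.coeff N.natDegree) * u ^ N.natDegree).natDegree = N.natDegree * u.natDegree := by
    rw [natDegree_C_mul (by simpa using hN), natDegree_pow]
  rcases Nat.eq_zero_or_pos N.natDegree with h0 | h0
  · rw [h0] at h1 ⊢
    simp
  rw [add_comm, natDegree_add_eq_left_of_natDegree_lt, h1]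
  rw [h1]
  obtain ⟨M, hM⟩ : ∃ M, N.natDegree = M + 1 := ⟨N.natDegree - 1, by omega⟩
  rw [hM]
  refine lt_of_le_of_lt (b := M * u.natDegree + v.natDegree)
    (natDegree_sum_le_of_forall_le _ _ fun i hi ↦ ?_) ?_
  · have hi' : M = i + (M - i) := by have := Finset.mem_range.1 hi; omega
    calc _ ≤ (C (N.coeff i) * u ^ i).natDegree + (v ^ (M + 1 - i)).natDegree := natDegree_mul_le
      _ ≤ i * u.natDegree + (M + 1 - i) * v.natDegree :=
        add_le_add ((natDegree_C_mul_le _ _).trans natDegree_pow_le) natDegree_pow_le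
      _ = i * u.natDegree + (M - i) * v.natDegree + v.natDegree := by
        rw [show M + 1 - i = (M - i) + 1 by omega]; ring
      _ ≤ i * u.natDegree + (M - i) * u.natDegree + v.natDegree := by gcongr
      _ = M * u.natDegree + v.natDegree := by rw [← add_mul, ← hi']
  · rw [add_mul, one_mul]
    omega

/-- If a nonconstant polynomial is a rational function of `u / v` with `u / v` having a pole
at infinity, then `v` is constant. -/
lemma Polynomial.isUnit_of_mul_aeval_eq (u v p N D : K[X]) (hcop : IsCoprime u v) (hv : v ≠ 0)
    (huv : v.natDegree < u.natDegree) (hp : 0 < p.natDegree) (hD : D ≠ 0)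
    (h : algebraMap K[X] (RatFunc K) p *
        aeval (algebraMap K[X] (RatFunc K) u / algebraMap K[X] (RatFunc K) v) D =
      aeval (algebraMap K[X] (RatFunc K) u / algebraMap K[X] (RatFunc K) v) N) : IsUnit v := by
  have key : ∀ M, N.natDegree ≤ M → D.natDegree ≤ M →
      p * (∑ i ∈ Finset.range (M + 1), C (D.coeff i) * u ^ i * v ^ (M - i)) =
      ∑ i ∈ Finset.range (M + 1), C (N.coeff i) * u ^ i * v ^ (M - i) := by
    intro M h1 h2
    apply FaithfulSMul.algebraMap_injective K[X] (RatFunc K)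
    rw [map_mul, algebraMap_sum_pow_mul_pow u v N hv M h1, algebraMap_sum_pow_mul_pow u v D hv M h2,
      ← h]
    ring
  have hlt : D.natDegree < N.natDegree := by
    by_contra! hle
    have h1 := congrArg natDegree (key D.natDegree hle le_rfl)
    have h2 := natDegree_sum_pow_mul_pow_le u v N huv.le D.natDegree
    have h3 := natDegree_sum_pow_mul_pow u v D huv hD
    have hne : (∑ i ∈ Finset.range (D.natDegree + 1),
        C (D.coeff i) * u ^ i * v ^ (D.natDegree - i)) ≠ 0 := by
      intro h0
      have := algebraMap_sum_pow_mul_pow u v D hv D.natDegree le_rfl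
      rw [h0, map_zero] at this
      have h4 := natDegree_sum_pow_mul_pow u v D huv hD
      rw [h0, natDegree_zero] at h4
      have h5 : D.natDegree = 0 := by
        rcases mul_eq_zero.1 h4.symm with h | h
        · exact h
        · omega
      rw [h5] at h0
      simp only [zero_add, Finset.range_one, Finset.sum_singleton, pow_zero, mul_one, tsub_self,
        C_eq_zero] at h0
      rw [eq_C_of_natDegree_eq_zero h5, h0] at hD
      simp at hD
    rw [natDegree_mul (by rintro rfl; simp at hp) hne, h3] at h1
    omega
  have h1 := key N.natDegree le_rfl hlt.le
  have hvl : v ∣ ∑ i ∈ Finset.range (N.natDegree + 1),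
      C (D.coeff i) * u ^ i * v ^ (N.natDegree - i) := by
    refine Finset.dvd_sum fun i hi ↦ ?_
    rcases lt_or_ge D.natDegree i with h | h
    · simp [coeff_eq_zero_of_natDegree_lt h]
    · exact Dvd.dvd.mul_left (dvd_pow_self _ (by omega)) _
  have h2 := (hvl.mul_left p)
  rw [h1, Finset.sum_range_succ, tsub_self, pow_zero, mul_one] at h2
  have h3 : v ∣ C (N.coeff N.natDegree) * u ^ N.natDegree := by
    refine (dvd_add_right (Finset.dvd_sum fun i hi ↦ ?_)).1 h2
    have := Finset.mem_range.1 hi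
    exact Dvd.dvd.mul_left (dvd_pow_self _ (by omega)) _
  have hN : IsUnit (C (N.coeff N.natDegree)) := by
    refine isUnit_C.2 (IsUnit.mk0 _ ?_)
    rw [coeff_natDegree, Ne, leadingCoeff_eq_zero]
    rintro rfl
    simp at hlt
  exact hcop.symm.pow_right.isUnit_of_dvd (hN.dvd_mul_left.1 h3)

lemma Polynomial.eq_comp_of_mul_comp_eq (h x N D : K[X]) (hh : 0 < h.natDegree) (hD : D ≠ 0)
    (heq : x * D.comp h = N.comp h) : ∃ P : K[X], x = P.comp h := by
  classical
  refine ⟨N / D, ?_⟩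
  by_contra hne
  have h1 : (x - (N / D).comp h) * D.comp h = (N % D).comp h := by
    have := congrArg (fun q ↦ q.comp h) (EuclideanDomain.div_add_mod N D)
    simp only [add_comp, mul_comp] at this
    rw [sub_mul, heq, ← this]
    ring
  have hlt := degree_mod_lt N hD
  have hr : N % D ≠ 0 := by
    intro h0
    rw [h0, zero_comp, mul_eq_zero] at h1
    rcases h1 with h1 | h1
    · exact hne (sub_eq_zero.1 h1)
    · rw [comp_eq_zero_iff] at h1
      rcases h1 with h1 | h1
      · exact hD h1
      · have h2 := h1.2
        rw [h2] at hh
        simp at hh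
  have h2 := congrArg natDegree h1
  have h3 : D.comp h ≠ 0 := by
    intro h0
    rw [h0, mul_zero] at h1
    rw [eq_comm, comp_eq_zero_iff] at h1
    rcases h1 with h1 | h1
    · exact hr h1
    · have h2 := h1.2
      rw [h2] at hh
      simp at hh
  rw [natDegree_mul (sub_ne_zero.2 hne) h3, natDegree_comp, natDegree_comp] at h2
  have h4 := natDegree_lt_natDegree hr hlt
  have := Nat.mul_lt_mul_of_pos_right h4 hh
  omega

lemma exists_luroth_generator_natDegree_lt (E : IntermediateField K (RatFunc K)) (hE : E ≠ ⊥) :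
    ∃ u v : K[X], IsCoprime u v ∧ v ≠ 0 ∧ v.natDegree < u.natDegree ∧
      E = K⟮algebraMap K[X] (RatFunc K) u / algebraMap K[X] (RatFunc K) v⟯ := by
  obtain ⟨g, hg⟩ : ∃ g, E = K⟮g⟯ := ⟨_, RatFunc.Luroth.eq_adjoin_generator⟩
  have hgc : ∀ c : K, g ≠ algebraMap K (RatFunc K) c := by
    rintro c rfl
    exact hE (hg.trans (by rw [adjoin_simple_eq_bot_iff]; exact IntermediateField.algebraMap_mem _ _))
  have hinv : ∀ x : RatFunc K, K⟮x⁻¹⟯ = K⟮x⟯ := fun x ↦ by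
    apply le_antisymm
    · rw [adjoin_simple_le_iff]; exact inv_mem (mem_adjoin_simple_self K x)
    · rw [adjoin_simple_le_iff]
      simpa using inv_mem (mem_adjoin_simple_self K x⁻¹)
  have hsub : ∀ (x : RatFunc K) (c : K), K⟮x - algebraMap K _ c⟯ = K⟮x⟯ := fun x c ↦ by
    apply le_antisymm
    · rw [adjoin_simple_le_iff]; exact sub_mem (mem_adjoin_simple_self K x) (IntermediateField.algebraMap_mem _ _)
    · rw [adjoin_simple_le_iff]
      simpa using add_mem (mem_adjoin_simple_self K (x - algebraMap K _ c)) (IntermediateField.algebraMap_mem _ c)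
  have hden := g.denom_ne_zero
  have hcop := g.isCoprime_num_denom
  have hgd : g = algebraMap K[X] (RatFunc K) g.num / algebraMap K[X] (RatFunc K) g.denom :=
    (g.num_div_denom).symm
  have hd' : algebraMap K[X] (RatFunc K) g.denom ≠ 0 := by simpa using hden
  have hnum : g.num ≠ 0 := by
    intro h0
    apply hgc 0
    rw [hgd, h0]
    simp
  rcases lt_trichotomy g.denom.natDegree g.num.natDegree with h | h | h
  · exact ⟨g.num, g.denom, hcop, hden, h, by rw [hg]; congr⟩
  · set c := g.num.leadingCoeff / g.denom.leadingCoeff with hc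
    have hlc : g.denom.leadingCoeff ≠ 0 := by simpa using hden
    have hc0 : c ≠ 0 := div_ne_zero (by simpa using hnum) hlc
    have hne : g.num - C c * g.denom ≠ 0 := by
      intro h0
      apply hgc c
      conv_lhs => rw [hgd]
      rw [sub_eq_zero] at h0
      rw [h0, map_mul, mul_div_assoc, div_self hd', mul_one]
      rfl
    refine ⟨g.denom, g.num - C c * g.denom, ?_, hne, ?_, ?_⟩
    · rw [show g.num - C c * g.denom = g.num + g.denom * (-C c) by ring]
      exact hcop.symm.add_mul_left_right _
    · have hdeg : (g.num - C c * g.denom).degree < g.num.degree := by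
        refine degree_sub_lt_left ?_ hnum ?_
        · rw [degree_C_mul hc0, degree_eq_natDegree hden, degree_eq_natDegree hnum, h]
        · rw [leadingCoeff_mul, leadingCoeff_C, hc, div_mul_cancel₀ _ hlc]
      rw [h]
      exact natDegree_lt_natDegree hne hdeg
    · rw [hg, ← hsub g c, ← hinv]
      congr 1
      have h1 : algebraMap K[X] (RatFunc K) (g.num - C c * g.denom) ≠ 0 :=
        (map_ne_zero_iff _ (FaithfulSMul.algebraMap_injective K[X] (RatFunc K))).2 hne
      have h2 : g - algebraMap K (RatFunc K) c =
          algebraMap K[X] (RatFunc K) (g.num - C c * g.denom) /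
            algebraMap K[X] (RatFunc K) g.denom := by
        rw [map_sub, sub_div, ← hgd, map_mul, mul_div_assoc, div_self hd', mul_one]
        rfl
      rw [h2, inv_div]
  · refine ⟨g.denom, g.num, hcop.symm, hnum, h, ?_⟩
    rw [hg, ← hinv]
    congr 1
    rw [← inv_div, ← hgd]

/-- **Lüroth's theorem** for intermediate fields containing a nonconstant polynomial: there is
a polynomial generator, and all polynomials in the field are polynomials in the generator. -/
theorem exists_polynomial_luroth_generator (E : IntermediateField K (RatFunc K)) (p : K[X])
    (hp : 0 < p.natDegree) (hpE : algebraMap K[X] (RatFunc K) p ∈ E) :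
    ∃ h : K[X], 0 < h.natDegree ∧ E = K⟮algebraMap K[X] (RatFunc K) h⟯ ∧
      ∀ x : K[X], algebraMap K[X] (RatFunc K) x ∈ E → ∃ P : K[X], x = P.comp h := by
  have hE : E ≠ ⊥ := by
    rintro rfl
    obtain ⟨c, hc⟩ := mem_bot.1 hpE
    have : C c = p := FaithfulSMul.algebraMap_injective K[X] (RatFunc K) hc
    rw [← this] at hp
    simp at hp
  obtain ⟨u, v, hcop, hv, huv, hEg⟩ := exists_luroth_generator_natDegree_lt E hE
  have hfrac : ∀ x : RatFunc K, x ∈ E → ∃ N D : K[X], D ≠ 0 ∧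
      x * aeval (algebraMap K[X] (RatFunc K) u / algebraMap K[X] (RatFunc K) v) D =
      aeval (algebraMap K[X] (RatFunc K) u / algebraMap K[X] (RatFunc K) v) N := by
    intro x hx
    rw [hEg, mem_adjoin_simple_iff] at hx
    obtain ⟨N, D, hx⟩ := hx
    by_cases hD : aeval (algebraMap K[X] (RatFunc K) u / algebraMap K[X] (RatFunc K) v) D = 0
    · exact ⟨0, 1, one_ne_zero, by rw [hx, hD]; simp⟩
    · refine ⟨N, D, fun h ↦ hD (by rw [h, map_zero]), ?_⟩
      rw [hx, div_mul_cancel₀ _ hD]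
  obtain ⟨N, D, hD, hND⟩ := hfrac _ hpE
  obtain ⟨c, hc, hcv⟩ := isUnit_iff.1 (isUnit_of_mul_aeval_eq u v p N D hcop hv huv hp hD hND)
  have hc0 := hc.ne_zero
  have hu : algebraMap K[X] (RatFunc K) u / algebraMap K[X] (RatFunc K) v =
      algebraMap K[X] (RatFunc K) (C c⁻¹ * u) := by
    rw [← hcv, div_eq_iff (by simpa using hc0), ← map_mul]
    congr 1
    rw [mul_right_comm, ← C_mul, inv_mul_cancel₀ hc0, C_1, one_mul]
  have hdeg : 0 < (C c⁻¹ * u).natDegree := by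
    rw [natDegree_C_mul (inv_ne_zero hc0)]
    omega
  refine ⟨C c⁻¹ * u, hdeg, by rw [hEg, hu], fun x hx ↦ ?_⟩
  obtain ⟨N, D, hD, hND⟩ := hfrac _ hx
  refine eq_comp_of_mul_comp_eq _ x N D hdeg hD ?_
  apply FaithfulSMul.algebraMap_injective K[X] (RatFunc K)
  have hcomp : ∀ q : K[X], algebraMap K[X] (RatFunc K) (q.comp (C c⁻¹ * u)) =
      aeval (algebraMap K[X] (RatFunc K) (C c⁻¹ * u)) q := fun q ↦ by
    rw [comp_eq_aeval, ← aeval_algebraMap_apply]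
  rw [map_mul, hcomp, hcomp, ← hu, hND]

end Luroth

section AlgebraicallyClosed

open IntermediateField

variable {k R B : Type u} [Field k] [CommRing R] [Algebra k R] [CommRing B]
    [Algebra k B] [Algebra R B] [IsScalarTower k R B]

lemma PlaneFamily.ker_fib_le (β : PlaneFamily k R B) (ψ : B →ₐ[k] k) (ε : R →ₐ[k] k)
    (h : ∀ r, ψ (algebraMap R B r) = ε r) : RingHom.ker (β.fib ε) ≤ RingHom.ker ψ := by
  rw [β.ker_fib, Ideal.map_le_iff_le_comap]
  intro x hx
  rw [Ideal.mem_comap, RingHom.mem_ker, h]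
  exact hx

lemma exists_algebraMap_eq_of_isIntegral {k C : Type*} [Field k] [IsAlgClosed k] [CommRing C]
    [IsDomain C] [Algebra k C] {x : C} (hx : IsIntegral k x) : ∃ l : k, algebraMap k C l = x := by
  have : Algebra.IsIntegral k (Algebra.adjoin k {x}) :=
    Algebra.IsIntegral.adjoin (by simpa using hx)
  obtain ⟨l, hl⟩ := (IsAlgClosed.algebraMap_bijective_of_isIntegral (k := k)
    (K := Algebra.adjoin k {x})).2 ⟨x, Algebra.self_mem_adjoin_singleton k x⟩
  exact ⟨l, congrArg Subtype.val hl⟩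

lemma PlaneFamily.exists_fib_eq_C_of_isIntegral [IsAlgClosed k] (β : PlaneFamily k R B)
    (ε : R →ₐ[k] k) {b : B} (hb : IsIntegral R b) :
    ∃ l : k, β.fib ε (b - algebraMap k B l) = 0 := by
  have h : IsIntegral k (β.fib ε b) := by
    obtain ⟨P, hP, hPb⟩ := hb
    refine ⟨P.map (ε : R →+* k), hP.map _, ?_⟩
    have h1 := congrArg (β.fib ε : B →+* MvPolynomial (Fin 2) k) hPb
    rw [Polynomial.hom_eval₂, map_zero] at h1
    rw [Polynomial.eval₂_map, ← h1]
    congr 1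
    ext1 r
    simp [β.fib_algebraMap, MvPolynomial.algebraMap_eq]
  obtain ⟨l, hl⟩ := exists_algebraMap_eq_of_isIntegral h
  exact ⟨l, by rw [map_sub, AlgHom.commutes, hl, sub_self]⟩

variable [IsDomain R] [IsDomain B] (K E : Type u) [Field K] [Algebra R K] [IsFractionRing R K]
  [Field E] [Algebra B E] [IsFractionRing B E] [Algebra K E] [Algebra R E] [IsScalarTower R K E]
  [IsScalarTower R B E]

/-- The function field of the base is algebraically closed in that of the total space. -/
lemma PlaneFamily.exists_algebraMap_eq_of_isIntegral [CharZero k] [IsAlgClosed k]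
    [Algebra.FiniteType k R] [Algebra.FiniteType k B]
    (β : PlaneFamily k R B) {b : B} (hb : IsIntegral R b) :
    ∃ z : K, algebraMap K E z = algebraMap B E b := by
  classical
  by_contra hcon
  let _ : Algebra k K := ((algebraMap R K).comp (algebraMap k R)).toAlgebra
  have : IsScalarTower k R K := IsScalarTower.of_algebraMap_eq fun x ↦ rfl
  have : CharZero K := charZero_of_injective_algebraMap (algebraMap k K).injective
  have hRB := β.injective_algebraMap
  let c := algebraMap B E b
  let L := AlgebraicClosure K
  have hc : IsIntegral K c := (hb.algebraMap (B := E)).tower_top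
  obtain ⟨x₁, x₂, hx⟩ : ∃ x₁ x₂ : { x // x ∈ (minpoly K c).aroots L }, x₁ ≠ x₂ := by
    have h1 : 1 < (minpoly K c).natDegree := by
      refine lt_of_le_of_ne (minpoly.natDegree_pos hc) fun h ↦ hcon ?_
      exact minpoly.natDegree_eq_one_iff.1 h.symm
    rw [← Polynomial.card_rootSet_eq_natDegree (K := L) (minpoly.irreducible hc).separable
      (IsAlgClosed.splits _), Fintype.one_lt_card_iff] at h1
    obtain ⟨⟨x, hx⟩, ⟨y, hy⟩, hxy⟩ := h1
    exact ⟨⟨x, Multiset.mem_toFinset.1 hx⟩, ⟨y, Multiset.mem_toFinset.1 hy⟩, by simpa using hxy⟩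
  let S := Algebra.adjoin R {b}
  let bS : S := ⟨b, Algebra.self_mem_adjoin_singleton R b⟩
  have hi : ∀ x : { x // x ∈ (minpoly K c).aroots L }, ∃ i : S →ₐ[R] L,
      i bS = x ∧ Function.Injective i := by
    intro x
    let T : Subalgebra R E := K⟮c⟯.toSubalgebra.restrictScalars R
    let f : S →ₐ[R] T := ((IsScalarTower.toAlgHom R B E).comp S.val).codRestrict T (by
      have h : S ≤ T.comap (IsScalarTower.toAlgHom R B E) := by
        refine Algebra.adjoin_le ?_
        rintro _ rfl
        exact IntermediateField.mem_adjoin_simple_self K c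
      exact fun x ↦ h x.2)
    let g : K⟮c⟯ →ₐ[K] L := (algHomAdjoinIntegralEquiv K hc).symm x
    let g' : T →ₐ[R] L := g.restrictScalars R
    refine ⟨g'.comp f, ?_, ?_⟩
    · exact algHomAdjoinIntegralEquiv_symm_apply_gen K hc x
    · have h1 : Function.Injective g' := g.injective
      have h2 : Function.Injective f := by
        refine (AlgHom.injective_codRestrict _ _ _).2 ?_
        exact (IsFractionRing.injective B E).comp Subtype.val_injective
      exact h1.comp h2
  obtain ⟨i₁, hi₁, hinj₁⟩ := hi x₁
  obtain ⟨i₂, hi₂, hinj₂⟩ := hi x₂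
  have : IsNoetherianRing R := Algebra.FiniteType.isNoetherianRing k R
  have hSfg : S.FG := ⟨{b}, by simp [S]⟩
  have : Algebra.FiniteType R S := S.fg_iff_finiteType.1 hSfg
  have : Algebra.FiniteType k S := Algebra.FiniteType.trans (S := R) inferInstance inferInstance
  have : IsNoetherianRing S := Algebra.FiniteType.isNoetherianRing k S
  have : Algebra.FiniteType S B := Algebra.FiniteType.of_restrictScalars_finiteType k S B
  obtain ⟨σ, hσ, hext⟩ := exists_forall_exists_algHom_extension (k := k) (S := S) (C := B)
    Subtype.val_injective 1 one_ne_zero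
  let C : Subalgebra R L := i₁.range ⊔ i₂.range
  have : Algebra.FiniteType R C := by
    have h : ∀ i : S →ₐ[R] L, i.range.FG := fun i ↦ by
      rw [← Algebra.map_top]
      exact (Algebra.FiniteType.out (R := R) (A := S)).map i
    exact C.fg_iff_finiteType.1 ((h i₁).sup (h i₂))
  have : Algebra.FiniteType k C := Algebra.FiniteType.trans (S := R) inferInstance inferInstance
  let j₁ : S →ₐ[R] C := i₁.codRestrict C fun x ↦ le_sup_left (α := Subalgebra R L) ⟨x, rfl⟩
  let j₂ : S →ₐ[R] C := i₂.codRestrict C fun x ↦ le_sup_right (α := Subalgebra R L) ⟨x, rfl⟩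
  have hne : (j₁ bS - j₂ bS) * (j₁ σ * j₂ σ) ≠ 0 := by
    have h₁ : j₁ σ ≠ 0 := fun h ↦ hσ (hinj₁ (by simpa [j₁] using congrArg Subtype.val h))
    have h₂ : j₂ σ ≠ 0 := fun h ↦ hσ (hinj₂ (by simpa [j₂] using congrArg Subtype.val h))
    refine mul_ne_zero (fun h ↦ hx (Subtype.ext ?_)) (mul_ne_zero h₁ h₂)
    rw [← hi₁, ← hi₂]
    simpa [j₁, j₂] using congrArg Subtype.val (sub_eq_zero.1 h)
  obtain ⟨r, hr, hψ⟩ := exists_forall_exists_algHom_extension (k := k) (S := R) (C := C)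
    (fun x y h ↦ by
      have h1 : algebraMap R L x = algebraMap R L y := congrArg Subtype.val h
      rw [IsScalarTower.algebraMap_apply R K L, IsScalarTower.algebraMap_apply R K L] at h1
      exact IsFractionRing.injective R K ((algebraMap K L).injective h1)) _ hne
  obtain ⟨ε, hε⟩ := exists_algHom_apply_ne_zero (k := k) r hr
  obtain ⟨ψ, hψR, hψne⟩ := hψ ε hε
  obtain ⟨l, hl⟩ := β.exists_fib_eq_C_of_isIntegral ε hb
  have hval : ∀ j : S →ₐ[R] C, ψ (j σ) ≠ 0 → ψ (j bS) = l := by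
    intro j hj
    obtain ⟨ψ', hψ', -⟩ := hext (ψ.comp (j.restrictScalars k)) hj
    have h1 := β.ker_fib_le ψ' ε (fun r ↦ by
      rw [IsScalarTower.algebraMap_apply R S B, hψ', ← hψR]
      simp) hl
    rw [RingHom.mem_ker, map_sub, AlgHom.commutes, sub_eq_zero] at h1
    exact (hψ' bS).symm.trans h1
  rw [map_mul, map_mul, map_sub] at hψne
  apply hψne
  rw [hval j₁ (fun h ↦ hψne (by rw [h]; ring)), hval j₂ (fun h ↦ hψne (by rw [h]; ring))]
  simp

end AlgebraicallyClosed

section Parametrization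

open Polynomial IntermediateField

lemma MvPolynomial.aeval_eval₂_X {R D : Type*} [CommRing R] [CommRing D] [Algebra R D]
    (P : R[X][X]) (u v : D) :
    MvPolynomial.aeval ![u, v] (P.eval₂ (Polynomial.aeval (R := R)
      (MvPolynomial.X 0 : MvPolynomial (Fin 2) R)).toRingHom (MvPolynomial.X 1)) =
      P.eval₂ (Polynomial.aeval u : R[X] →ₐ[R] D).toRingHom v := by
  have h := Polynomial.hom_eval₂ P (Polynomial.aeval (R := R)
    (MvPolynomial.X 0 : MvPolynomial (Fin 2) R)).toRingHom
    (MvPolynomial.aeval (R := R) ![u, v]).toRingHom (MvPolynomial.X 1)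
  refine h.trans ?_
  congr 1
  · ext x <;> simp
  · simp

variable {k : Type*} [Field k]

lemma Polynomial.exists_comp_eq_and_adjoin_eq_top (p₀ q₀ : k[X]) (hp₀ : 0 < p₀.natDegree) :
    ∃ h p q : k[X], 0 < h.natDegree ∧ p₀ = p.comp h ∧ q₀ = q.comp h ∧
      k⟮algebraMap k[X] (RatFunc k) p, algebraMap k[X] (RatFunc k) q⟯ = ⊤ := by
  obtain ⟨h, hh, hE, hcomp⟩ := exists_polynomial_luroth_generator
    k⟮algebraMap k[X] (RatFunc k) p₀, algebraMap k[X] (RatFunc k) q₀⟯ p₀ hp₀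
    (subset_adjoin k _ (by simp))
  obtain ⟨p, hp⟩ := hcomp p₀ (subset_adjoin k _ (by simp))
  obtain ⟨q, hq⟩ := hcomp q₀ (subset_adjoin k _ (by simp))
  refine ⟨h, p, q, hh, hp, hq, ?_⟩
  have hmem : algebraMap k[X] (RatFunc k) h ∈
      k⟮algebraMap k[X] (RatFunc k) p₀, algebraMap k[X] (RatFunc k) q₀⟯ := by
    rw [hE]
    exact mem_adjoin_simple_self k _
  have hinj : Function.Injective (algebraMap k[X] (RatFunc k)) := IsFractionRing.injective _ _
  have hadj : ∀ u v : k[X], ∀ x ∈ Algebra.adjoin k {algebraMap k[X] (RatFunc k) u,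
      algebraMap k[X] (RatFunc k) v}, ∃ Θ : MvPolynomial (Fin 2) k,
        x = algebraMap k[X] (RatFunc k) (MvPolynomial.aeval ![u, v] Θ) := by
    intro u v x hx
    rw [← Matrix.range_cons_cons_empty _ _ ![], Algebra.adjoin_range_eq_range_aeval] at hx
    obtain ⟨Θ, rfl⟩ := hx
    refine ⟨Θ, ?_⟩
    rw [← MvPolynomial.aeval_algebraMap_apply]
    refine congrArg (fun f ↦ MvPolynomial.aeval f Θ) ?_
    ext i
    fin_cases i <;> rfl
  rw [mem_adjoin_iff_div] at hmem
  obtain ⟨r, hr, s, hs, hrs⟩ := hmem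
  obtain ⟨Θ, rfl⟩ := hadj _ _ r hr
  obtain ⟨Ψ, rfl⟩ := hadj _ _ s hs
  have hΨ : MvPolynomial.aeval ![p₀, q₀] Ψ ≠ 0 := by
    intro h0
    rw [h0, map_zero, div_zero, map_eq_zero_iff _ hinj] at hrs
    simp [hrs] at hh
  rw [eq_div_iff ((map_ne_zero_iff _ hinj).2 hΨ), ← map_mul] at hrs
  have hc : ∀ Θ : MvPolynomial (Fin 2) k, MvPolynomial.aeval ![p₀, q₀] Θ =
      (MvPolynomial.aeval ![p, q] Θ).comp h := by
    intro Θ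
    have : (MvPolynomial.aeval ![p₀, q₀] : MvPolynomial (Fin 2) k →ₐ[k] k[X]) =
        (Polynomial.aeval h).comp (MvPolynomial.aeval ![p, q]) := by
      ext1 i
      fin_cases i
      · simp [hp, Polynomial.comp, Polynomial.aeval_def]
      · simp [hq, Polynomial.comp, Polynomial.aeval_def]
    rw [this]
    simp [Polynomial.comp, Polynomial.aeval_def]
  have hX : (X * MvPolynomial.aeval ![p, q] Ψ - MvPolynomial.aeval ![p, q] Θ).comp h = 0 := by
    rw [sub_comp, mul_comp, X_comp, ← hc, ← hc, hinj hrs, sub_self]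
  have hX0 : X * MvPolynomial.aeval ![p, q] Ψ = MvPolynomial.aeval ![p, q] Θ := by
    rcases comp_eq_zero_iff.1 hX with h1 | ⟨-, h1⟩
    · exact sub_eq_zero.1 h1
    · rw [h1] at hh
      simp at hh
  have hΨ' : MvPolynomial.aeval ![p, q] Ψ ≠ 0 := by
    intro h0
    rw [hc, h0, zero_comp] at hΨ
    exact hΨ rfl
  have hmem : ∀ Θ : MvPolynomial (Fin 2) k, algebraMap k[X] (RatFunc k)
      (MvPolynomial.aeval ![p, q] Θ) ∈
      k⟮algebraMap k[X] (RatFunc k) p, algebraMap k[X] (RatFunc k) q⟯ := by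
    intro Θ
    apply algebra_adjoin_le_adjoin
    rw [← MvPolynomial.aeval_algebraMap_apply, ← Matrix.range_cons_cons_empty _ _ ![],
      Algebra.adjoin_range_eq_range_aeval]
    refine ⟨Θ, congrArg (fun f ↦ MvPolynomial.aeval f Θ) ?_⟩
    ext i
    fin_cases i <;> rfl
  have hXmem : (RatFunc.X : RatFunc k) ∈
      k⟮algebraMap k[X] (RatFunc k) p, algebraMap k[X] (RatFunc k) q⟯ := by
    have h1 : (RatFunc.X : RatFunc k) = algebraMap k[X] (RatFunc k) (MvPolynomial.aeval ![p, q] Θ)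
        / algebraMap k[X] (RatFunc k) (MvPolynomial.aeval ![p, q] Ψ) := by
      rw [eq_div_iff ((map_ne_zero_iff _ hinj).2 hΨ'), ← RatFunc.algebraMap_X,
        ← map_mul, hX0]
    rw [h1]
    exact div_mem (hmem _) (hmem _)
  have h2 := RatFunc.IntermediateField.adjoin_X
    k⟮algebraMap k[X] (RatFunc k) p, algebraMap k[X] (RatFunc k) q⟯
  rw [eq_top_iff]
  intro x _
  have h3 : x ∈ (⊤ : IntermediateField
    k⟮algebraMap k[X] (RatFunc k) p, algebraMap k[X] (RatFunc k) q⟯ (RatFunc k)) := trivial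
  rw [← h2, adjoin_simple_eq_bot_iff.2 ?_] at h3
  · obtain ⟨y, rfl⟩ := mem_bot.1 h3
    exact y.2
  · exact mem_bot.2 ⟨⟨_, hXmem⟩, rfl⟩

lemma Polynomial.natDegree_le_of_adjoin_eq_top (p q : k[X]) (hp : 0 < p.natDegree)
    (htop : k⟮algebraMap k[X] (RatFunc k) p, algebraMap k[X] (RatFunc k) q⟯ = ⊤) (P : k[X][X])
    (hP : P.Monic) (hPq : P.eval₂ (aeval p : k[X] →ₐ[k] k[X]).toRingHom q = 0) :
    p.natDegree ≤ P.natDegree := by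
  let K₁ := k⟮algebraMap k[X] (RatFunc k) p⟯
  have h1 : Module.finrank K₁ (RatFunc k) = p.natDegree := by
    rw [RatFunc.finrank_eq_max_natDegree, RatFunc.num_algebraMap, RatFunc.denom_algebraMap]
    simp
  have : FiniteDimensional K₁ (RatFunc k) := Module.finite_of_finrank_pos (by omega)
  let f : k[X] →+* K₁ := (aeval (R := k) (A := K₁) ⟨_, mem_adjoin_simple_self k _⟩).toRingHom
  have h2 : K₁⟮algebraMap k[X] (RatFunc k) q⟯ = ⊤ := by
    apply restrictScalars_injective k
    rw [adjoin_simple_adjoin_simple, htop]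
    rfl
  rw [← h1, ← (Field.primitive_element_iff_minpoly_natDegree_eq _ _).1 h2,
    ← (hP.natDegree_map f)]
  refine natDegree_le_natDegree (minpoly.min K₁ _ (hP.map f) ?_)
  rw [aeval_def, eval₂_map]
  have h3 := congrArg (algebraMap k[X] (RatFunc k)) hPq
  rw [hom_eval₂, map_zero] at h3
  rw [← h3]
  congr 1
  ext x
  · simp [f]
  · simp [f]

lemma Polynomial.natDegree_le_mul_of_monic (p q : k[X]) (P : k[X][X]) (M : ℕ)
    (hM : ∀ i, (P.coeff i).natDegree ≤ M)
    (hP : P.Monic) (hPq : P.eval₂ (aeval p : k[X] →ₐ[k] k[X]).toRingHom q = 0) :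
    q.natDegree ≤ M * p.natDegree := by
  by_contra! hlt
  have hq : q ≠ 0 := by
    rintro rfl
    simp at hlt
  rw [eval₂_eq_sum_range, Finset.sum_range_succ, hP.coeff_natDegree, map_one, one_mul,
    add_eq_zero_iff_neg_eq'] at hPq
  have h1 : (q ^ P.natDegree).degree = (P.natDegree * q.natDegree : ℕ) := by
    rw [degree_eq_natDegree (pow_ne_zero _ hq), natDegree_pow]
  have h2 : (q ^ P.natDegree).degree < (P.natDegree * q.natDegree : ℕ) := by
    rw [← degree_neg, hPq]
    refine (degree_sum_le _ _).trans_lt ((Finset.sup_lt_iff (WithBot.bot_lt_coe _)).2 ?_)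
    intro i hi
    rw [Finset.mem_range] at hi
    refine (degree_le_natDegree).trans_lt (Nat.cast_lt.2 ?_)
    calc _ ≤ ((aeval p : k[X] →ₐ[k] k[X]) (P.coeff i)).natDegree + (q ^ i).natDegree :=
          natDegree_mul_le
      _ = (P.coeff i).natDegree * p.natDegree + i * q.natDegree := by
          rw [natDegree_pow, aeval_def, algebraMap_eq, ← Polynomial.comp, natDegree_comp]
      _ ≤ M * p.natDegree + i * q.natDegree := by gcongr; exact hM i
      _ < (i + 1) * q.natDegree := by linarith
      _ ≤ _ := by gcongr; omega
  rw [h1] at h2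
  exact lt_irrefl _ h2

/-- A nonconstant polynomial in two variables restricts to a nonconstant one on some line. -/
lemma exists_algHom_natDegree_pos [Infinite k] (a : MvPolynomial (Fin 2) k)
    (ha : ∀ c, a ≠ MvPolynomial.C c) :
    ∃ ρ : MvPolynomial (Fin 2) k →ₐ[k] k[X], 0 < (ρ a).natDegree := by
  obtain ⟨v, hv⟩ : ∃ v, MvPolynomial.eval v a ≠ MvPolynomial.eval 0 a := by
    by_contra! h
    exact ha _ (MvPolynomial.funext fun v ↦ by rw [h, MvPolynomial.eval_C])
  refine ⟨MvPolynomial.aeval fun i ↦ X * C (v i), ?_⟩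
  by_contra h
  obtain ⟨c, hc⟩ := natDegree_eq_zero.1 (Nat.eq_zero_of_not_pos h)
  have h1 : ∀ t : k, MvPolynomial.eval (fun i ↦ t * v i) a = c := by
    intro t
    have h2 := congrArg (aeval t) hc
    have h3 : (aeval t).comp (MvPolynomial.aeval fun i ↦ X * C (v i)) =
        MvPolynomial.aeval fun i ↦ t * v i := by
      ext1 i
      simp [mul_comm t]
    rw [← AlgHom.comp_apply, h3, MvPolynomial.aeval_eq_eval] at h2
    simpa using h2.symm
  apply hv
  have h2 := h1 1
  have h3 := h1 0
  simp only [one_mul, zero_mul] at h2 h3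
  rw [h2, ← h3]
  rfl

lemma exists_bounded_parametrization [Infinite k] (a w : MvPolynomial (Fin 2) k)
    (ha : ∀ c, a ≠ MvPolynomial.C c) (P : k[X][X]) (M : ℕ)
    (hM : ∀ i, (P.coeff i).natDegree ≤ M)
    (hP : P.Monic)
    (hPw : P.eval₂ (aeval a : k[X] →ₐ[k] MvPolynomial (Fin 2) k).toRingHom w = 0) :
    ∃ p q : k[X], 0 < p.natDegree ∧ p.natDegree ≤ P.natDegree ∧
      q.natDegree ≤ M * P.natDegree ∧
      ∀ Θ : MvPolynomial (Fin 2) k, MvPolynomial.aeval ![a, w] Θ = 0 →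
        MvPolynomial.aeval ![p, q] Θ = 0 := by
  obtain ⟨ρ, hρ⟩ := exists_algHom_natDegree_pos a ha
  obtain ⟨h, p, q, hh, hp, hq, htop⟩ := exists_comp_eq_and_adjoin_eq_top (ρ a) (ρ w) hρ
  have hp0 : 0 < p.natDegree := by
    rw [hp, natDegree_comp] at hρ
    exact Nat.pos_of_mul_pos_right hρ
  have hcomp : ∀ x : k[X], x.comp h = 0 → x = 0 := by
    intro x hx
    rcases comp_eq_zero_iff.1 hx with h1 | ⟨-, h1⟩
    · exact h1
    · rw [h1] at hh
      simp at hh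
  have hrel : ∀ Θ : MvPolynomial (Fin 2) k, MvPolynomial.aeval ![a, w] Θ = 0 →
      MvPolynomial.aeval ![p, q] Θ = 0 := by
    intro Θ hΘ
    apply hcomp
    have h1 : (aeval h).comp (MvPolynomial.aeval ![p, q]) =
        ρ.comp (MvPolynomial.aeval ![a, w]) := by
      ext1 i
      fin_cases i
      · simp [hp, Polynomial.comp, Polynomial.aeval_def]
      · simp [hq, Polynomial.comp, Polynomial.aeval_def]
    have h2 := DFunLike.congr_fun h1 Θ
    rw [AlgHom.comp_apply, AlgHom.comp_apply, hΘ, map_zero] at h2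
    exact h2
  have hPq : P.eval₂ (aeval p : k[X] →ₐ[k] k[X]).toRingHom q = 0 := by
    rw [← MvPolynomial.aeval_eval₂_X]
    exact hrel _ (by rw [MvPolynomial.aeval_eval₂_X, hPw])
  have hdeg := natDegree_le_of_adjoin_eq_top p q hp0 htop P hP hPq
  exact ⟨p, q, hp0, hdeg, (natDegree_le_mul_of_monic p q P M hM hP hPq).trans (by gcongr), hrel⟩

end Parametrization

section GenericParametrization

open Polynomial

/-- The polynomial with prescribed coefficients. -/
noncomputable def Polynomial.ofCoeffs {C : Type*} [CommRing C] {N : ℕ} (x : Fin (N + 1) → C) :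
    C[X] :=
  ∑ i : Fin (N + 1), monomial (i : ℕ) (x i)

lemma Polynomial.coeff_ofCoeffs {C : Type*} [CommRing C] {N : ℕ} (x : Fin (N + 1) → C)
    (i : Fin (N + 1)) : (ofCoeffs x).coeff i = x i := by
  simp [ofCoeffs, finsetSum_coeff, coeff_monomial, Fin.val_inj]

lemma Polynomial.ofCoeffs_coeff {C : Type*} [CommRing C] {N : ℕ} (p : C[X])
    (hp : p.natDegree ≤ N) : ofCoeffs (fun i : Fin (N + 1) ↦ p.coeff i) = p := by
  conv_rhs => rw [p.as_sum_range' (N + 1) (by omega), Finset.sum_range]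
  rfl

lemma Polynomial.map_ofCoeffs {C D : Type*} [CommRing C] [CommRing D] (f : C →+* D) {N : ℕ}
    (x : Fin (N + 1) → C) : (ofCoeffs x).map f = ofCoeffs (fun i ↦ f (x i)) := by
  simp [ofCoeffs, Polynomial.map_sum]

/-- The equations for a nonconstant polynomial curve of bounded degree satisfying all the
relations between `a` and `w`. -/
noncomputable def curveIdeal {R B : Type*} [CommRing R] [CommRing B] [Algebra R B] (a w : B)
    (N : ℕ) : Ideal (MvPolynomial (Fin 3 × Fin (N + 1)) R) :=
  Ideal.span ({c | ∃ Θ : MvPolynomial (Fin 2) R, MvPolynomial.aeval ![a, w] Θ = 0 ∧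
      ∃ d, c = (MvPolynomial.aeval ![ofCoeffs fun i : Fin (N + 1) ↦
        (MvPolynomial.X (0, i) : MvPolynomial (Fin 3 × Fin (N + 1)) R),
        ofCoeffs fun i : Fin (N + 1) ↦ MvPolynomial.X (1, i)] Θ).coeff d} ∪
    {∑ i : Fin N, MvPolynomial.X (2, i.castSucc) * MvPolynomial.X (0, i.succ) - 1})

lemma map_aeval_ofCoeffs {R C : Type*} [CommRing R] [CommRing C] [Algebra R C] {N : ℕ}
    (x : Fin 3 × Fin (N + 1) → C) (Θ : MvPolynomial (Fin 2) R) :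
    (MvPolynomial.aeval ![ofCoeffs fun i : Fin (N + 1) ↦
        (MvPolynomial.X (0, i) : MvPolynomial (Fin 3 × Fin (N + 1)) R),
        ofCoeffs fun i : Fin (N + 1) ↦ MvPolynomial.X (1, i)] Θ).map
          (MvPolynomial.aeval (R := R) x : MvPolynomial (Fin 3 × Fin (N + 1)) R →+* C) =
      MvPolynomial.aeval ![ofCoeffs fun i ↦ x (0, i), ofCoeffs fun i ↦ x (1, i)] Θ := by
  have h : (mapAlgHom (MvPolynomial.aeval (R := R) x)).comp
      (MvPolynomial.aeval ![ofCoeffs fun i : Fin (N + 1) ↦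
        (MvPolynomial.X (0, i) : MvPolynomial (Fin 3 × Fin (N + 1)) R),
        ofCoeffs fun i : Fin (N + 1) ↦ MvPolynomial.X (1, i)]) =
      MvPolynomial.aeval ![ofCoeffs fun i ↦ x (0, i), ofCoeffs fun i ↦ x (1, i)] := by
    ext1 i
    fin_cases i <;> simp [map_ofCoeffs]
  exact DFunLike.congr_fun h Θ

lemma curveIdeal_le_ker_iff {R B C : Type*} [CommRing R] [CommRing B] [Algebra R B] [CommRing C]
    [Algebra R C] (a w : B) (N : ℕ) (x : Fin 3 × Fin (N + 1) → C) :
    curveIdeal (R := R) a w N ≤ RingHom.ker (MvPolynomial.aeval (R := R) x) ↔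
      (∀ Θ : MvPolynomial (Fin 2) R, MvPolynomial.aeval ![a, w] Θ = 0 →
        MvPolynomial.aeval ![ofCoeffs fun i ↦ x (0, i), ofCoeffs fun i ↦ x (1, i)] Θ = 0) ∧
      ∑ i : Fin N, x (2, i.castSucc) * x (0, i.succ) = 1 := by
  rw [curveIdeal, Ideal.span_le, Set.union_subset_iff, Set.singleton_subset_iff]
  refine and_congr ⟨fun h Θ hΘ ↦ ?_, ?_⟩ ?_
  · ext d
    rw [← map_aeval_ofCoeffs, coeff_map, coeff_zero]
    exact h ⟨Θ, hΘ, d, rfl⟩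
  · rintro h _ ⟨Θ, hΘ, d, rfl⟩
    have h1 := h Θ hΘ
    rw [← map_aeval_ofCoeffs] at h1
    have h2 := congrArg (fun p ↦ coeff p d) h1
    simp only [coeff_map, coeff_zero] at h2
    exact h2
  · rw [SetLike.mem_coe, RingHom.mem_ker, map_sub, sub_eq_zero]
    simp only [map_sum, map_mul, MvPolynomial.aeval_X, map_one]

lemma exists_isGalois_forall_mem {K ι : Type*} [Field K] [CharZero K] [Finite ι]
    (y : ι → AlgebraicClosure K) : ∃ L : IntermediateField K (AlgebraicClosure K),
      FiniteDimensional K L ∧ IsGalois K L ∧ ∀ i, y i ∈ L := by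
  let L₀ := IntermediateField.adjoin K (Set.range y)
  have : FiniteDimensional K L₀ :=
    IntermediateField.finiteDimensional_adjoin fun x _ ↦ Algebra.IsIntegral.isIntegral x
  exact ⟨IntermediateField.normalClosure K L₀ (AlgebraicClosure K), inferInstance, inferInstance,
    fun i ↦ L₀.le_normalClosure (IntermediateField.subset_adjoin K _ ⟨i, rfl⟩)⟩

variable {k R B : Type u} [Field k] [CommRing R] [Algebra k R] [CommRing B]
    [Algebra k B] [Algebra R B] [IsScalarTower k R B]

lemma PlaneFamily.exists_parametrization [IsAlgClosed k] [CharZero k] [IsDomain R]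
    [IsDomain B] [Algebra.FiniteType k R] [Algebra.FiniteType k B] (β : PlaneFamily k R B) (K : Type u) [Field K] [Algebra R K]
    [IsFractionRing R K] (a w : B) (ha : Transcendental R a) (P : R[X][X]) (hP : P.Monic)
    (hPw : P.eval₂ (aeval a : R[X] →ₐ[R] B).toRingHom w = 0) :
    ∃ L : IntermediateField K (AlgebraicClosure K), FiniteDimensional K L ∧ IsGalois K L ∧
      ∃ p q : L[X], 0 < p.natDegree ∧
        ∀ Θ : MvPolynomial (Fin 2) R, MvPolynomial.aeval ![a, w] Θ = 0 →
          MvPolynomial.aeval ![p, q] Θ = 0 := by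
  obtain ⟨M, hM⟩ : ∃ M, ∀ i, (P.coeff i).natDegree ≤ M := by
    refine ⟨P.support.sup fun i ↦ (P.coeff i).natDegree, fun i ↦ ?_⟩
    by_cases hi : i ∈ P.support
    · exact Finset.le_sup (f := fun i ↦ (P.coeff i).natDegree) hi
    · simp [notMem_support_iff.1 hi]
  let N := max P.natDegree (M * P.natDegree)
  let W := MvPolynomial (Fin 3 × Fin (N + 1)) R ⧸ curveIdeal (R := R) a w N
  have hW : ∀ r ≠ 0, algebraMap R W r ≠ 0 := by
    intro r hr h0
    obtain ⟨r₀, hr₀, hind⟩ := β.exists_forall_algebraicIndependent (fun _ : Unit ↦ a)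
      (algebraicIndependent_unique_type_iff.2 ha)
    obtain ⟨ε, hε⟩ := exists_algHom_apply_ne_zero (k := k) (r * r₀) (mul_ne_zero hr hr₀)
    rw [map_mul] at hε
    have hind' : Transcendental k (β.fib ε a) :=
      algebraicIndependent_unique_type_iff.1 (hind ε (right_ne_zero_of_mul hε))
    let _ : Algebra R k := (ε : R →+* k).toAlgebra
    have hmon : (P.map (mapRingHom (ε : R →+* k))).Monic := hP.map _
    have hdeg := hP.natDegree_map (mapRingHom (ε : R →+* k))
    have hfib : ∀ Θ : MvPolynomial (Fin 2) R, MvPolynomial.aeval ![β.fib ε a, β.fib ε w]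
        (Θ.map (ε : R →+* k)) = β.fib ε (MvPolynomial.aeval ![a, w] Θ) := by
      intro Θ
      have h : ((MvPolynomial.aeval (R := k) ![β.fib ε a, β.fib ε w]).toRingHom.comp
          (MvPolynomial.map (ε : R →+* k))) = ((β.fib ε : B →+* MvPolynomial (Fin 2) k).comp
            (MvPolynomial.aeval (R := R) ![a, w]).toRingHom) := by
        refine MvPolynomial.ringHom_ext (fun r ↦ ?_) fun i ↦ ?_
        · simp [β.fib_algebraMap, MvPolynomial.algebraMap_eq]
        · fin_cases i <;> simp
      exact DFunLike.congr_fun h Θ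
    obtain ⟨p, q, hp0, hpd, hqd, hrel⟩ := exists_bounded_parametrization (β.fib ε a) (β.fib ε w)
      (fun c hc ↦ hind' (by rw [hc]; exact isAlgebraic_algebraMap c))
      (P.map (mapRingHom (ε : R →+* k))) M (fun i ↦ by
        rw [coeff_map]
        exact natDegree_map_le.trans (hM i)) hmon (by
        have h1 := congrArg (β.fib ε : B →+* MvPolynomial (Fin 2) k) hPw
        rw [hom_eval₂, map_zero] at h1
        rw [eval₂_map]
        refine Eq.trans ?_ h1
        congr 1
        ext x
        · simp [β.fib_algebraMap, MvPolynomial.algebraMap_eq]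
        · simp)
    rw [hdeg] at hpd hqd
    let x : Fin 3 × Fin (N + 1) → k := fun i ↦ ![p.coeff i.2, q.coeff i.2,
      if (i.2 : ℕ) + 1 = p.natDegree then p.leadingCoeff⁻¹ else 0] i.1
    have hx := (curveIdeal_le_ker_iff (R := R) a w N x).2 ⟨by
      intro Θ hΘ
      have h1 : (ofCoeffs fun i : Fin (N + 1) ↦ x (0, i)) = p :=
        ofCoeffs_coeff p (hpd.trans (le_max_left _ _))
      have h2 : (ofCoeffs fun i : Fin (N + 1) ↦ x (1, i)) = q :=
        ofCoeffs_coeff q (hqd.trans (le_max_right _ _))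
      rw [h1, h2, ← MvPolynomial.aeval_map_algebraMap k]
      exact hrel _ ((hfib Θ).trans (by rw [hΘ, map_zero])), by
      have hN : p.natDegree ≤ N := hpd.trans (le_max_left _ _)
      rw [Finset.sum_eq_single (⟨p.natDegree - 1, by omega⟩ : Fin N)]
      · have h1 : p.natDegree - 1 + 1 = p.natDegree := by omega
        simp only [x, Fin.val_castSucc, h1, Fin.val_succ, if_true, Matrix.cons_val]
        exact inv_mul_cancel₀ (leadingCoeff_ne_zero.2 (by rintro rfl; simp at hp0))
      · intro i _ hi
        have h1 : (i : ℕ) + 1 ≠ p.natDegree := by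
          intro h
          exact hi (Fin.ext (by simp; omega))
        simp [x, h1]
      · simp⟩
    have h1 : (MvPolynomial.C r : MvPolynomial (Fin 3 × Fin (N + 1)) R) ∈
        curveIdeal (R := R) a w N := Ideal.Quotient.eq_zero_iff_mem.1 h0
    have h2 := hx h1
    rw [RingHom.mem_ker, MvPolynomial.aeval_C] at h2
    exact left_ne_zero_of_mul hε h2
  obtain ⟨f⟩ := exists_algHom_algebraicClosure (R := R) (S := W) K hW
  let y : Fin 3 × Fin (N + 1) → AlgebraicClosure K :=
    fun i ↦ f (Ideal.Quotient.mk _ (MvPolynomial.X i))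
  have : CharZero K := by
    have := charZero_of_injective_algebraMap (algebraMap k R).injective
    exact charZero_of_injective_algebraMap (IsFractionRing.injective R K)
  obtain ⟨L, hLf, hLg, hL⟩ := exists_isGalois_forall_mem y
  let x : Fin 3 × Fin (N + 1) → L := fun i ↦ ⟨y i, hL i⟩
  have hx := (curveIdeal_le_ker_iff (R := R) a w N x).1 (by
    intro G hG
    have h1 : (L.val.restrictScalars R).comp (MvPolynomial.aeval (R := R) x) =
        f.comp (Ideal.Quotient.mkₐ R _) := by
      ext1 i
      simp [x, y]
      rfl
    have h2 := DFunLike.congr_fun h1 G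
    rw [AlgHom.comp_apply, AlgHom.comp_apply, Ideal.Quotient.mkₐ_eq_mk,
      Ideal.Quotient.eq_zero_iff_mem.2 hG, map_zero] at h2
    exact Subtype.ext h2)
  refine ⟨L, hLf, hLg, _, _, ?_, hx.1⟩
  by_contra! h0
  refine zero_ne_one (α := L) (Eq.trans (Finset.sum_eq_zero fun i _ ↦ ?_).symm hx.2)
  rw [← coeff_ofCoeffs (fun i ↦ x (0, i)) i.succ, coeff_eq_zero_of_natDegree_lt, mul_zero]
  exact h0.trans_lt (by simp)

end GenericParametrization

section Descent

open Polynomial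

/-- Galois descent for the affine line: if the polynomial ring `K'[h] ⊆ E` is stable under the
Galois group of `E / F`, then its ring of invariants is a polynomial ring over `K`. -/
lemma exists_forall_exists_eq_aeval_of_isGalois {K K' F E : Type*} [Field K] [Field K'] [Field F]
    [Field E] [Algebra K K'] [Algebra K F] [Algebra K E] [Algebra K' E] [Algebra F E]
    [IsScalarTower K K' E] [IsScalarTower K F E] [FiniteDimensional F E] [IsGalois F E]
    [Normal K K'] (hspan : Submodule.span F (Set.range (algebraMap K' E)) = ⊤)
    (hF : ∀ z : F, IsIntegral K z → ∃ c, algebraMap K F c = z) (h : E)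
    (hinj : Function.Injective (aeval h : K'[X] →ₐ[K'] E))
    (hyint : ∀ (y : E) (P Q : K'[X]), 0 < P.natDegree → aeval y P = aeval h Q →
      ∃ Q' : K'[X], y = aeval h Q')
    (a : F) (P₀ : K'[X]) (hP₀ : 0 < P₀.natDegree) (ha : algebraMap F E a = aeval h P₀) :
    ∃ f : F, (∃ Q : K'[X], algebraMap F E f = aeval h Q) ∧
      ∀ (b : F) (Q : K'[X]), algebraMap F E b = aeval h Q → ∃ P : K[X], b = aeval f P := by
  classical
  let τ : (E ≃ₐ[F] E) → (K' →+* K') := fun σ ↦ (σ.restrictScalars K).restrictNormal K'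
  have hτ : ∀ σ c, algebraMap K' E (τ σ c) = σ (algebraMap K' E c) := fun σ c ↦
    (σ.restrictScalars K).restrictNormal_commutes K' c
  have hσ : ∀ (σ : E ≃ₐ[F] E) (y : E) (Q : K'[X]),
      σ (aeval y Q) = aeval (σ y) (Q.map (τ σ)) := by
    intro σ y Q
    rw [aeval_def, aeval_def, eval₂_map]
    refine (hom_eval₂ Q (algebraMap K' E) (σ : E →+* E) y).trans ?_
    congr 1
    ext c
    exact (hτ σ c).symm
  have hP : ∀ σ : E ≃ₐ[F] E, ∃ Q : K'[X], σ h = aeval h Q := by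
    intro σ
    refine hyint (σ h) (P₀.map (τ σ)) P₀ (by rwa [natDegree_map]) ?_
    rw [← hσ, ← ha, σ.commutes]
  choose P hP using hP
  have hdeg : ∀ σ, (P σ).natDegree = 1 := by
    intro σ
    have h1 : aeval h (((P σ).map (τ σ⁻¹)).comp (P σ⁻¹)) = aeval h (X : K'[X]) := by
      rw [aeval_comp, ← hP, ← hσ, ← hP, aeval_X]
      exact σ.symm_apply_apply h
    have h2 := congrArg natDegree (hinj h1)
    rw [natDegree_comp, natDegree_map, natDegree_X] at h2
    exact Nat.eq_one_of_mul_eq_one_right h2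
  obtain ⟨ω, hω⟩ : ∃ ω : K', ∑ σ : E ≃ₐ[F] E, τ σ ω * (P σ).coeff 1 ≠ 0 := by
    by_contra! h0
    have hli := (linearIndependent_toLinearMap F E E).comp
      (fun σ : E ≃ₐ[F] E ↦ (σ : E →ₐ[F] E)) (fun _ _ h ↦ AlgEquiv.coe_toAlgHom_injective h)
    rw [Fintype.linearIndependent_iff] at hli
    have h1 := hli (fun σ ↦ algebraMap K' E ((P σ).coeff 1)) (by
      refine LinearMap.ext_on_range hspan fun c ↦ ?_
      have h2 := congrArg (algebraMap K' E) (h0 c)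
      simpa [hτ, mul_comm, Algebra.smul_def] using h2) 1
    rw [map_eq_zero, ← hdeg 1, coeff_natDegree, leadingCoeff_eq_zero] at h1
    have := hdeg 1
    rw [h1] at this
    simp at this
  let Q : K'[X] := ∑ σ : E ≃ₐ[F] E, C (τ σ ω) * P σ
  have hQ1 : Q.coeff 1 ≠ 0 := by simpa [Q, finsetSum_coeff] using hω
  have hQdeg : Q.natDegree ≤ 1 := by
    refine natDegree_sum_le_of_forall_le _ _ fun σ _ ↦ ?_
    exact (natDegree_C_mul_le _ _).trans (hdeg σ).le
  let f : F := Algebra.trace F E (algebraMap K' E ω * h)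
  have hf : algebraMap F E f = aeval h Q := by
    rw [trace_eq_sum_automorphisms]
    simp [Q, hτ, hP]
  refine ⟨f, ⟨Q, hf⟩, fun b Z hb ↦ ?_⟩
  let Q' : K'[X] := C (Q.coeff 1)⁻¹ * (X - C (Q.coeff 0))
  have hQ' : Q'.comp Q = X := by
    have h1 : Q = C (Q.coeff 1) * X + C (Q.coeff 0) := eq_X_add_C_of_natDegree_le_one hQdeg
    simp only [Q', mul_comp, sub_comp, C_comp, X_comp]
    nth_rw 2 [h1]
    rw [add_sub_cancel_right, ← mul_assoc, ← C_mul, inv_mul_cancel₀ hQ1, C_1, one_mul]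
  have hcomp : ∀ Z : K'[X], aeval (algebraMap F E f) Z = aeval h (Z.comp Q) := by
    intro Z
    rw [hf, aeval_comp]
  have hinj' : Function.Injective (aeval (algebraMap F E f) : K'[X] →ₐ[K'] E) := by
    rw [injective_iff_map_eq_zero]
    intro Z hZ
    rw [hcomp] at hZ
    have h1 := hinj (hZ.trans (map_zero _).symm)
    rcases comp_eq_zero_iff.1 h1 with h2 | ⟨-, h2⟩
    · exact h2
    · rw [h2] at hQ1
      simp at hQ1
  let Z' := Z.comp Q'
  have hbZ : algebraMap F E b = aeval (algebraMap F E f) Z' := by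
    rw [hcomp, comp_assoc, hQ', comp_X, hb]
  have hfix : ∀ σ, Z'.map (τ σ) = Z' := by
    intro σ
    apply hinj'
    rw [← hbZ, ← σ.commutes b, hbZ, hσ, σ.commutes]
  have hcoeff : ∀ n, ∃ c : K, algebraMap K K' c = Z'.coeff n := by
    intro n
    have h1 : algebraMap K' E (Z'.coeff n) ∈ (⊥ : IntermediateField F E) := by
      rw [IsGalois.mem_bot_iff_fixed]
      intro σ
      rw [← hτ]
      conv_rhs => rw [← hfix σ, coeff_map]
    obtain ⟨z, hz⟩ := IntermediateField.mem_bot.1 h1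
    have h2 : IsIntegral K z := by
      rw [← isIntegral_algebraMap_iff (algebraMap F E).injective, hz]
      exact (Algebra.IsIntegral.isIntegral (R := K) (Z'.coeff n)).algebraMap
    obtain ⟨c, rfl⟩ := hF z h2
    refine ⟨c, (algebraMap K' E).injective ?_⟩
    rw [← hz, ← IsScalarTower.algebraMap_apply, ← IsScalarTower.algebraMap_apply]
  obtain ⟨W, hW⟩ : ∃ W : K[X], W.map (algebraMap K K') = Z' := by
    rw [← Polynomial.mem_lifts, Polynomial.lifts_iff_coeff_lifts]
    exact fun n ↦ hcoeff n
  refine ⟨W, (algebraMap F E).injective ?_⟩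
  rw [hbZ, ← hW, aeval_map_algebraMap, aeval_algebraMap_apply]

lemma Polynomial.exists_algebraMap_eq_of_aeval_eq {K : Type*} [Field K] (y : RatFunc K)
    (P q : K[X]) (hP : 0 < P.natDegree) (hy : aeval y P = algebraMap K[X] (RatFunc K) q) :
    ∃ x : K[X], algebraMap K[X] (RatFunc K) x = y := by
  refine IsIntegrallyClosed.isIntegral_iff.1 ?_
  have hP0 : P ≠ 0 := by
    rintro rfl
    simp at hP
  have h1 : (P * C P.leadingCoeff⁻¹).natDegree = P.natDegree := by
    rw [natDegree_mul_C]
    exact inv_ne_zero (leadingCoeff_ne_zero.2 hP0)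
  refine IsIntegral.of_aeval_monic (p := (P * C P.leadingCoeff⁻¹).map C)
    ((monic_mul_leadingCoeff_inv hP0).map _) ?_ ?_
  · rw [natDegree_map, h1]
    exact hP.ne'
  · have h2 : aeval y ((P * C P.leadingCoeff⁻¹).map (C : K →+* K[X])) =
        algebraMap K[X] (RatFunc K) (q * C P.leadingCoeff⁻¹) := by
      have h3 := aeval_map_algebraMap K[X] y (P * C P.leadingCoeff⁻¹)
      rw [algebraMap_eq] at h3
      rw [h3, map_mul, hy, map_mul, aeval_C]
      rfl
    rw [h2]
    exact isIntegral_algebraMap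

theorem exists_forall_exists_eq_aeval_of_algHom_ratFunc {K K' F : Type*} [Field K] [CharZero K]
    [Field K'] [Field F] [Algebra K K'] [Algebra K F] [FiniteDimensional K K'] [IsGalois K K']
    (hF : ∀ z : F, IsIntegral K z → ∃ c, algebraMap K F c = z) (ψ : F →ₐ[K] RatFunc K')
    (a : F) (p : K'[X]) (hp : 0 < p.natDegree) (ha : ψ a = algebraMap K'[X] (RatFunc K') p) :
    ∃ f : F, (∃ q : K'[X], ψ f = algebraMap K'[X] (RatFunc K') q) ∧
      ∀ (b : F) (q : K'[X]), ψ b = algebraMap K'[X] (RatFunc K') q →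
        ∃ P : K[X], b = aeval f P := by
  let _ : Algebra F (RatFunc K') := ψ.toRingHom.toAlgebra
  have : IsScalarTower K F (RatFunc K') := IsScalarTower.of_algebraMap_eq fun x ↦ by
    exact (ψ.commutes x).symm
  obtain ⟨g, hg, hgK⟩ := IsGalois.is_separable_splitting_field K K'
  have hsplit : ((g.map (algebraMap K F)).map (algebraMap F (RatFunc K'))).Splits := by
    rw [map_map, ← IsScalarTower.algebraMap_eq, IsScalarTower.algebraMap_eq K K' (RatFunc K'),
      ← map_map]
    exact hgK.splits.map _
  let E := IntermediateField.adjoin F ((g.map (algebraMap K F)).rootSet (RatFunc K'))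
  have hE : (g.map (algebraMap K F)).IsSplittingField F E :=
    IntermediateField.adjoin_rootSet_isSplittingField hsplit
  have : FiniteDimensional F E := hE.finiteDimensional _ _
  have : IsGalois F E := IsGalois.of_separable_splitting_field (p := g.map (algebraMap K F)) hg.map
  have hroot : algebraMap K' (RatFunc K') '' g.rootSet K' ⊆
      (g.map (algebraMap K F)).rootSet (RatFunc K') := by
    classical
    rw [hgK.splits.image_rootSet_algebraMap, rootSet, rootSet, aroots_map]
  have hK'E : ∀ x : K', algebraMap K' (RatFunc K') x ∈ E := by
    intro x
    have h1 : x ∈ Algebra.adjoin K (g.rootSet K') := by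
      rw [hgK.adjoin_rootSet]
      trivial
    have h2 : Algebra.adjoin K (g.rootSet K') ≤ (E.toSubalgebra.restrictScalars K).comap
        (IsScalarTower.toAlgHom K K' (RatFunc K')) :=
      Algebra.adjoin_le fun y hy ↦ IntermediateField.subset_adjoin F _ (hroot ⟨y, hy, rfl⟩)
    exact h2 h1
  let κ : K' →ₐ[K] E := AlgHom.codRestrict (IsScalarTower.toAlgHom K K' (RatFunc K'))
    (E.toSubalgebra.restrictScalars K) hK'E
  let _ : Algebra K' E := κ.toRingHom.toAlgebra
  have : IsScalarTower K K' E := IsScalarTower.of_algebraMap_eq fun x ↦ (κ.commutes x).symm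
  have : IsScalarTower K' E (RatFunc K') := IsScalarTower.of_algebraMap_eq fun x ↦ rfl
  have hspan : Submodule.span F (Set.range (algebraMap K' E)) = ⊤ := by
    classical
    rw [eq_top_iff, ← Algebra.top_toSubmodule, ← hE.adjoin_rootSet, Algebra.adjoin_eq_span]
    refine Submodule.span_mono ?_
    have h1 : Submonoid.closure ((g.map (algebraMap K F)).rootSet E) ≤
        MonoidHom.mrange (algebraMap K' E : K' →* E) := by
      rw [Submonoid.closure_le, rootSet, aroots_map, ← rootSet,
        ← hgK.splits.image_rootSet_algebraMap (B := E)]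
      rintro _ ⟨y, -, rfl⟩
      exact ⟨y, rfl⟩
    exact h1
  let E' : IntermediateField K' (RatFunc K') :=
    { E.toSubfield with algebraMap_mem' := hK'E }
  have hFE : ∀ x : F, ψ x ∈ E := fun x ↦ E.algebraMap_mem x
  obtain ⟨h, hh, hEh, hcomp⟩ := exists_polynomial_luroth_generator E' p hp
    (by rw [← ha]; exact hFE a)
  let hE : E := ⟨algebraMap K'[X] (RatFunc K') h, by
    have h1 := IntermediateField.mem_adjoin_simple_self K' (algebraMap K'[X] (RatFunc K') h)
    rw [← hEh] at h1
    exact h1⟩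
  have hval : ∀ Q : K'[X], (aeval hE Q : E).1 = algebraMap K'[X] (RatFunc K') (Q.comp h) := by
    intro Q
    have h1 := aeval_algebraMap_apply (RatFunc K') hE Q
    refine h1.symm.trans ?_
    rw [show algebraMap E (RatFunc K') hE = algebraMap K'[X] (RatFunc K') h from rfl,
      aeval_algebraMap_apply, Polynomial.comp, aeval_def, algebraMap_eq]
  have hmem : ∀ (y : E) (q : K'[X]), y.1 = algebraMap K'[X] (RatFunc K') q →
      ∃ Q : K'[X], y = aeval hE Q := by
    intro y q hy
    obtain ⟨Q, rfl⟩ := hcomp q (by rw [← hy]; exact y.2)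
    exact ⟨Q, Subtype.ext (hy.trans (hval Q).symm)⟩
  obtain ⟨P₀, hP₀⟩ := hmem (algebraMap F E a) p ha
  have hval' := hval P₀
  rw [← hP₀] at hval'
  obtain ⟨f, ⟨Q, hfQ⟩, hf⟩ := exists_forall_exists_eq_aeval_of_isGalois (K := K) (K' := K')
    (F := F) (E := E) hspan hF hE (by
      rw [injective_iff_map_eq_zero]
      intro Q hQ
      have h1 := hval Q
      rw [hQ] at h1
      rcases comp_eq_zero_iff.1 (IsFractionRing.injective K'[X] (RatFunc K')
        (h1.symm.trans (map_zero _).symm)) with h2 | ⟨-, h2⟩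
      · exact h2
      · rw [h2] at hh
        simp at hh) (by
      intro y P Q hP hy
      have h1 := congrArg Subtype.val hy
      rw [hval] at h1
      obtain ⟨x, hx⟩ := exists_algebraMap_eq_of_aeval_eq y.1 P _ hP
        ((aeval_algebraMap_apply (RatFunc K') y P).trans h1)
      exact hmem y x hx.symm) a P₀ (by
      have h1 := IsFractionRing.injective K'[X] (RatFunc K') (ha.symm.trans hval')
      rw [h1, natDegree_comp] at hp
      exact Nat.pos_of_mul_pos_right hp) hP₀
  refine ⟨f, ⟨Q.comp h, by rw [← hval, ← hfQ]; rfl⟩, fun b q hb ↦ ?_⟩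
  obtain ⟨Q', hQ'⟩ := hmem (algebraMap F E b) q hb
  exact hf b Q' hQ'

end Descent

section Generators

open Polynomial IntermediateField

lemma Subalgebra.isIntegrallyClosed_of_forall_isAlgebraic {R B : Type*} [CommRing R] [CommRing B]
    [IsDomain B] [Algebra R B] [IsIntegrallyClosed B] (A : Subalgebra R B)
    (hA : ∀ b : B, IsAlgebraic A b → b ∈ A) : IsIntegrallyClosed A := by
  let E := FractionRing B
  let F := FractionRing A
  rw [isIntegrallyClosed_iff F]
  intro x hx
  obtain ⟨p, q, hq, rfl⟩ := IsFractionRing.div_surjective (A := A) x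
  have hq0 : q ≠ 0 := nonZeroDivisors.ne_zero hq
  have hinj : Function.Injective (Algebra.ofId A E) := fun x y h ↦
    Subtype.ext (IsFractionRing.injective B E (a₁ := (x : B)) (a₂ := (y : B)) h)
  let j : F →ₐ[A] E := IsFractionRing.liftAlgHom hinj
  have h0 : IsIntegral A (j (algebraMap A F p / algebraMap A F q)) := hx.map j
  have h1 : IsIntegral B (j (algebraMap A F p / algebraMap A F q)) := h0.tower_top
  obtain ⟨b, hb⟩ := IsIntegrallyClosed.isIntegral_iff.1 h1
  have h2 : (q : B) * b = p := by
    apply IsFractionRing.injective B E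
    rw [map_mul, hb, map_div₀, AlgHom.commutes, AlgHom.commutes]
    refine mul_div_cancel₀ _ ?_
    exact (map_ne_zero_iff _ (IsFractionRing.injective B E)).2 (fun h ↦ hq0 (Subtype.ext h))
  have h3 : b ∈ A := hA b ⟨C q * X - C p, fun h ↦ hq0 (by
    have := congrArg (fun f ↦ coeff f 1) h
    simpa [coeff_C] using this), by
    simp only [map_sub, map_mul, aeval_C, aeval_X]
    exact sub_eq_zero.2 h2⟩
  refine ⟨⟨b, h3⟩, ?_⟩
  rw [eq_div_iff ((map_ne_zero_iff _ (IsFractionRing.injective A F)).2 hq0), ← map_mul]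
  congr 1
  exact Subtype.ext ((mul_comm _ _).trans h2)

lemma exists_integral_primitive_element {k R A : Type*} [Field k] [CharZero k] [CommRing R]
    [CommRing A] [IsDomain A] [IsIntegrallyClosed A] [Algebra k R] [Algebra R A] [Algebra k A]
    [IsScalarTower k R A] (a : A)
    (halg : Algebra.IsAlgebraic (Algebra.adjoin R {a}) A) (c : A) (hc : c ≠ 0) (G : Finset A)
    (hG : ∀ b : A, ∃ N, c ^ N * b ∈ Algebra.adjoin R (G : Set A)) :
    ∃ w : A, IsIntegral (Algebra.adjoin R {a}) w ∧
      ∀ b : A, ∃ s ∈ Algebra.adjoin R {a, w}, ∃ t ∈ Algebra.adjoin R {a, w},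
        s ≠ 0 ∧ s * b = t := by
  classical
  let F := FractionRing A
  have hAF : Function.Injective (algebraMap A F) := IsFractionRing.injective A F
  let S₁ := Algebra.adjoin R {a}
  let K₁ : IntermediateField k F := adjoin k (algebraMap A F '' S₁)
  let i : S₁ →+* K₁ := ((algebraMap A F).comp S₁.subtype).codRestrict K₁.toSubring
    fun x ↦ subset_adjoin k _ ⟨x, x.2, rfl⟩
  let _ : Algebra S₁ K₁ := i.toAlgebra
  have : IsScalarTower S₁ K₁ F := IsScalarTower.of_algebraMap_eq fun x ↦ rfl
  have hi : Function.Injective (algebraMap S₁ K₁) := fun x y h ↦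
    Subtype.ext (hAF (congrArg Subtype.val h))
  have hFalg : ∀ x : F, IsAlgebraic S₁ x := by
    intro x
    obtain ⟨p, q, hq, rfl⟩ := IsFractionRing.div_surjective (A := A) x
    rw [div_eq_mul_inv]
    exact ((halg.isAlgebraic p).algebraMap).mul ((halg.isAlgebraic q).algebraMap).inv
  have hFint : ∀ x : F, IsIntegral K₁ x := fun x ↦
    ((hFalg x).extendScalars hi).isIntegral
  have htop : adjoin K₁ (algebraMap A F '' (insert c G : Finset A)) = ⊤ := by
    rw [eq_top_iff]
    intro x _
    obtain ⟨p, q, hq, rfl⟩ := IsFractionRing.div_surjective (A := A) x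
    have h1 : ∀ b : A, algebraMap A F b ∈
        adjoin K₁ (algebraMap A F '' (insert c G : Finset A)) := by
      intro b
      obtain ⟨N, hN⟩ := hG b
      have h2 : ∀ y ∈ Algebra.adjoin R (G : Set A), algebraMap A F y ∈
          adjoin K₁ (algebraMap A F '' (insert c G : Finset A)) := by
        intro y hy
        induction hy using Algebra.adjoin_induction with
        | mem y hy => exact subset_adjoin K₁ _ ⟨y, by simp [Finset.mem_coe.1 hy], rfl⟩
        | algebraMap r =>
          have h3 : algebraMap A F (algebraMap R A r) ∈ K₁ :=
            subset_adjoin k _ ⟨_, S₁.algebraMap_mem r, rfl⟩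
          exact (adjoin K₁ _).algebraMap_mem (⟨_, h3⟩ : K₁)
        | add y z _ _ hy hz => rw [map_add]; exact add_mem hy hz
        | mul y z _ _ hy hz => rw [map_mul]; exact mul_mem hy hz
      have h3 := h2 _ hN
      have hcmem : algebraMap A F c ∈ adjoin K₁ (algebraMap A F '' (insert c G : Finset A)) :=
        subset_adjoin K₁ _ ⟨c, by simp, rfl⟩
      have h4 : algebraMap A F b = algebraMap A F (c ^ N * b) / algebraMap A F c ^ N := by
        rw [map_mul, map_pow, mul_div_cancel_left₀]
        exact pow_ne_zero _ ((map_ne_zero_iff _ hAF).2 hc)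
      rw [h4]
      exact div_mem h3 (pow_mem hcmem N)
    exact div_mem (h1 p) (h1 q)
  have : FiniteDimensional K₁ F := by
    have h1 : FiniteDimensional K₁ (adjoin K₁ (algebraMap A F '' (insert c G : Finset A))) :=
      finiteDimensional_adjoin fun x _ ↦ hFint x
    rw [htop] at h1
    exact Module.Finite.equiv (topEquiv (F := K₁) (E := F)).toLinearEquiv
  obtain ⟨α, hα⟩ := Field.exists_primitive_element K₁ F
  obtain ⟨y, hy0, hy⟩ := (hFalg α).exists_integral_multiple
  obtain ⟨w, hw⟩ := IsIntegrallyClosed.isIntegral_iff.1 (hy.tower_top (A := A))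
  refine ⟨w, ?_, ?_⟩
  · rw [← hw] at hy
    exact (isIntegral_algebraMap_iff hAF).1 hy
  · let S := Algebra.adjoin R {a, w}
    let T : IntermediateField k F := adjoin k (algebraMap A F '' S)
    have hS₁S : S₁ ≤ S := Algebra.adjoin_mono (by simp)
    have hKT : K₁ ≤ T := adjoin.mono k _ _ (Set.image_mono hS₁S)
    have hαT : α ∈ extendScalars hKT := by
      rw [mem_extendScalars]
      have hy' : algebraMap A F (y : A) ≠ 0 :=
        (map_ne_zero_iff _ hAF).2 fun h ↦ hy0 (Subtype.ext h)
      have h1 : α = algebraMap A F w / algebraMap A F y := by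
        rw [hw, eq_div_iff hy', mul_comm, Algebra.smul_def]
        rfl
      rw [h1]
      exact div_mem (subset_adjoin k _ ⟨w, Algebra.subset_adjoin (by simp), rfl⟩)
        (subset_adjoin k _ ⟨y, hS₁S y.2, rfl⟩)
    have hT : ∀ x : F, x ∈ T := by
      intro x
      have h1 : x ∈ K₁⟮α⟯ := by rw [hα]; trivial
      exact (adjoin_simple_le_iff.2 hαT) h1
    have hadj : ∀ x ∈ Algebra.adjoin k (algebraMap A F '' S), ∃ s ∈ S, algebraMap A F s = x := by
      intro x hx
      have h1 : Algebra.adjoin k (algebraMap A F '' S) ≤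
          (S.restrictScalars k).map (IsScalarTower.toAlgHom k A F) :=
        Algebra.adjoin_le fun x hx ↦ hx
      exact h1 hx
    intro b
    obtain ⟨r, hr, s, hs, hrs⟩ := mem_adjoin_iff_div.1 (hT (algebraMap A F b))
    obtain ⟨t, ht, rfl⟩ := hadj r hr
    obtain ⟨v, hv, rfl⟩ := hadj s hs
    by_cases hs0 : v = 0
    · have hb : b = 0 := by
        rw [hs0, map_zero, div_zero] at hrs
        exact hAF (hrs.trans (map_zero _).symm)
      exact ⟨1, one_mem _, 0, zero_mem _, one_ne_zero, by rw [hb, mul_zero]⟩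
    · refine ⟨v, hv, t, ht, hs0, hAF ?_⟩
      rw [map_mul, hrs, mul_div_cancel₀]
      exact (map_ne_zero_iff _ hAF).2 hs0

end Generators

section FunctionField

open Polynomial

lemma exists_monic_eval₂_eq_zero {R A : Type*} [CommRing R] [CommRing A] [Algebra R A] {a w : A}
    (hw : IsIntegral (Algebra.adjoin R {a}) w) :
    ∃ P : R[X][X], P.Monic ∧ P.eval₂ (aeval a : R[X] →ₐ[R] A).toRingHom w = 0 := by
  obtain ⟨P, hP, hPw⟩ := hw
  let f : R[X] →ₐ[R] Algebra.adjoin R {a} :=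
    aeval ⟨a, Algebra.self_mem_adjoin_singleton R a⟩
  have hf : ∀ x : R[X], (f x : A) = aeval a x := fun x ↦
    (aeval_algHom_apply (Algebra.adjoin R {a}).val _ x).symm
  have hlift : P ∈ lifts (f : R[X] →+* Algebra.adjoin R {a}) := by
    rw [lifts_iff_coeff_lifts]
    intro n
    obtain ⟨x, hx⟩ := (Algebra.adjoin_singleton_eq_range_aeval R a).le (P.coeff n).2
    exact ⟨x, Subtype.ext ((hf x).trans hx)⟩
  obtain ⟨Q, hQ, -, hQm⟩ := lifts_and_natDegree_eq_and_monic hlift hP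
  refine ⟨Q, hQm, ?_⟩
  rw [← hQ, eval₂_map] at hPw
  rw [← hPw]
  congr 1
  ext x
  · simp [← hf]
  · simp [f]

lemma injective_of_transcendental {R S D : Type*} [CommRing R] [CommRing S] [IsDomain S]
    [CommRing D] [Algebra R S] [Algebra R D] (a : S)
    (halg : Algebra.IsAlgebraic (Algebra.adjoin R {a}) S) (g : S →ₐ[R] D)
    (hg : Transcendental R (g a)) : Function.Injective g := by
  rw [injective_iff_map_eq_zero]
  intro x hx
  by_contra hx0
  obtain ⟨r, hr0, y, hy⟩ := (halg.isAlgebraic x).exists_nonzero_dvd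
    (mem_nonZeroDivisors_of_ne_zero hx0)
  obtain ⟨ρ, hρ⟩ := (Algebra.adjoin_singleton_eq_range_aeval R a).le r.2
  have hρ' : aeval a ρ = (r : S) := hρ
  have h1 : aeval (g a) ρ = 0 := by
    rw [aeval_algHom_apply, hρ']
    have : (r : S) = x * y := hy
    rw [this, map_mul, hx, zero_mul]
  rw [transcendental_iff.1 hg ρ h1, map_zero] at hρ'
  exact hr0 (Subtype.ext hρ'.symm)

lemma exists_map_eq_C_mul {R K : Type*} [CommRing R] [IsDomain R] [Field K] [Algebra R K]
    [IsFractionRing R K] (P : K[X]) :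
    ∃ r : R, r ≠ 0 ∧ ∃ Q : R[X], Q.map (algebraMap R K) = C (algebraMap R K r) * P := by
  obtain ⟨r, hr, h⟩ := IsLocalization.integerNormalization_spec (nonZeroDivisors R) P
  exact ⟨r, nonZeroDivisors.ne_zero hr, _, by rw [h, ← smul_eq_C_mul, algebraMap_smul]⟩

variable {k R B : Type u} [Field k] [CommRing R] [Algebra k R] [CommRing B]
    [Algebra k B] [Algebra R B] [IsScalarTower k R B]

lemma PlaneFamily.exists_mul_eq_algebraMap_of_isIntegral [CharZero k] [IsAlgClosed k]
    [IsDomain R] [IsDomain B] [Algebra.FiniteType k R] [Algebra.FiniteType k B]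
    (β : PlaneFamily k R B) {b : B} (hb : IsIntegral R b) :
    ∃ u v : R, v ≠ 0 ∧ algebraMap R B v * b = algebraMap R B u := by
  let E := FractionRing B
  let K := FractionRing R
  have hRB := β.injective_algebraMap
  have : FaithfulSMul R E := (faithfulSMul_iff_algebraMap_injective R E).2 (by
    rw [IsScalarTower.algebraMap_eq R B E]
    exact (IsFractionRing.injective B E).comp hRB)
  let _ : Algebra K E := FractionRing.liftAlgebra R E
  have : IsScalarTower R K E := FractionRing.isScalarTower_liftAlgebra R E
  obtain ⟨z, hz⟩ := β.exists_algebraMap_eq_of_isIntegral K E hb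
  obtain ⟨u, v, hv, rfl⟩ := IsFractionRing.div_surjective (A := R) z
  have hv0 := nonZeroDivisors.ne_zero hv
  refine ⟨u, v, hv0, IsFractionRing.injective B E ?_⟩
  rw [map_mul, ← hz, map_div₀, ← IsScalarTower.algebraMap_apply, ← IsScalarTower.algebraMap_apply,
    ← IsScalarTower.algebraMap_apply, ← IsScalarTower.algebraMap_apply, mul_div_cancel₀]
  exact (map_ne_zero_iff _ (FaithfulSMul.algebraMap_injective R E)).2 hv0

lemma PlaneFamily.exists_algebraMap_eq_of_isIntegral_fractionRing [CharZero k] [IsAlgClosed k]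
    [IsDomain R] [IsDomain B] [Algebra.FiniteType k R] [Algebra.FiniteType k B]
    (β : PlaneFamily k R B) (A : Subalgebra R B) [IsIntegrallyClosed A] (K F : Type*) [Field K]
    [Algebra R K] [IsFractionRing R K] [Field F] [Algebra A F] [IsFractionRing A F]
    [Algebra R F] [IsScalarTower R A F] [Algebra K F] [IsScalarTower R K F] (z : F)
    (hz : IsIntegral K z) : ∃ c, algebraMap K F c = z := by
  obtain ⟨y, hy⟩ := hz.exists_multiple_integral_of_isLocalization (nonZeroDivisors R) z
  have hy0 := nonZeroDivisors.ne_zero y.2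
  obtain ⟨b, hb⟩ := IsIntegrallyClosed.isIntegral_iff.1 (hy.tower_top (A := A))
  have hAF : Function.Injective (algebraMap A F) := IsFractionRing.injective A F
  have hRF : Function.Injective (algebraMap R F) := by
    rw [IsScalarTower.algebraMap_eq R K F]
    exact (algebraMap K F).injective.comp (IsFractionRing.injective R K)
  have hbR : IsIntegral R (b : B) := by
    rw [← hb] at hy
    exact ((isIntegral_algebraMap_iff hAF).1 hy).map A.val
  obtain ⟨u, v, hv, huv⟩ := β.exists_mul_eq_algebraMap_of_isIntegral hbR
  have h1 : algebraMap R A v * b = algebraMap R A u := Subtype.ext huv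
  have h2 := congrArg (algebraMap A F) h1
  rw [map_mul, hb, ← IsScalarTower.algebraMap_apply, ← IsScalarTower.algebraMap_apply,
    Submonoid.smul_def, Algebra.smul_def] at h2
  refine ⟨algebraMap R K u / (algebraMap R K v * algebraMap R K y), ?_⟩
  rw [map_div₀, map_mul, ← IsScalarTower.algebraMap_apply, ← IsScalarTower.algebraMap_apply,
    ← IsScalarTower.algebraMap_apply, ← h2, ← mul_assoc, mul_div_cancel_left₀]
  exact mul_ne_zero ((map_ne_zero_iff _ hRF).2 hv) ((map_ne_zero_iff _ hRF).2 hy0)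

end FunctionField

section RationalGenerator

open Polynomial

section

variable {R A : Type*} [CommRing R] [IsDomain R] [CommRing A] [IsDomain A] [Algebra R A]
    (K F : Type*) [Field K] [Algebra R K] [IsFractionRing R K] [Field F] [Algebra A F]
    [IsFractionRing A F] [Algebra R F] [IsScalarTower R A F] [Algebra K F] [IsScalarTower R K F]

lemma exists_isIntegral_smul_of_aeval_eq {a : A} (ha : Transcendental R a) (f : F) (P : K[X])
    (hP : algebraMap A F a = aeval f P) : ∃ r : R, r ≠ 0 ∧ IsIntegral A (r • f) := by
  have hAF : Function.Injective (algebraMap A F) := IsFractionRing.injective A F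
  have hRF : Function.Injective (algebraMap R F) := by
    rw [IsScalarTower.algebraMap_eq R K F]
    exact (algebraMap K F).injective.comp (IsFractionRing.injective R K)
  have hRA : Function.Injective (algebraMap R A) := by
    rw [IsScalarTower.algebraMap_eq R A F, RingHom.coe_comp] at hRF
    exact hRF.of_comp
  obtain ⟨r, hr, Q, hQ⟩ := exists_map_eq_C_mul (R := R) P
  have haQ : algebraMap A F (algebraMap R A r * a) = aeval f Q := by
    rw [← aeval_map_algebraMap K, hQ, map_mul (aeval f), aeval_C, ← hP, map_mul,
      ← IsScalarTower.algebraMap_apply, ← IsScalarTower.algebraMap_apply]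
  have hdeg : Q.natDegree ≠ 0 := by
    intro h0
    rw [eq_C_of_natDegree_eq_zero h0, aeval_C, IsScalarTower.algebraMap_apply R A F] at haQ
    refine ha ⟨C r * X - C (Q.coeff 0), fun h ↦ hr ?_, ?_⟩
    · simpa [coeff_C] using congrArg (fun f ↦ coeff f 1) h
    · simp only [map_sub, map_mul, aeval_C, aeval_X]
      exact sub_eq_zero.2 (hAF haQ)
  have hdeg' : (Q.map (algebraMap R A)).natDegree = Q.natDegree :=
    natDegree_map_eq_of_injective hRA Q
  refine ⟨Q.leadingCoeff, leadingCoeff_ne_zero.2 fun h ↦ hdeg (by simp [h]), ?_⟩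
  have h1 := isIntegral_leadingCoeff_smul
    (Q.map (algebraMap R A) - C (algebraMap R A r * a)) f (by
      rw [map_sub, aeval_map_algebraMap, aeval_C, haQ, sub_self])
  rw [leadingCoeff_sub_of_degree_lt, leadingCoeff_map_of_injective hRA, algebraMap_smul] at h1
  · exact h1
  · exact degree_C_le.trans_lt (natDegree_pos_iff_degree_pos.1 (by omega))

lemma exists_rational_generator_of_aeval_eq [IsIntegrallyClosed A] {a w : A}
    (ha : Transcendental R a)
    (hS : ∀ b : A, ∃ s ∈ Algebra.adjoin R {a, w}, ∃ t ∈ Algebra.adjoin R {a, w},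
      s ≠ 0 ∧ s * b = t) (f : F) (P Q : K[X])
    (hP : algebraMap A F a = aeval f P) (hQ : algebraMap A F w = aeval f Q) :
    ∃ f : A, Transcendental R f ∧
      ∀ b : A, ∃ s t : R[X], s ≠ 0 ∧ aeval f s * b = aeval f t := by
  have hAF : Function.Injective (algebraMap A F) := IsFractionRing.injective A F
  have hRF : Function.Injective (algebraMap R F) := by
    rw [IsScalarTower.algebraMap_eq R K F]
    exact (algebraMap K F).injective.comp (IsFractionRing.injective R K)
  obtain ⟨r, hr, hrf⟩ := exists_isIntegral_smul_of_aeval_eq K F ha f P hP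
  obtain ⟨f₁, hf₁⟩ := IsIntegrallyClosed.isIntegral_iff.1 hrf
  have hff : f = aeval (algebraMap A F f₁) (C (algebraMap R K r)⁻¹ * X : K[X]) := by
    rw [map_mul, aeval_C, aeval_X, hf₁, map_inv₀, ← IsScalarTower.algebraMap_apply,
      Algebra.smul_def, inv_mul_cancel_left₀]
    exact (map_ne_zero_iff _ hRF).2 hr
  have hcomp : ∀ T : K[X], aeval f T =
      aeval (algebraMap A F f₁) (T.comp (C (algebraMap R K r)⁻¹ * X)) := by
    intro T
    rw [aeval_comp, ← hff]
  refine ⟨f₁, fun hf ↦ ha ?_, fun b ↦ ?_⟩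
  · have h1 : IsAlgebraic K (algebraMap A F f₁) :=
      (IsFractionRing.isAlgebraic_iff R K F).1 hf.algebraMap
    have h2 : IsAlgebraic K (aeval (algebraMap A F f₁)
        (P.comp (C (algebraMap R K r)⁻¹ * X))) :=
      IsIntegral.isAlgebraic
        (adjoin_le_integralClosure h1.isIntegral (aeval_mem_adjoin_singleton K _))
    rw [← hcomp, ← hP, ← IsFractionRing.isAlgebraic_iff R K F] at h2
    exact (isAlgebraic_algebraMap_iff hAF).1 h2
  · have key : ∀ s ∈ Algebra.adjoin R {a, w}, ∃ T : K[X],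
        algebraMap A F s = aeval (algebraMap A F f₁) T := by
      intro s hs
      induction hs using Algebra.adjoin_induction with
      | mem x hx =>
        rcases hx with rfl | rfl
        · exact ⟨_, hP.trans (hcomp P)⟩
        · exact ⟨_, hQ.trans (hcomp Q)⟩
      | algebraMap x =>
        refine ⟨C (algebraMap R K x), ?_⟩
        rw [aeval_C, ← IsScalarTower.algebraMap_apply, ← IsScalarTower.algebraMap_apply]
      | add x y _ _ hx hy =>
        obtain ⟨T, hT⟩ := hx
        obtain ⟨U, hU⟩ := hy
        exact ⟨T + U, by rw [map_add, map_add, hT, hU]⟩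
      | mul x y _ _ hx hy =>
        obtain ⟨T, hT⟩ := hx
        obtain ⟨U, hU⟩ := hy
        exact ⟨T * U, by rw [map_mul, map_mul, hT, hU]⟩
    obtain ⟨s, hs, t, ht, hs0, hst⟩ := hS b
    obtain ⟨T, hT⟩ := key s hs
    obtain ⟨U, hU⟩ := key t ht
    obtain ⟨x, hx, T', hT'⟩ := exists_map_eq_C_mul (R := R) T
    obtain ⟨y, hy, U', hU'⟩ := exists_map_eq_C_mul (R := R) U
    have e1 : aeval (algebraMap A F f₁) T' = algebraMap R F x * algebraMap A F s := by
      rw [← aeval_map_algebraMap K, hT', map_mul, aeval_C, hT, ← IsScalarTower.algebraMap_apply]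
    have e2 : aeval (algebraMap A F f₁) U' = algebraMap R F y * algebraMap A F t := by
      rw [← aeval_map_algebraMap K, hU', map_mul, aeval_C, hU, ← IsScalarTower.algebraMap_apply]
    rw [aeval_algebraMap_apply] at e1 e2
    refine ⟨C y * T', C x * U', ?_, hAF ?_⟩
    · intro h0
      have h1 := congrArg (aeval f₁) h0
      rw [map_mul, aeval_C, map_zero] at h1
      have h2 := congrArg (algebraMap A F) h1
      rw [map_mul, e1, map_zero, ← IsScalarTower.algebraMap_apply] at h2
      have hx' := (map_ne_zero_iff _ hRF).2 hx
      have hy' := (map_ne_zero_iff _ hRF).2 hy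
      have hs' := (map_ne_zero_iff _ hAF).2 hs0
      exact mul_ne_zero hy' (mul_ne_zero hx' hs') h2
    · simp only [map_mul, aeval_C, e1, e2, ← hst, ← IsScalarTower.algebraMap_apply]
      ring

end

variable {k R B : Type u} [Field k] [CommRing R] [Algebra k R] [CommRing B]
    [Algebra k B] [Algebra R B] [IsScalarTower k R B]

set_option maxHeartbeats 1000000 in
lemma PlaneFamily.exists_rational_generator [CharZero k] [IsAlgClosed k]
    [IsDomain R] [IsDomain B] [Algebra.FiniteType k R] [Algebra.FiniteType k B]
    (β : PlaneFamily k R B) (A : Subalgebra R B) [IsIntegrallyClosed A]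
    (htr : Algebra.trdeg R A = 1) (c : A) (hc : c ≠ 0) (G : Finset A)
    (hG : ∀ b : A, ∃ N, c ^ N * b ∈ Algebra.adjoin R (G : Set A)) :
    ∃ f : A, Transcendental R f ∧
      ∀ b : A, ∃ s t : R[X], s ≠ 0 ∧ aeval f s * b = aeval f t := by
  have hRB := β.injective_algebraMap
  have hRA : Function.Injective (algebraMap R A) := fun x y h ↦ hRB (congrArg Subtype.val h)
  obtain ⟨a, ha⟩ := exists_transcendental_of_trdeg_eq_one htr
  have halg := isAlgebraic_adjoin_of_trdeg_eq_one htr ha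
  obtain ⟨w, hw, hS⟩ := exists_integral_primitive_element (k := k) a halg c hc G hG
  obtain ⟨P, hP, hPw⟩ := exists_monic_eval₂_eq_zero hw
  let K := FractionRing R
  let F := FractionRing A
  have hAF : Function.Injective (algebraMap A F) := IsFractionRing.injective A F
  have hRF : Function.Injective (algebraMap R F) := by
    rw [IsScalarTower.algebraMap_eq R A F]
    exact hAF.comp hRA
  have : FaithfulSMul R F := (faithfulSMul_iff_algebraMap_injective R F).2 hRF
  let _ : Algebra K F := FractionRing.liftAlgebra R F
  have : IsScalarTower R K F := FractionRing.isScalarTower_liftAlgebra R F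
  have : CharZero K := charZero_of_injective_algebraMap (R := k)
    (((algebraMap R K).comp (algebraMap k R)).injective)
  obtain ⟨L, hfin, hgal, p, q, hp, hΘ⟩ := β.exists_parametrization K (a : B) (w : B)
    (fun h ↦ ha ((isAlgebraic_algHom_iff A.val Subtype.val_injective).1 h)) P hP (by
      have h1 := congrArg A.val hPw
      rw [map_zero] at h1
      rw [← h1]
      refine Eq.trans ?_ (hom_eval₂ P _ (A.val : A →+* B) w).symm
      congr 1
      ext x
      · simp
      · simp)
  let φ : MvPolynomial (Fin 2) R →ₐ[R] A := MvPolynomial.aeval ![a, w]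
  have hval : A.val.comp φ = MvPolynomial.aeval ![(a : B), (w : B)] := by
    ext i
    fin_cases i <;> simp [φ]
  let g := AlgHom.liftOfSurjective φ.rangeRestrict φ.rangeRestrict_surjective
    (MvPolynomial.aeval ![p, q]) (fun Θ h ↦ by
      refine hΘ Θ ?_
      have h0 : A.val (φ Θ) = 0 := congrArg (fun x : φ.range ↦ ((x : A) : B)) h
      rw [← h0, ← hval]; rfl)
  have hg : ∀ Θ, g (φ.rangeRestrict Θ) = MvPolynomial.aeval ![p, q] Θ :=
    AlgHom.liftOfSurjective_apply _ _ _ _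
  let aS : φ.range := φ.rangeRestrict (MvPolynomial.X 0)
  have haS : (aS : A) = a := by simp [aS, φ]
  have hgp : g aS = p := by simp [aS, hg]
  have hpt : Transcendental R p := by
    have h1 : Transcendental L p := transcendental p hp.ne'
      (mem_nonZeroDivisors_of_ne_zero (leadingCoeff_ne_zero.2 fun h ↦ by simp [h] at hp))
    refine h1.restrictScalars ?_
    rw [IsScalarTower.algebraMap_eq R K L]
    exact (algebraMap K L).injective.comp (IsFractionRing.injective R K)
  have hS1 : Algebra.trdeg R φ.range = 1 := by
    refine le_antisymm (htr ▸ trdeg_le_of_injective φ.range.val Subtype.val_injective) ?_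
    rw [Cardinal.one_le_iff_ne_zero, trdeg_ne_zero_iff, Algebra.transcendental_def]
    exact ⟨aS, fun h ↦ ha (haS ▸ h.algHom φ.range.val)⟩
  have hginj : Function.Injective g := by
    refine injective_of_transcendental aS (isAlgebraic_adjoin_of_trdeg_eq_one hS1 ?_) g
      (hgp ▸ hpt)
    exact fun h ↦ ha (haS ▸ h.algHom φ.range.val)
  have hrange : Algebra.adjoin R {a, w} ≤ φ.range := by
    refine Algebra.adjoin_le ?_
    rintro x (rfl | rfl)
    · exact ⟨MvPolynomial.X 0, by simp [φ]⟩
    · exact ⟨MvPolynomial.X 1, by simp [φ]⟩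
  have : FaithfulSMul φ.range F := (faithfulSMul_iff_algebraMap_injective _ F).2
    fun x y h ↦ Subtype.ext (hAF h)
  have : IsFractionRing φ.range F := by
    refine IsFractionRing.of_field _ _ fun z ↦ ?_
    obtain ⟨x, y, hy, rfl⟩ := IsFractionRing.div_surjective (A := A) z
    have hy0 := (map_ne_zero_iff _ hAF).2 (nonZeroDivisors.ne_zero hy)
    obtain ⟨s, hs, t, ht, hs0, hst⟩ := hS x
    obtain ⟨s', hs', t', ht', hs0', hst'⟩ := hS y
    have e0 := (map_ne_zero_iff _ hAF).2 hs0
    have e0' := (map_ne_zero_iff _ hAF).2 hs0'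
    refine ⟨⟨t * s', hrange (mul_mem ht hs')⟩, ⟨t' * s, hrange (mul_mem ht' hs)⟩, ?_⟩
    change _ = algebraMap A F (t * s') / algebraMap A F (t' * s)
    rw [← hst, ← hst', map_mul, map_mul, map_mul, map_mul]
    rw [div_eq_div_iff hy0 (mul_ne_zero (mul_ne_zero e0' hy0) e0)]
    ring
  have hlift : Function.Injective
      ((algebraMap L[X] (RatFunc L)).comp (g : φ.range →+* L[X])) :=
    (IsFractionRing.injective L[X] (RatFunc L)).comp hginj
  let ψ₀ : F →+* RatFunc L := IsFractionRing.lift hlift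
  have hψ₀ : ∀ x : φ.range, ψ₀ (algebraMap A F x) = algebraMap L[X] (RatFunc L) (g x) :=
    fun x ↦ IsFractionRing.lift_algebraMap hlift x
  have hψR : (ψ₀.comp (algebraMap K F)).comp (algebraMap R K) =
      (algebraMap K (RatFunc L)).comp (algebraMap R K) := by
    ext r
    have h1 := hψ₀ (algebraMap R φ.range r)
    rw [AlgHom.commutes, ← IsScalarTower.algebraMap_apply] at h1
    exact (congrArg ψ₀ (IsScalarTower.algebraMap_apply R K F r).symm).trans
      (h1.trans (IsScalarTower.algebraMap_apply R K (RatFunc L) r))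
  let ψ : F →ₐ[K] RatFunc L := AlgHom.mk ψ₀ fun x ↦ DFunLike.congr_fun
    (IsLocalization.ringHom_ext (nonZeroDivisors R) hψR) x
  have hψ : ∀ x : φ.range, ψ (algebraMap A F x) = algebraMap L[X] (RatFunc L) (g x) := hψ₀
  obtain ⟨f, -, hf⟩ := exists_forall_exists_eq_aeval_of_algHom_ratFunc
    (β.exists_algebraMap_eq_of_isIntegral_fractionRing A K F) ψ (algebraMap A F a) p hp (by
      rw [← hgp, ← hψ, haS])
  obtain ⟨P₁, hP₁⟩ := hf (algebraMap A F a) p (by rw [← hgp, ← hψ, haS])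
  obtain ⟨Q₁, hQ₁⟩ := hf (algebraMap A F w) (g ⟨w, hrange (Algebra.subset_adjoin (by simp))⟩)
    (by rw [← hψ])
  exact exists_rational_generator_of_aeval_eq K F ha hS f P₁ Q₁ hP₁ hQ₁

end RationalGenerator

section PolynomialGenerator

open Polynomial

lemma Polynomial.exists_isCoprime_cofactors {R : Type*} [CommRing R] [IsDomain R] (s t : R[X])
    (hs : s ≠ 0) : ∃ (c ρ : R) (g q p u v : R[X]), c ≠ 0 ∧ ρ ≠ 0 ∧ g ≠ 0 ∧
      C c * s = g * q ∧ C c * t = g * p ∧ q * u + p * v = C ρ := by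
  classical
  let K := FractionRing R
  have hRK : Function.Injective (algebraMap R K) := IsFractionRing.injective R K
  have hmap : Function.Injective (map (algebraMap R K)) := map_injective _ hRK
  let γ := EuclideanDomain.gcd (s.map (algebraMap R K)) (t.map (algebraMap R K))
  obtain ⟨q', hq'⟩ : γ ∣ s.map (algebraMap R K) := EuclideanDomain.gcd_dvd_left _ _
  obtain ⟨p', hp'⟩ : γ ∣ t.map (algebraMap R K) := EuclideanDomain.gcd_dvd_right _ _
  have hs' : s.map (algebraMap R K) ≠ 0 := (Polynomial.map_ne_zero_iff hRK).2 hs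
  have hγ : γ ≠ 0 := left_ne_zero_of_mul (hq' ▸ hs')
  obtain ⟨u', v', huv⟩ : ∃ u' v', q' * u' + p' * v' = 1 := by
    have h1 := EuclideanDomain.gcd_eq_gcd_ab (s.map (algebraMap R K)) (t.map (algebraMap R K))
    refine ⟨EuclideanDomain.gcdA (s.map (algebraMap R K)) (t.map (algebraMap R K)),
      EuclideanDomain.gcdB (s.map (algebraMap R K)) (t.map (algebraMap R K)),
      mul_left_cancel₀ hγ ?_⟩
    rw [mul_one, mul_add, ← mul_assoc, ← mul_assoc, ← hq', ← hp']
    exact h1.symm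
  obtain ⟨a, ha, g, hg⟩ := exists_map_eq_C_mul (R := R) γ
  obtain ⟨b, hb, q, hq⟩ := exists_map_eq_C_mul (R := R) q'
  obtain ⟨c, hc, p, hp⟩ := exists_map_eq_C_mul (R := R) p'
  obtain ⟨d, hd, u, hu⟩ := exists_map_eq_C_mul (R := R) u'
  obtain ⟨e, he, v, hv⟩ := exists_map_eq_C_mul (R := R) v'
  refine ⟨a * b * c, b * c * d * e, g, C c * q, C b * p, C e * u, C d * v, ?_, ?_, ?_, ?_, ?_, ?_⟩
  · exact mul_ne_zero (mul_ne_zero ha hb) hc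
  · exact mul_ne_zero (mul_ne_zero (mul_ne_zero hb hc) hd) he
  · rintro rfl
    rw [Polynomial.map_zero, zero_eq_mul, C_eq_zero, map_eq_zero_iff _ hRK] at hg
    exact hg.elim ha hγ
  · apply hmap
    simp only [Polynomial.map_mul, map_C, hg, hq, hq', map_mul]
    ring
  · apply hmap
    simp only [Polynomial.map_mul, map_C, hg, hp, hp', map_mul]
    ring
  · apply hmap
    simp only [Polynomial.map_mul, Polynomial.map_add, map_C, hq, hp, hu, hv, map_mul]
    linear_combination (C (algebraMap R K b) * C (algebraMap R K c) * C (algebraMap R K d) *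
      C (algebraMap R K e)) * huv

variable {k R B : Type u} [Field k] [CommRing R] [Algebra k R] [CommRing B]
    [Algebra k B] [Algebra R B] [IsScalarTower k R B]

lemma PlaneFamily.fib_aeval (β : PlaneFamily k R B) (ε : R →ₐ[k] k) (f : B) (q : R[X]) :
    β.fib ε (aeval f q) = aeval (β.fib ε f) (q.map (ε : R →+* k)) := by
  induction q using Polynomial.induction_on' with
  | add p q hp hq => rw [map_add, map_add, Polynomial.map_add, map_add, hp, hq]
  | monomial n r =>
    rw [aeval_monomial, map_monomial, aeval_monomial, map_mul, map_pow, β.fib_algebraMap]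
    rfl

/-- A rational generator is a generator after inverting elements of the base. -/
lemma PlaneFamily.exists_smul_mem_adjoin [IsAlgClosed k] [IsDomain R]
    [Algebra.FiniteType k R] [IsDomain B] [Algebra.FiniteType k B] (β : PlaneFamily k R B)
    {f b : B} (hf : Transcendental R f) {s t : R[X]} (hs : s ≠ 0)
    (hst : aeval f s * b = aeval f t) :
    ∃ r : R, r ≠ 0 ∧ r • b ∈ Algebra.adjoin R {f} := by
  obtain ⟨c, ρ, g, q, p, u, v, hc, hρ, hg, hq, hp, huv⟩ := s.exists_isCoprime_cofactors t hs
  have hg' : aeval f g ≠ 0 := fun h ↦ hg (transcendental_iff.1 hf g h)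
  have hqb : aeval f q * b = aeval f p := by
    apply mul_left_cancel₀ hg'
    rw [← mul_assoc, ← map_mul, ← map_mul, ← hq, ← hp, map_mul, map_mul, mul_assoc, hst]
  have hunit : aeval f q * (aeval f u + b * aeval f v) = algebraMap R B ρ := by
    rw [← aeval_C f ρ, ← huv, map_add, map_mul, map_mul, ← hqb]
    ring
  have hq0 : q ≠ 0 := by
    rintro rfl
    rw [mul_zero, mul_eq_zero, C_eq_zero] at hq
    exact hq.elim hc hs
  obtain ⟨r₀, hr₀, hind⟩ := β.exists_forall_algebraicIndependent (fun _ : Unit ↦ f)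
    (algebraicIndependent_unique_type_iff.2 hf)
  obtain ⟨ε, hε⟩ := exists_algHom_apply_ne_zero (k := k) (ρ * q.leadingCoeff * r₀)
    (mul_ne_zero (mul_ne_zero hρ (leadingCoeff_ne_zero.2 hq0)) hr₀)
  rw [map_mul, map_mul] at hε
  have hfε : Transcendental k (β.fib ε f) :=
    algebraicIndependent_unique_type_iff.1 (hind ε (right_ne_zero_of_mul hε))
  have hεq : ε q.leadingCoeff ≠ 0 := right_ne_zero_of_mul (left_ne_zero_of_mul hε)
  have hερ : ε ρ ≠ 0 := left_ne_zero_of_mul (left_ne_zero_of_mul hε)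
  have hu : IsUnit (aeval (β.fib ε f) (q.map (ε : R →+* k))) := by
    have h1 := congrArg (β.fib ε) hunit
    rw [map_mul, β.fib_algebraMap, β.fib_aeval] at h1
    exact isUnit_of_mul_isUnit_left (h1 ▸ (isUnit_iff_ne_zero.2 hερ).map MvPolynomial.C)
  obtain ⟨l, -, hl⟩ := MvPolynomial.isUnit_iff_eq_C_of_isReduced.1 hu
  have hqC : q.map (ε : R →+* k) = C l := by
    refine sub_eq_zero.1 (transcendental_iff.1 hfε _ ?_)
    rw [map_sub, hl, aeval_C, MvPolynomial.algebraMap_eq, sub_self]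
  have hdeg : q.natDegree = 0 := by
    have h1 := natDegree_map_of_leadingCoeff_ne_zero (ε : R →+* k) hεq
    rw [← h1, hqC, natDegree_C]
  refine ⟨q.coeff 0, fun h ↦ hq0 ?_, ?_⟩
  · rw [eq_C_of_natDegree_eq_zero hdeg, h, C_0]
  · rw [Algebra.smul_def, ← aeval_C f, ← eq_C_of_natDegree_eq_zero hdeg, hqb]
    exact aeval_mem_adjoin_singleton R f

end PolynomialGenerator

section LocalGenerator

open Polynomial

variable {k R B : Type u} [Field k] [CommRing R] [Algebra k R] [CommRing B]
    [Algebra k B] [Algebra R B] [IsScalarTower k R B]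

lemma IsLocalParameter.exists_dvd_mul_of_mem_map {ε : R →ₐ[k] k} {t : R}
    (ht : IsLocalParameter ε t) {x : B} (hx : x ∈ (RingHom.ker ε).map (algebraMap R B)) :
    ∃ w, ε w ≠ 0 ∧ algebraMap R B t ∣ algebraMap R B w * x := by
  induction hx using Submodule.span_induction with
  | mem x hx =>
    obtain ⟨y, hy, rfl⟩ := hx
    obtain ⟨w, hw, h⟩ := ht.2.2 y hy
    exact ⟨w, hw, by rw [← map_mul]; exact map_dvd _ h⟩
  | zero => exact ⟨1, by simp, by simp⟩
  | add x y _ _ hx hy =>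
    obtain ⟨w, hw, h⟩ := hx
    obtain ⟨v, hv, h'⟩ := hy
    refine ⟨w * v, by simp [hw, hv], ?_⟩
    have : algebraMap R B (w * v) * (x + y) = algebraMap R B v * (algebraMap R B w * x) +
      algebraMap R B w * (algebraMap R B v * y) := by rw [map_mul]; ring
    rw [this]
    exact dvd_add (h.mul_left _) (h'.mul_left _)
  | smul a x _ hx =>
    obtain ⟨w, hw, h⟩ := hx
    refine ⟨w, hw, ?_⟩
    rw [smul_eq_mul, mul_left_comm]
    exact h.mul_left _

lemma IsLocalParameter.exists_mul_eq_pow_mul [IsDomain R] [IsNoetherianRing R] {ε : R →ₐ[k] k}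
    {t : R} (ht : IsLocalParameter ε t) {r : R} (hr : r ≠ 0) :
    ∃ (n : ℕ) (w u : R), ε w ≠ 0 ∧ ε u ≠ 0 ∧ w * r = t ^ n * u := by
  classical
  have hprime : (RingHom.ker ε).IsPrime := RingHom.ker_isPrime _
  have hex : ∃ j : ℕ, ¬ ∃ w ∉ RingHom.ker ε, t ^ j ∣ w * r := by
    by_contra! h
    exact hr (eq_zero_of_forall_pow_dvd (RingHom.ker ε) ht.1 h)
  obtain ⟨n, hn⟩ : ∃ n, Nat.find hex = n + 1 := by
    refine Nat.exists_eq_succ_of_ne_zero fun h ↦ ?_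
    refine (Nat.find_eq_zero hex).1 h ⟨1, ?_, by simp⟩
    exact fun h ↦ one_ne_zero ((map_one ε).symm.trans h)
  obtain ⟨w, hw, u, hu⟩ := not_not.1 (Nat.find_min hex (m := n) (by omega))
  refine ⟨n, w, u, hw, fun hu0 ↦ ?_, hu⟩
  obtain ⟨v, hv, y, hy⟩ := ht.2.2 u hu0
  refine Nat.find_spec hex ⟨v * w, fun h ↦ ?_, y, ?_⟩
  · exact (hprime.mem_or_mem h).elim hv hw
  · rw [hn, mul_assoc, hu, mul_left_comm, hy, pow_succ, mul_assoc]

variable [IsDomain B]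

lemma PlaneFamily.exists_smul_mem_adjoin_of_smul_mem (β : PlaneFamily k R B)
    (hinj : Function.Injective (algebraMap R B)) {ε : R →ₐ[k] k} {t : R}
    (ht : IsLocalParameter ε t) {f : B} (hf : Transcendental k (β.fib ε f)) {y : B}
    (hy : t • y ∈ Algebra.adjoin R {f}) : ∃ w, ε w ≠ 0 ∧ w • y ∈ Algebra.adjoin R {f} := by
  obtain ⟨p, hp⟩ := (Algebra.adjoin_singleton_eq_range_aeval R f).le hy
  replace hp : aeval f p = t • y := hp
  have hp0 : p.map (ε : R →+* k) = 0 := by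
    refine transcendental_iff.1 hf _ ?_
    rw [← β.fib_aeval, hp, Algebra.smul_def, map_mul, β.fib_algebraMap, ht.1, map_zero, zero_mul]
  have hc : ∀ d, ∃ w, ε w ≠ 0 ∧ t ∣ w * p.coeff d := fun d ↦ ht.2.2 _ (by
    have := congrArg (fun q ↦ coeff q d) hp0
    simpa [coeff_map] using this)
  choose w₁ hw₁ hd using hc
  obtain ⟨w, hw, hd'⟩ : ∃ w, ε w ≠ 0 ∧ ∀ d, t ∣ w * p.coeff d := by
    refine ⟨∏ d ∈ p.support, w₁ d, ?_, fun d ↦ ?_⟩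
    · rw [map_prod]
      exact Finset.prod_ne_zero_iff.2 fun d _ ↦ hw₁ d
    · by_cases h : d ∈ p.support
      · exact (hd d).trans (mul_dvd_mul_right (Finset.dvd_prod_of_mem _ h) _)
      · simp [notMem_support_iff.1 h]
  obtain ⟨q, hq⟩ : C t ∣ C w * p := by
    rw [C_dvd_iff_dvd_coeff]
    simpa using hd'
  refine ⟨w, hw, ?_⟩
  have h1 : w • y = aeval f q := by
    apply mul_left_cancel₀ ((map_ne_zero_iff _ hinj).2 ht.2.1)
    have h2 := congrArg (aeval f) hq
    rw [map_mul, map_mul, aeval_C, aeval_C, hp, Algebra.smul_def] at h2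
    rw [← h2, Algebra.smul_def]
    ring
  rw [h1]
  exact aeval_mem_adjoin_singleton R f

lemma PlaneFamily.exists_smul_mem_adjoin_of_pow_smul_mem (β : PlaneFamily k R B)
    (hinj : Function.Injective (algebraMap R B)) {ε : R →ₐ[k] k} {t : R}
    (ht : IsLocalParameter ε t) {f : B} (hf : Transcendental k (β.fib ε f)) (n : ℕ) :
    ∀ y : B, t ^ n • y ∈ Algebra.adjoin R {f} →
      ∃ w, ε w ≠ 0 ∧ w • y ∈ Algebra.adjoin R {f} := by
  induction n with
  | zero => exact fun y hy ↦ ⟨1, by simp, by simpa using hy⟩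
  | succ n ih =>
    intro y hy
    rw [pow_succ', mul_smul] at hy
    obtain ⟨w, hw, hwy⟩ := β.exists_smul_mem_adjoin_of_smul_mem hinj ht hf hy
    rw [smul_comm] at hwy
    obtain ⟨v, hv, hvy⟩ := ih _ hwy
    exact ⟨v * w, by simp [hv, hw], by rwa [mul_smul]⟩

lemma PlaneFamily.exists_smul_mem_adjoin_of_transcendental_fib [IsDomain R] [IsNoetherianRing R]
    (β : PlaneFamily k R B)
    (hinj : Function.Injective (algebraMap R B)) {ε : R →ₐ[k] k} {t : R}
    (ht : IsLocalParameter ε t) {f : B} (hf : Transcendental k (β.fib ε f)) {r : R} (hr : r ≠ 0)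
    {y : B} (hy : r • y ∈ Algebra.adjoin R {f}) :
    ∃ w, ε w ≠ 0 ∧ w • y ∈ Algebra.adjoin R {f} := by
  obtain ⟨n, w, u, hw, hu, h⟩ := ht.exists_mul_eq_pow_mul hr
  obtain ⟨v, hv, hvy⟩ := β.exists_smul_mem_adjoin_of_pow_smul_mem hinj ht hf n (u • y) (by
    rw [← mul_smul, ← h, mul_smul]
    exact Subalgebra.smul_mem _ hy w)
  exact ⟨v * u, by simp [hv, hu], by rwa [mul_smul]⟩

/-- An element that is transcendental over the base cannot agree with elements of the base to
arbitrarily high order along a fibre. -/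
lemma PlaneFamily.exists_forall_not_pow_dvd_sub [IsAlgClosed k] [IsDomain R]
    [Algebra.FiniteType k R] [Algebra.FiniteType k B] (β : PlaneFamily k R B) {ε : R →ₐ[k] k}
    {t : R} (ht : IsLocalParameter ε t) {f : B} (hf : Transcendental R f) :
    ∃ j : ℕ, ∀ v c : R, ε v ≠ 0 →
      ¬ algebraMap R B t ^ j ∣ algebraMap R B v * (f - algebraMap R B c) := by
  have : IsNoetherianRing B := Algebra.FiniteType.isNoetherianRing k B
  have hinj := β.injective_algebraMap
  have : FaithfulSMul R B := (faithfulSMul_iff_algebraMap_injective R B).2 hinj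
  by_contra! hcon
  choose v c hv hvc using hcon
  obtain ⟨b, hb⟩ := β.exists_fib_eq_X ε
  have hdep : ¬ AlgebraicIndependent R (fun o : Option (Fin 2) ↦ o.elim f b) := by
    intro h
    have h1 := h.lift_cardinalMk_le_trdeg
    rw [β.trdeg_eq_two ε ht, Cardinal.mk_fintype] at h1
    simp only [Fintype.card_option, Fintype.card_fin, Cardinal.lift_natCast,
      Cardinal.lift_ofNat] at h1
    exact absurd h1 (by norm_cast)
  obtain ⟨H, hH, hH0⟩ : ∃ H : MvPolynomial (Option (Fin 2)) R,
      MvPolynomial.aeval (fun o : Option (Fin 2) ↦ o.elim f b) H = 0 ∧ H ≠ 0 := by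
    rw [AlgebraicIndependent, injective_iff_map_eq_zero] at hdep
    push Not at hdep
    exact hdep
  let G := MvPolynomial.optionEquivRight R (Fin 2) H
  have hG0 : G ≠ 0 := (map_ne_zero_iff _ (MvPolynomial.optionEquivRight R (Fin 2)).injective).2 hH0
  let _ : Algebra R[X] B := (aeval f : R[X] →ₐ[R] B).toRingHom.toAlgebra
  have : IsScalarTower R R[X] B := IsScalarTower.of_algebraMap_eq fun x ↦ (aeval_C f x).symm
  have hG : MvPolynomial.aeval b G = 0 := by
    rw [← hH]
    have h1 : ((MvPolynomial.aeval b : MvPolynomial (Fin 2) R[X] →ₐ[R[X]] B).restrictScalars R).comp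
        (MvPolynomial.optionEquivRight R (Fin 2)).toAlgHom =
        MvPolynomial.aeval (fun o : Option (Fin 2) ↦ o.elim f b) := by
      ext o
      cases o with
      | none =>
        simp
        exact aeval_X f
      | some i => simp
    exact DFunLike.congr_fun h1 H
  obtain ⟨d, hd⟩ := MvPolynomial.ne_zero_iff.1 hG0
  refine hd (transcendental_iff.1 hf _ ?_)
  refine β.eq_zero_of_forall_pow_dvd ε ht.1 fun j ↦ ?_
  have hdiff : ∀ g : R[X], algebraMap R B t ^ j ∣
      algebraMap R B (v j) * (aeval f g - algebraMap R B (g.eval (c j))) := by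
    intro g
    have h1 := sub_dvd_eval_sub f (algebraMap R B (c j)) (g.map (algebraMap R B))
    rw [eval_map_algebraMap, eval_map_algebraMap, aeval_algebraMap_apply, coe_aeval_eq_eval] at h1
    exact (hvc j).trans (mul_dvd_mul_left _ h1)
  obtain ⟨w', hw', hdvd⟩ := β.exists_pow_dvd_coeff hinj ε ht b hb j
    (MvPolynomial.map (evalRingHom (c j)) G) (v j) (hv j) (by
      have h1 : MvPolynomial.aeval b (MvPolynomial.map (evalRingHom (c j)) G) =
          - ∑ d ∈ G.support, (aeval f (G.coeff d) - algebraMap R B ((G.coeff d).eval (c j))) *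
            ∏ i, b i ^ d i := by
        rw [MvPolynomial.aeval_def, MvPolynomial.eval₂_map, MvPolynomial.eval₂_eq']
        rw [MvPolynomial.aeval_def, MvPolynomial.eval₂_eq'] at hG
        simp only [sub_mul, Finset.sum_sub_distrib]
        rw [neg_sub, eq_sub_iff_add_eq]
        have h2 : ∑ d ∈ G.support, aeval f (G.coeff d) * ∏ i, b i ^ d i = 0 := hG
        rw [h2, add_zero]
        rfl
      rw [h1, mul_neg, dvd_neg, Finset.mul_sum, map_pow]
      refine Finset.dvd_sum fun d _ ↦ ?_
      rw [← mul_assoc]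
      exact (hdiff _).mul_right _)
  refine ⟨v j * w', by simp [hv, hw'], ?_⟩
  have h2 := hdvd d
  rw [MvPolynomial.coeff_map, coe_evalRingHom] at h2
  have h3 := map_dvd (algebraMap R B) h2
  rw [map_pow, map_mul] at h3
  have h4 : algebraMap R B (v j * w') * aeval f (G.coeff d) =
      algebraMap R B w' * (algebraMap R B (v j) *
        (aeval f (G.coeff d) - algebraMap R B ((G.coeff d).eval (c j)))) +
      algebraMap R B (v j) * (algebraMap R B w' * algebraMap R B ((G.coeff d).eval (c j))) := by
    rw [map_mul]
    ring
  rw [h4]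
  exact dvd_add ((hdiff _).mul_left _) (h3.mul_left _)

end LocalGenerator

section LocalGenerator

open Polynomial

variable {k R B : Type u} [Field k] [CommRing R] [Algebra k R] [CommRing B]
    [Algebra k B] [Algebra R B] [IsScalarTower k R B]

lemma exists_pow_smul_mem_adjoin {f f' : B} {v c t : R}
    (h : v • f = algebraMap R B (v * c) + t • f') {x : B} (hx : x ∈ Algebra.adjoin R {f}) :
    ∃ N : ℕ, v ^ N • x ∈ Algebra.adjoin R {f'} := by
  induction hx using Algebra.adjoin_induction with
  | mem x hx =>
    obtain rfl : x = f := hx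
    refine ⟨1, ?_⟩
    rw [pow_one, h]
    exact add_mem (Subalgebra.algebraMap_mem _ _)
      (Subalgebra.smul_mem _ (Algebra.self_mem_adjoin_singleton R f') t)
  | algebraMap r => exact ⟨0, Subalgebra.smul_mem _ (Subalgebra.algebraMap_mem _ _) _⟩
  | add x y _ _ hx hy =>
    obtain ⟨N, hN⟩ := hx
    obtain ⟨M, hM⟩ := hy
    refine ⟨N + M, ?_⟩
    have : v ^ (N + M) • (x + y) = v ^ M • (v ^ N • x) + v ^ N • (v ^ M • y) := by
      simp only [Algebra.smul_def, map_pow, pow_add, map_mul]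
      ring
    rw [this]
    exact add_mem (Subalgebra.smul_mem _ hN _) (Subalgebra.smul_mem _ hM _)
  | mul x y _ _ hx hy =>
    obtain ⟨N, hN⟩ := hx
    obtain ⟨M, hM⟩ := hy
    refine ⟨N + M, ?_⟩
    have : v ^ (N + M) • (x * y) = (v ^ N • x) * (v ^ M • y) := by
      simp only [Algebra.smul_def, map_pow, pow_add, map_mul]
      ring
    rw [this]
    exact mul_mem hN hM

/-- Dividing a generic coordinate by the largest possible power of a local parameter, after
subtracting an element of the base, produces an element that stays transcendental in the fibre. -/
lemma PlaneFamily.exists_transcendental_fib [IsAlgClosed k] [IsDomain R] [IsDomain B]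
    [Algebra.FiniteType k R] [Algebra.FiniteType k B] (β : PlaneFamily k R B) {ε : R →ₐ[k] k}
    {t : R} (ht : IsLocalParameter ε t) {f : B} (hf : Transcendental R f) :
    ∃ (f' : B) (v c u : R), v ≠ 0 ∧ u ≠ 0 ∧ v • f = algebraMap R B (v * c) + u • f' ∧
      Transcendental k (β.fib ε f') := by
  classical
  have hinj := β.injective_algebraMap
  obtain ⟨j, hj⟩ : ∃ j : ℕ, ¬ ∃ v c : R, ε v ≠ 0 ∧
      algebraMap R B t ^ j ∣ algebraMap R B v * (f - algebraMap R B c) := by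
    obtain ⟨j, hj⟩ := β.exists_forall_not_pow_dvd_sub ht hf
    exact ⟨j, fun ⟨v, c, hv, h⟩ ↦ hj v c hv h⟩
  have hex : ∃ j : ℕ, ¬ ∃ v c : R, ε v ≠ 0 ∧
      algebraMap R B t ^ j ∣ algebraMap R B v * (f - algebraMap R B c) := ⟨j, hj⟩
  obtain ⟨n, hn⟩ : ∃ n, Nat.find hex = n + 1 := by
    refine Nat.exists_eq_succ_of_ne_zero fun h ↦ ?_
    exact (Nat.find_eq_zero hex).1 h ⟨1, 0, by simp, by simp⟩
  obtain ⟨v, c, hv, f', hf'⟩ := not_not.1 (Nat.find_min hex (m := n) (by omega))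
  refine ⟨f', v, c, t ^ n, fun h ↦ hv (by simp [h]), pow_ne_zero _ ht.2.1, ?_, fun (halg : IsAlgebraic k _) ↦ ?_⟩
  · rw [Algebra.smul_def, Algebra.smul_def, map_mul, map_pow, ← hf']
    ring
  · obtain ⟨l, hl⟩ := _root_.exists_algebraMap_eq_of_isIntegral halg.isIntegral
    replace hl : β.fib ε f' = MvPolynomial.C l := hl.symm
    let l' : R := algebraMap k R (l / ε v)
    have h1 : f' - algebraMap R B (v * l') ∈ (RingHom.ker ε).map (algebraMap R B) := by
      rw [← β.ker_fib, RingHom.mem_ker, map_sub, β.fib_algebraMap, hl, map_mul, AlgHom.commutes,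
        Algebra.algebraMap_self_apply, mul_div_cancel₀ _ hv, sub_self]
    obtain ⟨w, hw, z, hz⟩ := ht.exists_dvd_mul_of_mem_map h1
    refine Nat.find_spec hex ⟨w * v, c + t ^ n * l', by simp [hw, hv], z, ?_⟩
    rw [hn, pow_succ, mul_assoc, ← hz]
    simp only [map_mul, map_add, map_pow]
    linear_combination algebraMap R B w * hf'

end LocalGenerator

section LocalTriviality

open Polynomial

variable {k R B : Type u} [Field k] [CommRing R] [Algebra k R] [CommRing B]
    [Algebra k B] [Algebra R B] [IsScalarTower k R B]

lemma exists_ker_eq_of_isMaximal [IsAlgClosed k] [Algebra.FiniteType k R] (m : Ideal R)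
    (hm : m.IsMaximal) : ∃ ε : R →ₐ[k] k, RingHom.ker ε = m := by
  obtain ⟨ε, hε⟩ := exists_algHom_of_ne_top (k := k) m hm.ne_top
  exact ⟨ε, (hm.eq_of_le (RingHom.ker_ne_top _) hε).symm⟩

lemma algHom_eq_of_ker_le {ε ε' : R →ₐ[k] k} (h : ∀ x, ε x = 0 → ε' x = 0) : ε = ε' := by
  ext x
  have h1 := h (x - algebraMap k R (ε x)) (by simp)
  rw [map_sub, AlgHom.commutes, sub_eq_zero] at h1
  exact h1.symm

lemma exists_notMem_forall_mem [IsDedekindDomain R] (m : Ideal R) [hm : m.IsMaximal] {r : R}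
    (hr : r ≠ 0) : ∃ s ∉ m, ∀ n : Ideal R, n.IsMaximal → n ≠ m → r ∈ n → s ∈ n := by
  classical
  have hfin := Ideal.finite_factors (R := R) (I := Ideal.span {r}) (by simpa using hr)
  have hex : ∀ v : IsDedekindDomain.HeightOneSpectrum R, ∃ s : R, s ∉ m ∧
      (v.asIdeal ≠ m → s ∈ v.asIdeal) := by
    intro v
    by_cases h : v.asIdeal = m
    · exact ⟨1, (Ideal.ne_top_iff_one m).1 hm.ne_top, fun h' ↦ absurd h h'⟩
    · obtain ⟨s, hs, hsm⟩ := SetLike.not_le_iff_exists.1 fun hle ↦ h (v.isMaximal.eq_of_le hm.ne_top hle)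
      exact ⟨s, hsm, fun _ ↦ hs⟩
  choose s hsm hs using hex
  refine ⟨∏ v ∈ hfin.toFinset, s v, fun h ↦ ?_, fun n hn hnm hrn ↦ ?_⟩
  · obtain ⟨v, -, hv⟩ := (hm.isPrime.prod_mem_iff).1 h
    exact hsm v hv
  · let v : IsDedekindDomain.HeightOneSpectrum R :=
      ⟨n, hn.isPrime, fun h ↦ hr (by simpa [h] using hrn)⟩
    refine Ideal.mem_of_dvd n (Finset.dvd_prod_of_mem s (a := v) ?_) (hs v hnm)
    simpa [Ideal.dvd_span_singleton] using hrn

/-- If an element of a subalgebra generates it generically, then around every point of the base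
it can be replaced by one that is also transcendental in the fibre. -/
lemma PlaneFamily.exists_generic_generator [IsAlgClosed k] [IsDomain R] [IsDomain B]
    [Algebra.FiniteType k R] [Algebra.FiniteType k B] (β : PlaneFamily k R B) {ε : R →ₐ[k] k}
    {t : R} (ht : IsLocalParameter ε t) {A : Subalgebra R B}
    (hA : ∀ (r : R) (y : B), r ≠ 0 → r • y ∈ A → y ∈ A) {f : B} (hfA : f ∈ A)
    (hf : Transcendental R f) (hgen : ∀ b ∈ A, ∃ r : R, r ≠ 0 ∧ r • b ∈ Algebra.adjoin R {f}) :
    ∃ f' ∈ A, Transcendental R f' ∧ Transcendental k (β.fib ε f') ∧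
      ∀ b ∈ A, ∃ r : R, r ≠ 0 ∧ r • b ∈ Algebra.adjoin R {f'} := by
  obtain ⟨f', v, c, u, hv, hu, h, hf'⟩ := β.exists_transcendental_fib ht hf
  have hinj := β.injective_algebraMap
  have hgen' : ∀ b ∈ A, ∃ r : R, r ≠ 0 ∧ r • b ∈ Algebra.adjoin R {f'} := by
    intro b hb
    obtain ⟨r, hr, hrb⟩ := hgen b hb
    obtain ⟨N, hN⟩ := exists_pow_smul_mem_adjoin h hrb
    exact ⟨v ^ N * r, mul_ne_zero (pow_ne_zero _ hv) hr, by rwa [mul_smul]⟩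
  refine ⟨f', hA u f' hu ?_, fun halg ↦ ?_, hf', hgen'⟩
  · rw [← sub_eq_iff_eq_add'.2 h]
    exact sub_mem (A.smul_mem hfA v) (A.algebraMap_mem _)
  · obtain ⟨r, hr, hrf⟩ := hgen' f hfA
    have hle : Algebra.adjoin R {f'} ≤ Subalgebra.algebraicClosure R B :=
      Algebra.adjoin_le (Set.singleton_subset_iff.2 halg)
    have h1 : IsAlgebraic R (r • f) := hle hrf
    exact hf (h1.of_smul (mem_nonZeroDivisors_of_ne_zero hr))

/-- Zariski-local triviality of a generically trivial subalgebra of a family of planes. -/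
lemma PlaneFamily.exists_forall_pow_smul_mem_adjoin [IsAlgClosed k] [IsDedekindDomain R]
    [IsDomain B] [Algebra.FiniteType k R] [Algebra.FiniteType k B] (β : PlaneFamily k R B)
    (hpar : ∀ ε : R →ₐ[k] k, ∃ t, IsLocalParameter ε t) (ε : R →ₐ[k] k) {A : Subalgebra R B}
    (hA : ∀ (r : R) (y : B), r ≠ 0 → r • y ∈ A → y ∈ A) {f : B} (hfA : f ∈ A)
    (hf : Transcendental R f) (hgen : ∀ b ∈ A, ∃ r : R, r ≠ 0 ∧ r • b ∈ Algebra.adjoin R {f}) :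
    ∃ g ∈ A, Transcendental R g ∧ Transcendental k (β.fib ε g) ∧ ∃ s : R, ε s ≠ 0 ∧
      ∀ b ∈ A, ∃ N : ℕ, s ^ N • b ∈ Algebra.adjoin R {g} := by
  have hinj := β.injective_algebraMap
  have : IsJacobsonRing R := isJacobsonRing_of_finiteType (A := k)
  obtain ⟨t, ht⟩ := hpar ε
  obtain ⟨g, hgA, hgR, hg, hggen⟩ := β.exists_generic_generator ht hA hfA hf hgen
  obtain ⟨r, hr, hrg⟩ := β.exists_forall_algebraicIndependent (fun _ : Unit ↦ g)
    ((algebraicIndependent_unique_type_iff).2 hgR)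
  have : (RingHom.ker ε).IsMaximal :=
    RingHom.ker_isMaximal_of_surjective ε fun x ↦ ⟨algebraMap k R x, by simp⟩
  obtain ⟨s, hs, hsr⟩ := exists_notMem_forall_mem (RingHom.ker ε) hr
  have hfib : ∀ ε' : R →ₐ[k] k, ε' s ≠ 0 → Transcendental k (β.fib ε' g) := by
    intro ε' hε'
    by_cases hr' : ε' r = 0
    · have hmax : (RingHom.ker ε').IsMaximal :=
        RingHom.ker_isMaximal_of_surjective ε' fun x ↦ ⟨algebraMap k R x, by simp⟩
      have hker : RingHom.ker ε' = RingHom.ker ε :=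
        by_contra fun h ↦ hε' (hsr _ hmax h hr')
      rwa [algHom_eq_of_ker_le (ε := ε') (ε' := ε) fun x hx ↦ hker.le hx]
    · exact (algebraicIndependent_unique_type_iff).1 (hrg ε' hr')
  refine ⟨g, hgA, hgR, hg, s, hs, fun b hb ↦ ?_⟩
  let I : Ideal R := (Subalgebra.toSubmodule (Algebra.adjoin R {g})).comap
    (LinearMap.toSpanSingleton R B b)
  have hI : ∀ w, w ∈ I ↔ w • b ∈ Algebra.adjoin R {g} := fun w ↦ Iff.rfl
  have hsI : s ∈ I.radical := by
    rw [Ideal.radical_eq_jacobson, Ideal.jacobson, Submodule.mem_sInf]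
    rintro J ⟨hIJ, hJ⟩
    obtain ⟨ε', rfl⟩ := exists_ker_eq_of_isMaximal (k := k) J hJ
    by_contra hsJ
    obtain ⟨t', ht'⟩ := hpar ε'
    obtain ⟨r', hr', hrb⟩ := hggen b hb
    obtain ⟨w, hw, hwb⟩ := β.exists_smul_mem_adjoin_of_transcendental_fib hinj ht'
      (hfib ε' hsJ) hr' hrb
    exact hw (hIJ ((hI w).2 hwb))
  obtain ⟨N, hN⟩ := hsI
  exact ⟨N, (hI _).1 hN⟩

end LocalTriviality

section AffineLineBundle

open Polynomial

lemma nonempty_algEquiv_polynomial_away {R A : Type*} [CommRing R] [CommRing A] [Algebra R A]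
    {s : R} {g : A} (hg : Transcendental R g)
    (hs : ∀ b : A, ∃ N : ℕ, s ^ N • b ∈ Algebra.adjoin R {g}) :
    Nonempty (Localization.Away s ⊗[R] A ≃ₐ[Localization.Away s] (Localization.Away s)[X]) := by
  let S := Localization.Away s
  let φ : S ⊗[R] R[X] →ₐ[S] S ⊗[R] A :=
    Algebra.TensorProduct.map (AlgHom.id S S) (aeval g)
  have hinj : Function.Injective φ :=
    Module.Flat.lTensor_preserves_injective_linearMap (M := S) (aeval g : R[X] →ₐ[R] A).toLinearMap
      (transcendental_iff_injective.1 hg)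
  have hsurj : Function.Surjective φ := by
    rw [← AlgHom.range_eq_top, eq_top_iff]
    intro x _
    induction x with
    | zero => exact zero_mem _
    | add x y hx hy => exact add_mem (hx trivial) (hy trivial)
    | tmul l a =>
      obtain ⟨N, hN⟩ := hs a
      obtain ⟨p, hp⟩ := (Algebra.adjoin_singleton_eq_range_aeval R g).le hN
      replace hp : aeval g p = s ^ N • a := hp
      obtain ⟨u, hu⟩ := (IsLocalization.map_units S (⟨s ^ N, N, rfl⟩ : Submonoid.powers s))
      refine ⟨(l * ↑u⁻¹) ⊗ₜ p, ?_⟩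
      change (l * ↑u⁻¹) ⊗ₜ aeval g p = l ⊗ₜ a
      rw [hp, TensorProduct.tmul_smul, TensorProduct.smul_tmul', Algebra.smul_def, ← hu]
      congr 1
      rw [mul_left_comm, Units.mul_inv, mul_one]
  exact ⟨((polyEquivTensor' R S).trans (AlgEquiv.ofBijective φ ⟨hinj, hsurj⟩)).symm⟩

lemma finiteType_of_forall_exists_pow_smul_mem {R A : Type*} [CommRing R] [CommRing A]
    [Algebra R A] (h : ∀ m : Ideal R, m.IsMaximal → ∃ s ∉ m, ∃ g : A,
      ∀ b : A, ∃ N : ℕ, s ^ N • b ∈ Algebra.adjoin R {g}) : Algebra.FiniteType R A := by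
  classical
  let S : Set R := {s | ∃ g : A, ∀ b : A, ∃ N : ℕ, s ^ N • b ∈ Algebra.adjoin R {g}}
  have hS : Ideal.span S = ⊤ := by
    by_contra hne
    obtain ⟨m, hm, hle⟩ := Ideal.exists_le_maximal _ hne
    obtain ⟨s, hsm, hs⟩ := h m hm
    exact hsm (hle (Ideal.subset_span hs))
  obtain ⟨T, hTS, hT⟩ := (Ideal.span_eq_top_iff_finite S).1 hS
  have hex : ∀ s : T, ∃ g : A, ∀ b : A, ∃ N : ℕ, (s : R) ^ N • b ∈ Algebra.adjoin R {g} :=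
    fun s ↦ hTS s.2
  choose g hg using hex
  refine ⟨Finset.univ.image g, eq_top_iff.2 fun b _ ↦ ?_⟩
  let C := Algebra.adjoin R ((Finset.univ.image g : Finset A) : Set A)
  let I : Ideal R := (Subalgebra.toSubmodule C).comap (LinearMap.toSpanSingleton R A b)
  have hI : I.radical = ⊤ := by
    rw [eq_top_iff, ← hT, Ideal.span_le]
    intro s hs
    obtain ⟨N, hN⟩ := hg ⟨s, hs⟩ b
    refine ⟨N, Algebra.adjoin_mono ?_ hN⟩
    simp
  have h1 : (1 : R) ∈ I := by
    rw [Ideal.radical_eq_top.1 hI]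
    trivial
  have h2 : (1 : R) • b ∈ C := h1
  rwa [one_smul] at h2

lemma nonempty_quotient_algEquiv_polynomial {k R A C : Type*} [Field k] [CommRing R] [Algebra k R]
    [CommRing A] [Algebra k A] [Algebra R A] [IsScalarTower k R A] [CommRing C] [Algebra k C]
    {ε : R →ₐ[k] k} {s : R} (hsε : ε s ≠ 0) {g : A}
    (hs : ∀ b : A, ∃ N : ℕ, s ^ N • b ∈ Algebra.adjoin R {g}) (ψ : A →ₐ[k] C)
    (hψ : ∀ r, ε r = 0 → ψ (algebraMap R A r) = 0) (hg : Transcendental k (ψ g)) :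
    Nonempty ((A ⧸ (RingHom.ker ε).map (algebraMap R A)) ≃ₐ[k] k[X]) := by
  let J := (RingHom.ker ε).map (algebraMap R A)
  let π : A →ₐ[k] A ⧸ J := Ideal.Quotient.mkₐ k J
  have hJ : ∀ a ∈ J, ψ a = 0 := by
    have : J ≤ RingHom.ker ψ := Ideal.map_le_iff_le_comap.2 fun r hr ↦ hψ r hr
    exact this
  let χ : k[X] →ₐ[k] A ⧸ J := aeval (π g)
  have hχ : ((Ideal.Quotient.liftₐ J ψ hJ).comp χ) = aeval (ψ g) := by
    ext
    simpa [χ, π] using Ideal.Quotient.lift_mk J (ψ : A →+* C) hJ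
  have hinj : Function.Injective χ := by
    have h1 : Function.Injective ((Ideal.Quotient.liftₐ J ψ hJ).comp χ) := by
      rw [hχ]
      exact transcendental_iff_injective.1 hg
    rw [AlgHom.coe_comp] at h1
    exact h1.of_comp
  have hπ : ∀ r : R, π (algebraMap R A r) = algebraMap k (A ⧸ J) (ε r) := by
    intro r
    have h1 : π (algebraMap R A (r - algebraMap k R (ε r))) = 0 :=
      Ideal.Quotient.eq_zero_iff_mem.2 (Ideal.mem_map_of_mem _ (by simp [RingHom.mem_ker]))
    rw [map_sub, map_sub, ← IsScalarTower.algebraMap_apply k R A, AlgHom.commutes,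
      sub_eq_zero] at h1
    exact h1
  have hadj : ∀ x ∈ Algebra.adjoin R {g}, π x ∈ χ.range := by
    intro x hx
    induction hx using Algebra.adjoin_induction with
    | mem x hx => exact ⟨X, by simp [χ, Set.mem_singleton_iff.1 hx]⟩
    | algebraMap r =>
      rw [hπ]
      exact Subalgebra.algebraMap_mem _ _
    | add x y _ _ hx hy => rw [map_add]; exact add_mem hx hy
    | mul x y _ _ hx hy => rw [map_mul]; exact mul_mem hx hy
  have hsurj : Function.Surjective χ := by
    intro x
    obtain ⟨b, rfl⟩ := Ideal.Quotient.mkₐ_surjective k J x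
    obtain ⟨N, hN⟩ := hs b
    have h1 := χ.range.smul_mem (hadj _ hN) ((ε s ^ N)⁻¹)
    rw [Algebra.smul_def (s ^ N), map_mul, hπ, ← Algebra.smul_def, smul_smul, map_pow,
      inv_mul_cancel₀ (pow_ne_zero _ hsε), one_smul] at h1
    exact h1
  exact ⟨(AlgEquiv.ofBijective χ ⟨hinj, hsurj⟩).symm⟩

lemma ringKrullDim_eq_two_of_quotient {k R A : Type u} [Field k] [IsAlgClosed k] [CommRing R]
    [IsDedekindDomain R] [Algebra k R] [CommRing A] [IsDomain A] [Algebra k A] [Algebra R A]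
    [IsScalarTower k R A] [Algebra.FiniteType k A] (hinj : Function.Injective (algebraMap R A))
    (hR : ¬ IsField R)
    (h : ∀ m : Ideal R, m.IsMaximal → ringKrullDim (A ⧸ m.map (algebraMap R A)) = 1) :
    ringKrullDim A = 2 := by
  have : IsNoetherianRing A := Algebra.FiniteType.isNoetherianRing k A
  apply le_antisymm
  · rw [ringKrullDim_le_iff_isMaximal_height_le]
    intro M hM
    obtain ⟨ψ, hψ⟩ := exists_ker_eq_of_isMaximal (k := k) M hM
    let m := M.under R
    have hm : m.IsMaximal := by
      have : m = RingHom.ker (ψ.comp (IsScalarTower.toAlgHom k R A)) := by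
        ext x
        rw [Ideal.mem_comap, ← hψ]
        rfl
      rw [this]
      exact RingHom.ker_isMaximal_of_surjective _ fun x ↦ ⟨algebraMap k R x, AlgHom.commutes _ x⟩
    have h1 := Ideal.height_le_height_add_of_liesOver m M
    have h2 : m.height ≤ 1 := by
      have h3 := (Ideal.height_le_ringKrullDim_of_ne_top hm.ne_top).trans
        (Ring.krullDimLE_iff.1 (inferInstance : Ring.KrullDimLE 1 R))
      exact_mod_cast h3
    have h3 : (M.map (Ideal.Quotient.mk (m.map (algebraMap R A)))).height ≤ 1 := by
      have h4 := Ideal.height_le_ringKrullDim_of_ne_top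
        (I := M.map (Ideal.Quotient.mk (m.map (algebraMap R A)))) (fun h0 ↦ hM.ne_top (by
          rw [← Ideal.comap_map_mk (I := m.map (algebraMap R A)) (J := M) Ideal.map_comap_le, h0,
            Ideal.comap_top]))
      rw [h m hm] at h4
      exact_mod_cast h4
    have h4 : M.height ≤ 2 := h1.trans ((add_le_add h2 h3).trans (by norm_num))
    have h5 := WithBot.coe_le_coe.2 h4
    exact h5
  · obtain ⟨m, hm⟩ := Ideal.exists_maximal R
    obtain ⟨t, htm, ht⟩ := Submodule.exists_mem_ne_zero_of_ne_bot
      (fun h0 : m = ⊥ ↦ hR (Ring.isField_iff_maximal_bot.2 (h0 ▸ hm)))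
    have h1 := ringKrullDim_quotient_succ_le_of_nonZeroDivisor
      (mem_nonZeroDivisors_of_ne_zero ((map_ne_zero_iff _ hinj).2 ht))
    have h2 := ringKrullDim_le_of_surjective
      (Ideal.Quotient.factor (S := Ideal.span {algebraMap R A t}) (T := m.map (algebraMap R A)) (by
        rw [Ideal.span_singleton_le_iff_mem]
        exact Ideal.mem_map_of_mem _ htm)) (Ideal.Quotient.factor_surjective _)
    rw [h m hm] at h2
    refine le_trans ?_ h1
    calc (2 : WithBot ℕ∞) = 1 + 1 := by norm_num
      _ ≤ _ := by gcongr

end AffineLineBundle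

/-- The family of planes given by identifications of the closed fibres. -/
noncomputable def PlaneFamily.ofAlgEquiv {k R B : Type u} [Field k] [CommRing R] [Algebra k R]
    [CommRing B] [Algebra k B] [Algebra R B]
    (e : ∀ ε : R →ₐ[k] k, (B ⧸ Ideal.map (algebraMap R B) (RingHom.ker ε)) ≃ₐ[k]
      MvPolynomial (Fin 2) k) : PlaneFamily k R B where
  fib ε := (e ε).toAlgHom.comp (Ideal.Quotient.mkₐ k _)
  surjective_fib ε := (e ε).surjective.comp (Ideal.Quotient.mkₐ_surjective k _)
  ker_fib ε := by
    ext x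
    rw [RingHom.mem_ker]
    exact (map_eq_zero_iff (e ε) (e ε).injective).trans Ideal.Quotient.eq_zero_iff_mem

lemma not_isField_of_quotient_algEquiv {k R B : Type u} [Field k] [CommRing R] [IsDomain R]
    [CommRing B] [Algebra k B] [Algebra R B] (hdim : ringKrullDim B = 3)
    (hfib : ∀ m : Ideal R, m.IsMaximal →
      Nonempty ((B ⧸ Ideal.map (algebraMap R B) m) ≃ₐ[k] MvPolynomial (Fin 2) k)) :
    ¬ IsField R := by
  intro hR
  obtain ⟨e⟩ := hfib ⊥ (Ring.isField_iff_maximal_bot.1 hR)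
  rw [Ideal.map_bot] at e
  rw [ringKrullDim_eq_of_ringEquiv ((RingEquiv.quotientBot B).symm.trans e.toRingEquiv),
    MvPolynomial.ringKrullDim_of_isNoetherianRing, ringKrullDim_eq_zero_of_field, zero_add] at hdim
  rw [Nat.card_fin] at hdim
  exact absurd hdim (by norm_cast)

/-- **Claims 2 and 3 in the proof of Theorem 2.10**: let `R` be the coordinate ring of a
smooth affine curve over an algebraically closed field `k` of characteristic zero, `B` a
regular (= smooth over `k`) affine domain of Krull dimension `3`, smooth over `R`, whose
closed fibers are all planes `k[x,y]`. Let `δ` be a locally nilpotent `R`-derivation of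
`B` which is nonzero on each closed fiber, and `A = Ker δ`. Then `A` is a finitely
generated normal `k`-domain of dimension `2`, it is flat over `R`, every closed fiber
`A ⊗_R R/m` is a polynomial ring `k[x]`, and `Spec A → Spec R` is an `𝔸¹`-bundle in the
Zariski topology. -/
theorem kernel_is_A1_bundle
    (k : Type u) [Field k] [IsAlgClosed k] [CharZero k]
    (R B : Type u) [CommRing R] [IsDedekindDomain R] [Algebra k R] [Algebra.FiniteType k R]
    [CommRing B] [IsDomain B] [Algebra k B] [Algebra.FiniteType k B]
    [Algebra R B] [IsScalarTower k R B]
    [Algebra.Smooth k B] (hdim : ringKrullDim B = 3)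
    [Algebra.Smooth R B]
    (hfib : ∀ m : Ideal R, m.IsMaximal →
      Nonempty ((B ⧸ Ideal.map (algebraMap R B) m) ≃ₐ[k] MvPolynomial (Fin 2) k))
    (δ : Derivation R B B)
    (hLN : ∀ b : B, ∃ n : ℕ, 1 ≤ n ∧ (⇑δ)^[n] b = 0)
    (hnz : ∀ m : Ideal R, m.IsMaximal →
      ∃ b : B, δ b ∉ Ideal.map (algebraMap R B) m) :
    -- (1) `A` is a finitely generated normal `k`-domain of Krull dimension 2
    (IsDomain (δ.kerSubalgebra) ∧ Algebra.FiniteType k (δ.kerSubalgebra) ∧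
      IsIntegrallyClosed (δ.kerSubalgebra) ∧ ringKrullDim (δ.kerSubalgebra) = 2) ∧
    -- (2) `A` is flat over `R`
    Module.Flat R (δ.kerSubalgebra) ∧
    -- (3) every closed fiber `A ⊗_R R/m` is a polynomial ring `k[x]`
    (∀ m : Ideal R, m.IsMaximal →
      Nonempty (((δ.kerSubalgebra) ⧸ Ideal.map (algebraMap R (δ.kerSubalgebra)) m)
        ≃ₐ[k] Polynomial k)) ∧
    -- (4) `Spec A → Spec R` is an `𝔸¹`-bundle in the Zariski topology
    (∀ m : Ideal R, m.IsMaximal → ∃ s : R, s ∉ m ∧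
      Nonempty ((Localization.Away s ⊗[R] (δ.kerSubalgebra))
        ≃ₐ[Localization.Away s] Polynomial (Localization.Away s))) := by
  have hFT : Algebra.FiniteType R B := Algebra.FiniteType.of_restrictScalars_finiteType k R B
  have hBN : IsNoetherianRing B := Algebra.FiniteType.isNoetherianRing k B
  have hmax : ∀ ε : R →ₐ[k] k, (RingHom.ker ε).IsMaximal := fun ε ↦
    RingHom.ker_isMaximal_of_surjective ε fun x ↦ ⟨algebraMap k R x, AlgHom.commutes ε x⟩
  have hR : ¬ IsField R := not_isField_of_quotient_algEquiv hdim hfib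
  obtain ⟨β⟩ : Nonempty (PlaneFamily k R B) :=
    ⟨PlaneFamily.ofAlgEquiv fun ε ↦ (hfib _ (hmax ε)).some⟩
  have hinj := β.injective_algebraMap
  have hpar : ∀ ε : R →ₐ[k] k, ∃ t, IsLocalParameter ε t := by
    intro ε
    have := hmax ε
    obtain ⟨t, htm, ht, h⟩ := exists_uniformizer (RingHom.ker ε) fun h0 ↦
      hR (Ring.isField_iff_maximal_bot.2 (h0 ▸ this))
    exact ⟨t, htm, ht, h⟩
  obtain ⟨m₀, hm₀⟩ := Ideal.exists_maximal R
  obtain ⟨ε₀, -⟩ := exists_ker_eq_of_isMaximal (k := k) m₀ hm₀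
  obtain ⟨t₀, ht₀⟩ := hpar ε₀
  have h0 : ∃ b, δ b ≠ 0 := by
    obtain ⟨b, hb⟩ := hnz m₀ hm₀
    exact ⟨b, fun h ↦ hb (h ▸ zero_mem _)⟩
  let A := δ.kerSubalgebra
  have hcharB : CharZero B := charZero_of_injective_algebraMap (algebraMap k B).injective
  have hBic : IsIntegrallyClosed B := isIntegrallyClosed_of_smooth k B
  have hAic : IsIntegrallyClosed A := A.isIntegrallyClosed_of_forall_isAlgebraic
    fun b hb ↦ δ.mem_kerSubalgebra_of_isAlgebraic hb
  obtain ⟨c, hc, G, hG⟩ := δ.exists_finset_pow_mul_mem_adjoin hLN h0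
  have htr : Algebra.trdeg R A = 1 := β.trdeg_subalgebra ε₀ ht₀ A (δ.trdeg_kerSubalgebra hLN h0)
  obtain ⟨f, hf, hfgen⟩ := β.exists_rational_generator A htr c hc G hG
  have hval : Function.Injective A.val := Subtype.val_injective
  have hfB : Transcendental R (f : B) := fun h ↦ hf ((isAlgebraic_algHom_iff A.val hval).1 h)
  have hgen : ∀ b ∈ A, ∃ r : R, r ≠ 0 ∧ r • b ∈ Algebra.adjoin R {(f : B)} := by
    intro b hb
    obtain ⟨s, t, hs, h⟩ := hfgen ⟨b, hb⟩
    refine β.exists_smul_mem_adjoin hfB hs (t := t) ?_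
    have h1 := congrArg A.val h
    rwa [map_mul, ← Polynomial.aeval_algHom_apply, ← Polynomial.aeval_algHom_apply] at h1
  have hA : ∀ (r : R) (y : B), r ≠ 0 → r • y ∈ A → y ∈ A := by
    intro r y hr hy
    rw [δ.mem_kerSubalgebra] at hy ⊢
    rw [Derivation.map_smul, Algebra.smul_def] at hy
    exact (mul_eq_zero.1 hy).resolve_left ((map_ne_zero_iff _ hinj).2 hr)
  have hloc : ∀ ε : R →ₐ[k] k, ∃ g : A, Transcendental R g ∧ Transcendental k (β.fib ε g) ∧
      ∃ s : R, ε s ≠ 0 ∧ ∀ b : A, ∃ N : ℕ, s ^ N • b ∈ Algebra.adjoin R {g} := by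
    intro ε
    obtain ⟨g, hgA, hg, hgε, s, hs, h⟩ :=
      β.exists_forall_pow_smul_mem_adjoin hpar ε hA f.2 hfB hgen
    refine ⟨⟨g, hgA⟩, fun h ↦ hg ((isAlgebraic_algHom_iff A.val hval).2 h), hgε, s, hs,
      fun b ↦ ?_⟩
    obtain ⟨N, hN⟩ := h b b.2
    obtain ⟨p, hp⟩ := (Algebra.adjoin_singleton_eq_range_aeval R g).le hN
    refine ⟨N, ?_⟩
    have h1 : s ^ N • b = Polynomial.aeval (⟨g, hgA⟩ : A) p := by
      apply hval
      rw [← Polynomial.aeval_algHom_apply]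
      exact hp.symm
    rw [h1]
    exact Polynomial.aeval_mem_adjoin_singleton R _
  have hFTA : Algebra.FiniteType R A := by
    refine finiteType_of_forall_exists_pow_smul_mem fun m hm ↦ ?_
    obtain ⟨ε, rfl⟩ := exists_ker_eq_of_isMaximal (k := k) m hm
    obtain ⟨g, -, -, s, hs, h⟩ := hloc ε
    exact ⟨s, hs, g, h⟩
  have hFTk : Algebra.FiniteType k A := Algebra.FiniteType.trans (S := R) inferInstance hFTA
  have hinjA : Function.Injective (algebraMap R A) := by
    have h : ⇑(algebraMap R B) = A.val ∘ algebraMap R A := rfl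
    exact Function.Injective.of_comp (h ▸ hinj)
  have hquot : ∀ m : Ideal R, m.IsMaximal →
      Nonempty ((A ⧸ Ideal.map (algebraMap R A) m) ≃ₐ[k] Polynomial k) := by
    intro m hm
    obtain ⟨ε, rfl⟩ := exists_ker_eq_of_isMaximal (k := k) m hm
    obtain ⟨g, -, hg, s, hs, h⟩ := hloc ε
    refine nonempty_quotient_algEquiv_polynomial hs h
      ((β.fib ε).comp (A.val.restrictScalars k)) (fun r hr ↦ ?_) hg
    exact (β.fib_algebraMap ε r).trans (by rw [hr, map_zero])
  refine ⟨⟨inferInstance, hFTk, hAic, ?_⟩, ?_, hquot, fun m hm ↦ ?_⟩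
  · refine ringKrullDim_eq_two_of_quotient (k := k) hinjA hR fun m hm ↦ ?_
    rw [ringKrullDim_eq_of_ringEquiv (hquot m hm).some.toRingEquiv,
      Polynomial.ringKrullDim_of_isNoetherianRing, ringKrullDim_eq_zero_of_field, zero_add]
  · have : FaithfulSMul R A := (faithfulSMul_iff_algebraMap_injective R A).2 hinjA
    exact inferInstanceAs (Module.Flat R A)
  · obtain ⟨ε, rfl⟩ := exists_ker_eq_of_isMaximal (k := k) m hm
    obtain ⟨g, hg, -, s, hs, h⟩ := hloc ε
    exact ⟨s, hs, nonempty_algEquiv_polynomial_away hg h⟩
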